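/- arXiv:1207.0672 — 8 statements merged into one kernel-verified Lean document; each statement's English description precedes it below -/
import Mathlib

section
/- For every integer k ≥ 2, any finite set of points in ℝ³ can be colored with k colors such that every translate of a given octant containing at least 12^(2^(k-1)+2^(k-2)-2) of the points contains all k colors. Precisely: for every finite S ⊆ ℝ³ there exists c : S → Fin k such that for every a ∈ ℝ³, if |S ∩ O(a)| ≥ 12^(2^(k-1)+2^(k-2)-2) then c takes all k values on S ∩ O(a). -/
/-- The octant with apex `a`. -/
def Octant (a : Fin 3 → ℝ) : Set (Fin 3 → ℝ) :=
  {x | x 0 ≤ a 0 ∧ x 1 ≤ a 1 ∧ x 2 ≤ a 2}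


namespace OctA

variable {α : Type*}

/-- `u`, `v` lie in the same component and have different colors. -/
def E (c : α → Bool) (k : α → α) (u v : α) : Prop := k u = k v ∧ c u ≠ c v

theorem link1 (c : α → Bool) (k : α → α) (a b : α) (hab : k a ≠ k b) :
    ∃ (c' : α → Bool) (k' : α → α), (∀ u v, E c k u v → E c' k' u v) ∧ E c' k' a b ∧
      (∀ u, k u ≠ k a → k' u = k u) ∧
      (∀ p, p ≠ a → p ≠ b → (∀ q, k q = k p → q = p) → ∀ q, k' q = k' p → q = p) := by
  classical
  refine ⟨fun u => if k u = k a then (if c a = c b then !(c u) else c u) else c u,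
    fun u => if k u = k a then k b else k u, ?_, ?_, ?_, ?_⟩
  · rintro u v ⟨h1, h2⟩
    refine ⟨by simp [h1], ?_⟩
    simp only [h1]
    split_ifs <;> simp_all
  · refine ⟨by simp [hab.symm], ?_⟩
    simp only [if_true, if_neg hab.symm]
    split_ifs with h <;> simp_all
  · intro u hu
    simp [hu]
  · intro p hpa hpb h q hq
    have h1 : k p ≠ k a := fun e => hpa (h a e.symm).symm
    have h2 : k b ≠ k p := fun e => hpb (h b e).symm
    simp only [if_neg h1] at hq
    split_ifs at hq with h3
    · exact absurd hq h2
    · exact h q hq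

theorem linkMany (c : α → Bool) (k : α → α) (p : α) (B : Finset α) :
    (∀ t ∈ B, k t ≠ k p) → (∀ t ∈ B, ∀ t' ∈ B, k t = k t' → t = t') →
    ∃ (c' : α → Bool) (k' : α → α), (∀ u v, E c k u v → E c' k' u v) ∧
      (∀ t ∈ B, E c' k' t p) ∧
      (∀ u, (∀ t ∈ B, k u ≠ k t) → k' u = k u) ∧
      (∀ r, r ∉ B → r ≠ p → (∀ q, k q = k r → q = r) → ∀ q, k' q = k' r → q = r) := by
  classical
  induction B using Finset.induction_on with
  | empty =>
    intro _ _
    exact ⟨c, k, fun _ _ h => h, by simp, fun _ _ => rfl, fun r _ _ h => h⟩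
  | insert t B ht ih =>
    intro h1 h2
    obtain ⟨c', k', e1, e2, e3, e4⟩ := ih (fun s hs => h1 s (Finset.mem_insert_of_mem hs))
      (fun s hs s' hs' => h2 s (Finset.mem_insert_of_mem hs) s' (Finset.mem_insert_of_mem hs'))
    have kt : k' t = k t := e3 t (fun s hs e => ht (by
      rw [h2 t (Finset.mem_insert_self _ _) s (Finset.mem_insert_of_mem hs) e]; exact hs))
    have kp : k' p = k p := e3 p (fun s hs e => h1 s (Finset.mem_insert_of_mem hs) e.symm)
    have hne : k' t ≠ k' p := by
      rw [kt, kp]; exact h1 t (Finset.mem_insert_self _ _)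
    obtain ⟨c2, k2, f1, f2, f3, f4⟩ := link1 c' k' t p hne
    refine ⟨c2, k2, fun u v h => f1 _ _ (e1 _ _ h), ?_, ?_, ?_⟩
    · intro s hs
      rcases Finset.mem_insert.1 hs with rfl | hs
      · exact f2
      · exact f1 _ _ (e2 s hs)
    · intro u hu
      have : k' u = k u := e3 u (fun s hs => hu s (Finset.mem_insert_of_mem hs))
      rw [f3 u (by rw [this, kt]; exact hu t (Finset.mem_insert_self _ _)), this]
    · intro r hr hrp h
      have hr1 : r ≠ t := fun e => hr (by rw [e]; exact Finset.mem_insert_self _ _)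
      have hr2 : r ∉ B := fun e => hr (Finset.mem_insert_of_mem e)
      exact f4 r hr1 hrp (e4 r hr2 hrp h)

variable (x y : α → ℝ)

/-- the wedge with corner `(X, Y)` contains an edge. -/
def Edgy (c : α → Bool) (k : α → α) (X Y : ℝ) : Prop :=
  ∃ a b, E c k a b ∧ x a ≤ X ∧ y a ≤ Y ∧ x b ≤ X ∧ y b ≤ Y

structure Inv0 (P : Finset α) (c : α → Bool) (k : α → α) (T L : Finset α) : Prop where
  TP : ∀ t ∈ T, t ∈ P
  LP : ∀ t ∈ L, t ∈ P
  unarr : ∀ p, p ∉ P → ∀ q, k q = k p → q = p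
  good : ∀ u ∈ P, u ∉ T → u ∉ L → Edgy x y c k (x u) (y u)
  inj : ∀ t ∈ T, ∀ t' ∈ T, k t = k t' → t = t'
  anti : ∀ t ∈ T, ∀ t' ∈ T, x t ≤ x t' → y t ≤ y t' → t = t'
  TL : ∀ t ∈ T, ∀ s ∈ L, x s ≤ x t → y s ≤ y t → False
  two : ∀ X Y, ¬ Edgy x y c k X Y → ∃ s₁ s₂, ∀ s ∈ L, x s ≤ X → y s ≤ Y → s = s₁ ∨ s = s₂

def Three (T L : Finset α) : Prop :=
  ∀ A ⊆ T, (∀ s ∈ L, ∀ a ∈ A, ∀ b ∈ A, x s ≤ x a → y s ≤ y b → False) → A.card ≤ 3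

variable {x y}

theorem Edgy.mono {c c' : α → Bool} {k k' : α → α} (h : ∀ u v, E c k u v → E c' k' u v)
    {X Y X' Y' : ℝ} (hX : X ≤ X') (hY : Y ≤ Y') (e : Edgy x y c k X Y) : Edgy x y c' k' X' Y' := by
  obtain ⟨a, b, h1, h2, h3, h4, h5⟩ := e
  exact ⟨a, b, h _ _ h1, h2.trans hX, h3.trans hY, h4.trans hX, h5.trans hY⟩

theorem four {T A : Finset α} (hA : A ⊆ T)
    (anti : ∀ t ∈ T, ∀ t' ∈ T, x t ≤ x t' → y t ≤ y t' → t = t') (h : 4 ≤ A.card) :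
    ∃ q1 ∈ A, ∃ q2 ∈ A, ∃ q3 ∈ A, ∃ q4 ∈ A, x q1 < x q2 ∧ x q2 < x q3 ∧ x q3 < x q4 ∧
      y q2 < y q1 ∧ y q3 < y q2 ∧ y q4 < y q3 := by
  classical
  have hlt : ∀ a ∈ A, ∀ b ∈ A, x a ≤ x b → a ≠ b → x a < x b ∧ y b < y a := by
    intro a ha b hb hab hne
    have h1 : y b < y a := by
      by_contra hh
      exact hne (anti a (hA ha) b (hA hb) hab (not_lt.1 hh))
    refine ⟨lt_of_le_of_ne hab fun e => ?_, h1⟩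
    exact hne (anti b (hA hb) a (hA ha) e.ge h1.le).symm
  have hne : A.Nonempty := Finset.card_pos.1 (by omega)
  obtain ⟨q1, h1, m1⟩ := A.exists_min_image x hne
  obtain ⟨q4, h4, m4⟩ := A.exists_max_image x hne
  have hc : 1 < ((A.erase q1).erase q4).card := by
    have e1 := Finset.card_erase_of_mem h1
    have e2 := Finset.pred_card_le_card_erase (s := A.erase q1) (a := q4)
    omega
  obtain ⟨a, ha, b, hb, hab⟩ := Finset.one_lt_card.1 hc
  simp only [Finset.mem_erase] at ha hb
  have key : ∀ a b, (a ≠ q4 ∧ a ≠ q1 ∧ a ∈ A) → (b ≠ q4 ∧ b ≠ q1 ∧ b ∈ A) → a ≠ b → x a ≤ x b →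
    ∃ q1 ∈ A, ∃ q2 ∈ A, ∃ q3 ∈ A, ∃ q4 ∈ A, x q1 < x q2 ∧ x q2 < x q3 ∧ x q3 < x q4 ∧
      y q2 < y q1 ∧ y q3 < y q2 ∧ y q4 < y q3 := by
    intro a b ha hb hab hx
    have i1 := hlt q1 h1 a ha.2.2 (m1 a ha.2.2) (Ne.symm ha.2.1)
    have i2 := hlt a ha.2.2 b hb.2.2 hx hab
    have i3 := hlt b hb.2.2 q4 h4 (m4 b hb.2.2) hb.1
    exact ⟨q1, h1, a, ha.2.2, b, hb.2.2, q4, h4, i1.1, i2.1, i3.1, i1.2, i2.2, i3.2⟩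
  rcases le_total (x a) (x b) with h | h
  · exact key a b ha hb hab h
  · exact key b a hb ha hab.symm h

theorem fix (P : Finset α) : ∀ (n : ℕ) (c : α → Bool) (k : α → α) (T L : Finset α), T.card ≤ n →
    Inv0 x y P c k T L →
    ∃ (c' : α → Bool) (k' : α → α) (T' L' : Finset α), (∀ u v, E c k u v → E c' k' u v) ∧
      Inv0 x y P c' k' T' L' ∧ Three x y T' L' := by
  classical
  intro n
  induction n with
  | zero =>
    intro c k T L hT hI
    refine ⟨c, k, T, L, fun _ _ h => h, hI, fun A hA _ => ?_⟩
    have := Finset.card_le_card hA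
    omega
  | succ n ih =>
    intro c k T L hT hI
    by_cases h3 : Three x y T L
    · exact ⟨c, k, T, L, fun _ _ h => h, hI, h3⟩
    simp only [Three, not_forall] at h3
    obtain ⟨A, hAT, hAL, hA⟩ := h3
    obtain ⟨q1, h1, q2, h2, q3, h3, q4, h4, x12, x23, x34, y12, y23, y34⟩ :=
      four hAT hI.anti (by omega)
    have g1 := hAT h1
    have g2 := hAT h2
    have g3 := hAT h3
    have g4 := hAT h4
    have n12 : q1 ≠ q2 := by rintro rfl; exact lt_irrefl _ x12
    have n23 : q2 ≠ q3 := by rintro rfl; exact lt_irrefl _ x23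
    have n34 : q3 ≠ q4 := by rintro rfl; exact lt_irrefl _ x34
    have n13 : q1 ≠ q3 := by rintro rfl; exact lt_irrefl _ (x12.trans x23)
    have n24 : q2 ≠ q4 := by rintro rfl; exact lt_irrefl _ (x23.trans x34)
    obtain ⟨c1, k1, e1, e2, e3, e4⟩ := link1 c k q2 q1 (fun e => n12 (hI.inj _ g2 _ g1 e).symm)
    have k1T : ∀ t ∈ T, t ≠ q2 → k1 t = k t := fun t ht hne => e3 t fun e => hne (hI.inj _ ht _ g2 e)
    obtain ⟨c2, k2, f1, f2, f3, f4⟩ := link1 c1 k1 q3 q4 (by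
      rw [k1T q3 g3 n23.symm, k1T q4 g4 n24.symm]
      exact fun e => n34 (hI.inj _ g3 _ g4 e))
    have k2T : ∀ t ∈ T, t ≠ q2 → t ≠ q3 → k2 t = k t := fun t ht hne hne3 => by
      rw [f3 t, k1T t ht hne]
      rw [k1T t ht hne, k1T q3 g3 n23.symm]
      exact fun e => hne3 (hI.inj _ ht _ g3 e)
    have mon : ∀ u v, E c k u v → E c2 k2 u v := fun u v h => f1 _ _ (e1 _ _ h)
    have E12 : E c2 k2 q2 q1 := f1 _ _ e2
    have W12 : ∀ X Y, x q2 ≤ X → y q1 ≤ Y → Edgy x y c2 k2 X Y := fun X Y hX hY =>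
      ⟨q2, q1, E12, hX, y12.le.trans hY, x12.le.trans hX, hY⟩
    have W34 : ∀ X Y, x q4 ≤ X → y q3 ≤ Y → Edgy x y c2 k2 X Y := fun X Y hX hY =>
      ⟨q3, q4, f2, x34.le.trans hX, hY, hX, y34.le.trans hY⟩
    have hLc : ∀ s ∈ L, x q4 < x s ∨ y q1 < y s := by
      intro s hs
      by_contra hh
      push Not at hh
      exact hAL s hs q4 h4 q1 h1 hh.1 hh.2
    let L' := (L.filter fun s => ¬(x q2 ≤ x s ∧ y q2 ≤ y s) ∧ ¬(x q3 ≤ x s ∧ y q3 ≤ y s)) ∪ {q2, q3}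
    have mL' : ∀ s, s ∈ L' ↔ (s ∈ L ∧ ¬(x q2 ≤ x s ∧ y q2 ≤ y s) ∧ ¬(x q3 ≤ x s ∧ y q3 ≤ y s)) ∨
        s = q2 ∨ s = q3 := by
      intro s; simp only [L', Finset.mem_union, Finset.mem_filter, Finset.mem_insert, Finset.mem_singleton]
    let T' := (T.erase q2).erase q3
    have mT' : ∀ t, t ∈ T' ↔ t ≠ q3 ∧ t ≠ q2 ∧ t ∈ T := by intro t; simp [T']
    have hI' : Inv0 x y P c2 k2 T' L' := by
      refine ⟨?_, ?_, ?_, ?_, ?_, ?_, ?_, ?_⟩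
      · intro t ht
        exact hI.TP t ((mT' t).1 ht).2.2
      · intro s hs
        rcases (mL' s).1 hs with h | rfl | rfl
        · exact hI.LP s h.1
        · exact hI.TP _ g2
        · exact hI.TP _ g3
      · intro p hp
        have np : ∀ t ∈ T, p ≠ t := by rintro t ht rfl; exact hp (hI.TP _ ht)
        exact f4 p (np _ g3) (np _ g4) (e4 p (np _ g2) (np _ g1) (hI.unarr p hp))
      · intro u hu huT huL
        rw [mT'] at huT
        rw [mL'] at huL
        push Not at huT huL
        have u3 := huL.2.2
        have u2 := huL.2.1
        have uT : u ∉ T := huT u3 u2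
        by_cases uL : u ∈ L
        · by_cases c2' : x q2 ≤ x u ∧ y q2 ≤ y u
          · rcases hLc u uL with hh | hh
            · exact W34 _ _ hh.le (y23.le.trans c2'.2)
            · exact W12 _ _ c2'.1 hh.le
          · have c3' := huL.1 uL (fun a => not_le.1 fun b => c2' ⟨a, b⟩)
            rcases hLc u uL with hh | hh
            · exact W34 _ _ hh.le c3'.2
            · exact W12 _ _ (x23.le.trans c3'.1) hh.le
        · exact (hI.good u hu uT uL).mono mon le_rfl le_rfl
      · intro t ht t' ht' e
        rw [mT'] at ht ht'
        rw [k2T t ht.2.2 ht.2.1 ht.1, k2T t' ht'.2.2 ht'.2.1 ht'.1] at e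
        exact hI.inj _ ht.2.2 _ ht'.2.2 e
      · intro t ht t' ht'
        exact hI.anti t ((mT' t).1 ht).2.2 t' ((mT' t').1 ht').2.2
      · intro t ht s hs hx hy
        rw [mT'] at ht
        rcases (mL' s).1 hs with h | rfl | rfl
        · exact hI.TL t ht.2.2 s h.1 hx hy
        · exact ht.2.1 (hI.anti _ g2 _ ht.2.2 hx hy).symm
        · exact ht.1 (hI.anti _ g3 _ ht.2.2 hx hy).symm
      · intro X Y hXY
        have a12 : x q2 ≤ X → Y < y q1 := fun h => not_le.1 fun h' => hXY (W12 _ _ h h')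
        have a34 : y q3 ≤ Y → X < x q4 := fun h => not_le.1 fun h' => hXY (W34 _ _ h' h)
        by_cases hq : (x q2 ≤ X ∧ y q2 ≤ Y) ∨ (x q3 ≤ X ∧ y q3 ≤ Y)
        · refine ⟨q2, q3, fun s hs hx hy => ?_⟩
          rcases (mL' s).1 hs with h | h
          · exfalso
            have b1 : Y < y q1 := a12 (by rcases hq with h | h <;> linarith [h.1])
            have b2 : X < x q4 := a34 (by rcases hq with h | h <;> linarith [h.2])
            rcases hLc s h.1 with hh | hh <;> linarith
          · exact h
        · obtain ⟨s1, s2, hs⟩ := hI.two X Y (fun h => hXY (h.mono mon le_rfl le_rfl))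
          refine ⟨s1, s2, fun s hsL hx hy => ?_⟩
          rcases (mL' s).1 hsL with h | rfl | rfl
          · exact hs s h.1 hx hy
          · exact absurd (Or.inl ⟨hx, hy⟩) hq
          · exact absurd (Or.inr ⟨hx, hy⟩) hq
    have hc : T'.card ≤ n := by
      have e1 := Finset.card_erase_of_mem g2
      have e2 : T'.card ≤ (T.erase q2).card := Finset.card_erase_le
      have := Finset.card_pos.2 ⟨q2, g2⟩
      omega
    obtain ⟨c', k', T'', L'', r1, r2⟩ := ih c2 k2 T' L' hc hI'
    exact ⟨c', k', T'', L'', fun u v h => r1 _ _ (mon _ _ h), r2⟩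

theorem step (P : Finset α) (p : α) (hp : p ∉ P) [DecidableEq α]
    (c : α → Bool) (k : α → α) (T L : Finset α)
    (hI : Inv0 x y P c k T L) :
    ∃ (c' : α → Bool) (k' : α → α) (T' L' : Finset α), (∀ u v, E c k u v → E c' k' u v) ∧
      Inv0 x y (insert p P) c' k' T' L' := by
  by_cases hs : ∃ s ∈ P, (s ∈ T ∨ s ∈ L) ∧ x s ≤ x p ∧ y s ≤ y p
  · obtain ⟨s, hsP, hsTL, hx, hy⟩ := hs
    have hne : s ≠ p := by rintro rfl; exact hp hsP
    obtain ⟨c1, k1, e1, e2, e3, e4⟩ := link1 c k p s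
      (fun e => hne (hI.unarr p hp s e.symm))
    have kT : ∀ t ∈ T, k1 t = k t := fun t ht => e3 t fun e => by
      have := hI.unarr p hp t e
      subst this
      exact hp (hI.TP _ ht)
    refine ⟨c1, k1, T, L, e1, ?_, ?_, ?_, ?_, ?_, hI.anti, hI.TL, ?_⟩
    · exact fun t ht => Finset.mem_insert_of_mem (hI.TP t ht)
    · exact fun t ht => Finset.mem_insert_of_mem (hI.LP t ht)
    · intro r hr
      rw [Finset.mem_insert, not_or] at hr
      exact e4 r hr.1 (by rintro rfl; exact hr.2 hsP) (hI.unarr r hr.2)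
    · intro u hu huT huL
      rcases Finset.mem_insert.1 hu with rfl | hu
      · exact ⟨u, s, e2, le_rfl, le_rfl, hx, hy⟩
      · exact (hI.good u hu huT huL).mono e1 le_rfl le_rfl
    · intro t ht t' ht' e
      rw [kT t ht, kT t' ht'] at e
      exact hI.inj t ht t' ht' e
    · intro X Y h
      exact hI.two X Y fun h' => h (h'.mono e1 le_rfl le_rfl)
  · have hs' : ∀ s, (s ∈ T ∨ s ∈ L) → x s ≤ x p → y s ≤ y p → False := fun s h1 h2 h3 =>
      hs ⟨s, h1.elim (hI.TP s) (hI.LP s), h1, h2, h3⟩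
    have pT : ∀ t ∈ T, t ≠ p := by rintro t ht rfl; exact hp (hI.TP _ ht)
    classical
    let B := T.filter fun t => x p ≤ x t ∧ y p ≤ y t
    have mB : ∀ t, t ∈ B ↔ t ∈ T ∧ x p ≤ x t ∧ y p ≤ y t := by intro t; simp [B]
    have kpT : ∀ t ∈ T, k t ≠ k p := fun t ht e => pT t ht (hI.unarr p hp t e)
    obtain ⟨c1, k1, e1, e2, e3, e4⟩ := linkMany c k p B
      (fun t ht => kpT t ((mB t).1 ht).1)
      (fun t ht t' ht' => hI.inj t ((mB t).1 ht).1 t' ((mB t').1 ht').1)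
    have kp : k1 p = k p := e3 p fun t ht e => kpT t ((mB t).1 ht).1 e.symm
    let T' := insert p (T.filter fun t => t ∉ B)
    have mT' : ∀ t, t ∈ T' ↔ t = p ∨ t ∈ T ∧ t ∉ B := by intro t; simp [T']
    have kT : ∀ t ∈ T, t ∉ B → k1 t = k t := fun t ht htB => e3 t fun s hsB e => by
      have := hI.inj t ht s ((mB s).1 hsB).1 e
      subst this
      exact htB hsB
    refine ⟨c1, k1, T', L, e1, ?_, ?_, ?_, ?_, ?_, ?_, ?_, ?_⟩
    · intro t ht
      rcases (mT' t).1 ht with rfl | h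
      · exact Finset.mem_insert_self _ _
      · exact Finset.mem_insert_of_mem (hI.TP t h.1)
    · exact fun t ht => Finset.mem_insert_of_mem (hI.LP t ht)
    · intro r hr
      rw [Finset.mem_insert, not_or] at hr
      exact e4 r (fun h => hr.2 (hI.TP r ((mB r).1 h).1)) hr.1 (hI.unarr r hr.2)
    · intro u hu huT huL
      rw [mT'] at huT
      push Not at huT
      rcases Finset.mem_insert.1 hu with rfl | hu
      · exact absurd rfl huT.1
      · by_cases uT : u ∈ T
        · have uB := huT.2 uT
          exact ⟨u, p, e2 u uB, le_rfl, le_rfl, ((mB u).1 uB).2.1, ((mB u).1 uB).2.2⟩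
        · exact (hI.good u hu uT huL).mono e1 le_rfl le_rfl
    · intro t ht t' ht' e
      rcases (mT' t).1 ht with rfl | h <;> rcases (mT' t').1 ht' with rfl | h'
      · rfl
      · rw [kp, kT t' h'.1 h'.2] at e
        exact absurd e.symm (kpT t' h'.1)
      · rw [kp, kT t h.1 h.2] at e
        exact absurd e (kpT t h.1)
      · rw [kT t h.1 h.2, kT t' h'.1 h'.2] at e
        exact hI.inj t h.1 t' h'.1 e
    · intro t ht t' ht' hx hy
      rcases (mT' t).1 ht with rfl | h <;> rcases (mT' t').1 ht' with rfl | h'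
      · rfl
      · exact absurd ((mB t').2 ⟨h'.1, hx, hy⟩) h'.2
      · exact (hs' t (Or.inl h.1) hx hy).elim
      · exact hI.anti t h.1 t' h'.1 hx hy
    · intro t ht s hsL hx hy
      rcases (mT' t).1 ht with rfl | h
      · exact hs' s (Or.inr hsL) hx hy
      · exact hI.TL t h.1 s hsL hx hy
    · intro X Y h
      exact hI.two X Y fun h' => h (h'.mono e1 le_rfl le_rfl)

theorem final (P : Finset α) (c : α → Bool) (k : α → α) (T L : Finset α)
    (hI : Inv0 x y P c k T L) (h3 : Three x y T L) (X Y : ℝ) (Q : Finset α) (hQP : Q ⊆ P)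
    (hQ : ∀ q ∈ Q, x q ≤ X ∧ y q ≤ Y) (hc : 12 ≤ Q.card) : Edgy x y c k X Y := by
  classical
  by_contra hE
  obtain ⟨s1, s2, hs⟩ := hI.two X Y hE
  have hTL : ∀ q ∈ Q, q ∈ T ∨ q ∈ L := by
    intro q hq
    by_contra hh
    push Not at hh
    exact hE ((hI.good q (hQP hq) hh.1 hh.2).mono (fun _ _ h => h) (hQ q hq).1 (hQ q hq).2)
  by_cases hs1 : ∃ s ∈ L, x s ≤ X ∧ y s ≤ Y
  swap
  · have hsub : Q ⊆ T := fun q hq => (hTL q hq).resolve_right fun h => hs1 ⟨q, h, hQ q hq⟩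
    have := h3 Q hsub (fun s hsL a ha b hb hx hy =>
      hs1 ⟨s, hsL, hx.trans (hQ a ha).1, hy.trans (hQ b hb).2⟩)
    omega
  -- choose s1 s2 both in L
  obtain ⟨s1, s2, m1, m2, hs⟩ : ∃ s1 s2, s1 ∈ L ∧ s2 ∈ L ∧
      ∀ s ∈ L, x s ≤ X → y s ≤ Y → s = s1 ∨ s = s2 := by
    obtain ⟨s0, h0, hx0, hy0⟩ := hs1
    by_cases a1 : s1 ∈ L <;> by_cases a2 : s2 ∈ L
    · exact ⟨s1, s2, a1, a2, hs⟩
    · refine ⟨s1, s1, a1, a1, fun s hsL hx hy => ?_⟩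
      rcases hs s hsL hx hy with rfl | rfl
      · exact Or.inl rfl
      · exact absurd hsL a2
    · refine ⟨s2, s2, a2, a2, fun s hsL hx hy => ?_⟩
      rcases hs s hsL hx hy with rfl | rfl
      · exact absurd hsL a1
      · exact Or.inl rfl
    · rcases hs s0 h0 hx0 hy0 with rfl | rfl
      · exact absurd h0 a1
      · exact absurd h0 a2
  let T0 := Q.filter fun q => q ∈ T
  have mT0 : ∀ q, q ∈ T0 ↔ q ∈ Q ∧ q ∈ T := by intro q; simp [T0]
  let A := T0.filter fun q => x q < min (x s1) (x s2)
  let B := T0.filter fun q => y q < min (y s1) (y s2)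
  let C := T0.filter fun q => x q < max (x s1) (x s2) ∧ y q < max (y s1) (y s2) ∧
    (∀ s ∈ L, x s ≤ X → y s ≤ Y → max (x s1) (x s2) ≤ x s ∨ max (y s1) (y s2) ≤ y s)
  have hcov : Q ⊆ {s1, s2} ∪ (A ∪ B ∪ C) := by
    intro q hq
    rcases hTL q hq with hT | hL
    · have t1 := fun h h' => hI.TL q hT s1 m1 h h'
      have t2 := fun h h' => hI.TL q hT s2 m2 h h'
      simp only [Finset.mem_union, A, B, C, Finset.mem_filter, mT0]
      right
      by_contra hh
      push Not at hh
      obtain ⟨⟨ha, hb⟩, hcc⟩ := hh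
      have ha := ha ⟨hq, hT⟩
      have hb := hb ⟨hq, hT⟩
      have hcc := hcc ⟨hq, hT⟩
      rw [min_le_iff] at ha hb
      have key : x q < max (x s1) (x s2) ∧ y q < max (y s1) (y s2) ∧
          ((max (x s1) (x s2) ≤ x s1 ∨ max (y s1) (y s2) ≤ y s1) ∧
          (max (x s1) (x s2) ≤ x s2 ∨ max (y s1) (y s2) ≤ y s2)) := by
        simp only [lt_max_iff, max_le_iff, le_refl, true_and, and_true]
        by_cases p1 : x s1 ≤ x q
        · have r1 := not_le.1 (t1 p1)
          have r2 : y s2 ≤ y q := hb.resolve_left (not_le.2 r1)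
          have r3 := not_le.1 (fun h => t2 h r2)
          exact ⟨Or.inr r3, Or.inl r1, Or.inr (by linarith), Or.inl (by linarith)⟩
        · have r0 := not_le.1 p1
          have r1 : x s2 ≤ x q := ha.resolve_left p1
          have r2 := not_le.1 (t2 r1)
          have r3 : y s1 ≤ y q := hb.resolve_right (not_le.2 r2)
          exact ⟨Or.inl r0, Or.inr r2, Or.inl (by linarith), Or.inr (by linarith)⟩
      obtain ⟨s, hsL, hx, hy, hz⟩ := hcc key.1 key.2.1
      rcases hs s hsL hx hy with rfl | rfl
      · rcases key.2.2.1 with h | h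
        · exact absurd hz.1 (not_lt.2 h)
        · exact absurd hz.2 (not_lt.2 h)
      · rcases key.2.2.2 with h | h
        · exact absurd hz.1 (not_lt.2 h)
        · exact absurd hz.2 (not_lt.2 h)
    · rcases hs q hL (hQ q hq).1 (hQ q hq).2 with rfl | rfl <;> simp
  have sub : ∀ D, D ⊆ T0 → D ⊆ T := fun D hD q hq => ((mT0 q).1 (hD hq)).2
  have inQ : ∀ D, D ⊆ T0 → ∀ q ∈ D, q ∈ Q := fun D hD q hq => ((mT0 q).1 (hD hq)).1
  have sA : A ⊆ T0 := Finset.filter_subset _ _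
  have sB : B ⊆ T0 := Finset.filter_subset _ _
  have sC : C ⊆ T0 := Finset.filter_subset _ _
  have cA : A.card ≤ 3 := h3 A (sub A sA) fun s hsL a ha b hb hx hy => by
    have h1 := (Finset.mem_filter.1 ha).2
    rw [lt_min_iff] at h1
    rcases hs s hsL (hx.trans (hQ a (inQ A sA a ha)).1) (hy.trans (hQ b (inQ A sA b hb)).2) with
      rfl | rfl
    · linarith [h1.1]
    · linarith [h1.2]
  have cB : B.card ≤ 3 := h3 B (sub B sB) fun s hsL a ha b hb hx hy => by
    have h1 := (Finset.mem_filter.1 hb).2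
    rw [lt_min_iff] at h1
    rcases hs s hsL (hx.trans (hQ a (inQ B sB a ha)).1) (hy.trans (hQ b (inQ B sB b hb)).2) with
      rfl | rfl
    · linarith [h1.1]
    · linarith [h1.2]
  have cC : C.card ≤ 3 := h3 C (sub C sC) fun s hsL a ha b hb hx hy => by
    have h1 := (Finset.mem_filter.1 ha).2
    have h2 := (Finset.mem_filter.1 hb).2
    rcases h1.2.2 s hsL (hx.trans (hQ a (inQ C sC a ha)).1)
      (hy.trans (hQ b (inQ C sC b hb)).2) with h | h
    · linarith [h1.1]
    · linarith [h2.2.1]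
  have c0 := Finset.card_le_card hcov
  have c1 := Finset.card_union_le {s1, s2} (A ∪ B ∪ C)
  have c2 := Finset.card_union_le (A ∪ B) C
  have c3 := Finset.card_union_le A B
  have c4 : ({s1, s2} : Finset α).card ≤ 2 := Finset.card_le_two
  omega

theorem sweep [Nonempty α] (x y z : α → ℝ) (P : Finset α) :
    ∃ (c : α → Bool) (k : α → α) (T L : Finset α), Inv0 x y P c k T L ∧ Three x y T L ∧
      ∀ (Q : Finset α) (X Y Z : ℝ), (∀ q, q ∈ Q ↔ q ∈ P ∧ x q ≤ X ∧ y q ≤ Y ∧ z q ≤ Z) →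
        12 ≤ Q.card → ∃ a ∈ Q, ∃ b ∈ Q, E c k a b := by
  classical
  induction P using Finset.induction_on_max_value z with
  | empty =>
    refine ⟨fun _ => true, id, ∅, ∅, ⟨by simp, by simp, fun p _ q h => h, by simp, by simp, by simp,
      by simp, ?_⟩, ?_, ?_⟩
    · intro X Y _
      obtain ⟨s⟩ := ‹Nonempty α›
      exact ⟨s, s, by simp⟩
    · intro A hA _
      rw [Finset.subset_empty.1 hA]; simp
    · intro Q X Y Z hQ hc
      have : Q = ∅ := by ext q; simp [hQ]
      simp [this] at hc
  | insert p P hp hmax ih =>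
    obtain ⟨c, k, T, L, hI, h3, hW⟩ := ih
    obtain ⟨c1, k1, T1, L1, m1, hI1⟩ := step P p hp c k T L hI
    obtain ⟨c2, k2, T2, L2, m2, hI2, h32⟩ := fix (insert p P) _ c1 k1 T1 L1 le_rfl hI1
    refine ⟨c2, k2, T2, L2, hI2, h32, ?_⟩
    intro Q X Y Z hQ hc
    by_cases hZ : z p ≤ Z
    · have hQ' : ∀ q, q ∈ Q ↔ q ∈ insert p P ∧ x q ≤ X ∧ y q ≤ Y := by
        intro q
        rw [hQ]
        refine ⟨fun h => ⟨h.1, h.2.1, h.2.2.1⟩, fun h => ⟨h.1, h.2.1, h.2.2, ?_⟩⟩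
        rcases Finset.mem_insert.1 h.1 with rfl | h'
        · exact hZ
        · exact (hmax q h').trans hZ
      obtain ⟨a, b, e, h1, h2, h3, h4⟩ := final _ c2 k2 T2 L2 hI2 h32 X Y Q
        (fun q hq => ((hQ' q).1 hq).1) (fun q hq => ((hQ' q).1 hq).2) hc
      have hne : a ≠ b := by rintro rfl; exact e.2 rfl
      have ha : a ∈ insert p P := by
        by_contra h
        exact hne (hI2.unarr a h b e.1.symm).symm
      have hb : b ∈ insert p P := by
        by_contra h
        exact hne (hI2.unarr b h a e.1)
      exact ⟨a, (hQ' a).2 ⟨ha, h1, h2⟩, b, (hQ' b).2 ⟨hb, h3, h4⟩, e⟩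
    · obtain ⟨a, ha, b, hb, e⟩ := hW Q X Y Z (fun q => by
        rw [hQ]
        refine ⟨fun h => ⟨?_, h.2⟩, fun h => ⟨Finset.mem_insert_of_mem h.1, h.2⟩⟩
        rcases Finset.mem_insert.1 h.1 with rfl | h'
        · exact absurd h.2.2.2 hZ
        · exact h') hc
      exact ⟨a, ha, b, hb, m2 _ _ (m1 _ _ e)⟩

end OctA

namespace OctB

abbrev V := Fin 3 → ℝ

open Classical in
/-- points of `P` in the octant with apex `a` -/
noncomputable def oct (P : Finset V) (a : V) : Finset V := P.filter fun p => p ≤ a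

theorem mem_oct {P : Finset V} {a p : V} : p ∈ oct P a ↔ p ∈ P ∧ p ≤ a := by
  classical
  simp [oct]

theorem oct_mono {P P' : Finset V} (h : P ⊆ P') (a : V) : oct P a ⊆ oct P' a := fun p hp =>
  mem_oct.2 ⟨h (mem_oct.1 hp).1, (mem_oct.1 hp).2⟩

/-- `c` is a coloring of `P` with colors `< k` such that octants with at least `m` points see all
colors. -/
def Col (P : Finset V) (k m : ℕ) (c : V → ℕ) : Prop :=
  (∀ p, c p < k) ∧ ∀ a, m ≤ (oct P a).card → ∀ j < k, ∃ p ∈ oct P a, c p = j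

theorem two_col (P : Finset V) : ∃ c : V → Bool, ∀ a, 12 ≤ (oct P a).card →
    ∀ j, ∃ p ∈ oct P a, c p = j := by
  obtain ⟨c, k, T, L, -, -, h⟩ := OctA.sweep (fun p : V => p 0) (fun p => p 1) (fun p => p 2) P
  refine ⟨c, fun a ha j => ?_⟩
  obtain ⟨u, hu, v, hv, e⟩ := h (oct P a) (a 0) (a 1) (a 2) (fun q => by
    rw [mem_oct, Pi.le_def, Fin.forall_fin_succ, Fin.forall_fin_succ, Fin.forall_fin_succ]
    simp) ha
  have hne := e.2
  by_cases hj : c u = j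
  · exact ⟨u, hu, hj⟩
  · refine ⟨v, hv, ?_⟩
    revert hne hj
    cases c u <;> cases c v <;> cases j <;> simp

theorem anti_step (k m : ℕ) (hm : 1 ≤ m)
    (ih : ∀ P : Finset V, (∀ p ∈ P, ∀ q ∈ P, p ≤ q → p = q) → ∃ c, Col P k m c)
    (P : Finset V) (hP : ∀ p ∈ P, ∀ q ∈ P, p ≤ q → p = q) : ∃ c, Col P (k + 1) (12 * m ^ 2) c := by
  classical
  obtain ⟨c0, h0⟩ := two_col P
  let B := P.filter fun p => c0 p = true
  have BP : B ⊆ P := Finset.filter_subset _ _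
  have mB : ∀ p, p ∈ B ↔ p ∈ P ∧ c0 p = true := by intro p; simp [B]
  obtain ⟨c1, hc1, h1⟩ := ih B (fun p hp q hq => hP p (BP hp) q (BP hq))
  refine ⟨fun p => if c0 p = true then c1 p else k, fun p => ?_, fun a ha j hj => ?_⟩
  · have := hc1 p
    dsimp only
    split_ifs <;> omega
  have hm2 : 1 ≤ m ^ 2 := Nat.one_le_pow _ _ hm
  by_cases hjk : j = k
  · obtain ⟨p, hp, hc⟩ := h0 a (by omega) false
    exact ⟨p, hp, by simp [hc, hjk]⟩
  by_cases hb : m ≤ (oct B a).card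
  · obtain ⟨p, hp, hc⟩ := h1 a hb j (by omega)
    exact ⟨p, oct_mono BP a hp, by simp [((mB p).1 (mem_oct.1 hp).1).2, hc]⟩
  exfalso
  let D := oct B a
  have hD : D.card + 1 ≤ m := Nat.lt_of_not_le hb
  let R := (oct P a).filter fun p => ¬ c0 p = true
  have hsplit : (oct P a).card = D.card + R.card := by
    rw [← Finset.card_filter_add_card_filter_not (s := oct P a) (fun p => c0 p = true)]
    congr 2
    ext p
    simp only [D, Finset.mem_filter, mem_oct, mB]
    tauto
  let f : V → ℕ × ℕ := fun p => ((D.filter fun b => b 0 ≤ p 0).card, (D.filter fun b => b 1 ≤ p 1).card)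
  have hsame : ∀ (i : Fin 3) (p q : V), (D.filter fun b => b i ≤ p i).card =
      (D.filter fun b => b i ≤ q i).card → ∀ b ∈ D, b i ≤ q i → b i ≤ p i := by
    intro i p q hcard b hb hbq
    rcases le_total (q i) (p i) with h | h
    · exact hbq.trans h
    · have hsub : (D.filter fun b => b i ≤ p i) ⊆ (D.filter fun b => b i ≤ q i) := by
        intro d hd
        rw [Finset.mem_filter] at hd ⊢
        exact ⟨hd.1, hd.2.trans h⟩
      have := Finset.eq_of_subset_of_card_le hsub hcard.ge
      have hb' : b ∈ D.filter fun b => b i ≤ q i := Finset.mem_filter.2 ⟨hb, hbq⟩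
      rw [← this] at hb'
      exact (Finset.mem_filter.1 hb').2
  have hR : R.card ≤ 11 * (Finset.range m ×ˢ Finset.range m).card := by
    refine Finset.card_le_mul_card_image_of_maps_to (f := f) (fun p _ => ?_) 11 (fun u _ => ?_)
    · have e1 := Finset.card_filter_le D fun b => b 0 ≤ p 0
      have e2 := Finset.card_filter_le D fun b => b 1 ≤ p 1
      simp only [f, Finset.mem_product, Finset.mem_range]
      omega
    · by_contra hbig
      let Q := R.filter fun p => f p = u
      have mQ : ∀ p ∈ Q, (p ∈ P ∧ p ≤ a) ∧ c0 p ≠ true ∧ f p = u := by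
        intro p hp
        simp only [Q, R, Finset.mem_filter, mem_oct] at hp
        tauto
      have hbig' : 12 ≤ Q.card := by
        change ¬ (Q.card ≤ 11) at hbig
        omega
      have hne : Q.Nonempty := Finset.card_pos.1 (by omega)
      have hmx : ∀ i : Fin 3, ∃ p ∈ Q, ∀ q ∈ Q, q i ≤ p i := fun i =>
        Q.exists_max_image (fun p => p i) hne
      choose g hg1 hg2 using hmx
      let a' : V := fun i => g i i
      have hQa : Q ⊆ oct P a' := fun q hq =>
        mem_oct.2 ⟨(mQ q hq).1.1, fun i => hg2 i q hq⟩
      obtain ⟨b, hb, hbc⟩ := h0 a' (hbig'.trans (Finset.card_le_card hQa)) true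
      rw [mem_oct] at hb
      have hbB : b ∈ B := (mB b).2 ⟨hb.1, hbc⟩
      have hbD : b ∈ D := mem_oct.2 ⟨hbB, fun i => (hb.2 i).trans ((mQ _ (hg1 i)).1.2 i)⟩
      let p := g 2
      have hp := mQ p (hg1 2)
      have hfe : ∀ i, f p = f (g i) := fun i => by rw [hp.2.2, (mQ _ (hg1 i)).2.2]
      have x0 : b 0 ≤ p 0 := hsame 0 p (g 0) (congrArg Prod.fst (hfe 0)) b hbD (hb.2 0)
      have x1 : b 1 ≤ p 1 := hsame 1 p (g 1) (congrArg Prod.snd (hfe 1)) b hbD (hb.2 1)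
      have x2 : b 2 ≤ p 2 := hb.2 2
      have hle : b ≤ p := by
        rw [Pi.le_def, Fin.forall_fin_succ, Fin.forall_fin_succ, Fin.forall_fin_succ]
        exact ⟨x0, x1, x2, fun i => i.elim0⟩
      have := hP b hb.1 p hp.1.1 hle
      exact hp.2.1 (this ▸ hbc)
  rw [Finset.card_product, Finset.card_range] at hR
  have : m * m = m ^ 2 := by ring
  have : m ≤ m ^ 2 := by nlinarith
  omega

theorem anti_col (k : ℕ) : ∀ P : Finset V, (∀ p ∈ P, ∀ q ∈ P, p ≤ q → p = q) →
    ∃ c, Col P (k + 1) (12 ^ (2 ^ k - 1)) c := by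
  induction k with
  | zero =>
    intro P _
    refine ⟨fun _ => 0, fun _ => by simp, fun a ha j hj => ?_⟩
    obtain ⟨p, hp⟩ := Finset.card_pos.1 (show 0 < (oct P a).card by simpa using ha)
    exact ⟨p, hp, by dsimp only; omega⟩
  | succ k ih =>
    intro P hP
    have h := anti_step (k + 1) _ (Nat.one_le_pow _ _ (by norm_num)) ih P hP
    have e : 12 * (12 ^ (2 ^ k - 1)) ^ 2 = 12 ^ (2 ^ (k + 1) - 1) := by
      rw [← pow_mul, ← pow_succ']
      congr 1
      have := Nat.one_le_two_pow (n := k)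
      rw [pow_succ]
      omega
    rwa [e] at h

theorem gen_step (k m M : ℕ) (hM : 1 ≤ M)
    (hm : ∀ P : Finset V, (∀ p ∈ P, ∀ q ∈ P, p ≤ q → p = q) → ∃ c, Col P (k + 1) m c)
    (ih : ∀ P : Finset V, ∃ c, Col P k M c) (P : Finset V) :
    ∃ c, Col P (k + 1) (m + (k + 1) * M) c := by
  classical
  let A := P.filter fun p => ∀ q ∈ P, q ≤ p → q = p
  have AP : A ⊆ P := Finset.filter_subset _ _
  obtain ⟨c0, hc0, h0⟩ := hm A (fun p hp q hq h => (Finset.mem_filter.1 hq).2 p (AP hp) h)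
  have hpar : ∀ p, ∃ q, p ∈ P → q ∈ A ∧ q ≤ p := by
    intro p
    by_cases hp : p ∈ P
    · obtain ⟨q, hqp, hq⟩ := P.exists_le_minimal hp
      refine ⟨q, fun _ => ⟨Finset.mem_filter.2 ⟨hq.1, fun r hr hrq => ?_⟩, hqp⟩⟩
      exact le_antisymm hrq (hq.2 hr hrq)
    · exact ⟨p, fun h => absurd h hp⟩
  choose par hpar using hpar
  let N : ℕ → Finset V := fun f => (P \ A).filter fun p => c0 (par p) = f
  have mN : ∀ f p, p ∈ N f ↔ (p ∈ P ∧ p ∉ A) ∧ c0 (par p) = f := by intro f p; simp [N]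
  choose C hC hC2 using fun f => ih (N f)
  let sh : ℕ → ℕ → ℕ := fun f j => if j < f then j else j + 1
  refine ⟨fun p => if p ∈ A then c0 p else if C (c0 (par p)) p < c0 (par p) then
    C (c0 (par p)) p else C (c0 (par p)) p + 1, fun p => ?_, fun a ha j hj => ?_⟩
  · have e1 := hc0 p
    have e2 := hC (c0 (par p)) p
    dsimp only
    split_ifs <;> omega
  by_cases hA : m ≤ (oct A a).card
  · obtain ⟨p, hp, hc⟩ := h0 a hA j hj
    exact ⟨p, oct_mono AP a hp, by simp [(mem_oct.1 hp).1, hc]⟩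
  have hf : ∃ f < k + 1, M ≤ (oct (N f) a).card := by
    by_contra hh
    push Not at hh
    have hle : (oct (P \ A) a).card ≤ M * (Finset.range (k + 1)).card := by
      refine Finset.card_le_mul_card_image_of_maps_to (f := fun p => c0 (par p))
        (fun p _ => Finset.mem_range.2 (hc0 _)) M (fun f hf => ?_)
      have := hh f (Finset.mem_range.1 hf)
      refine le_trans (le_of_eq ?_) this.le
      congr 1
      ext p
      simp only [Finset.mem_filter, mem_oct, mN, Finset.mem_sdiff]
      tauto
    have hsub : oct P a ⊆ oct A a ∪ oct (P \ A) a := by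
      intro p hp
      simp only [Finset.mem_union, mem_oct, Finset.mem_sdiff] at hp ⊢
      tauto
    have h1 := Finset.card_le_card hsub
    have h2 := Finset.card_union_le (oct A a) (oct (P \ A) a)
    rw [Finset.card_range, mul_comm] at hle
    omega
  obtain ⟨f, hfk, hfM⟩ := hf
  by_cases hjf : j = f
  · obtain ⟨p, hp⟩ := Finset.card_pos.1 (lt_of_lt_of_le hM hfM)
    rw [mem_oct, mN] at hp
    have := hpar p hp.1.1.1
    exact ⟨par p, mem_oct.2 ⟨AP this.1, this.2.trans hp.2⟩, by simp [this.1, hp.1.2, hjf]⟩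
  · have key : ∀ i < k, (if i < f then i else i + 1) = j → ∃ p ∈ oct P a,
        (if p ∈ A then c0 p else if C (c0 (par p)) p < c0 (par p) then
    C (c0 (par p)) p else C (c0 (par p)) p + 1) = j := by
      intro i hi hij
      obtain ⟨p, hp, hc⟩ := hC2 f a hfM i hi
      rw [mem_oct, mN] at hp
      refine ⟨p, mem_oct.2 ⟨hp.1.1.1, hp.2⟩, ?_⟩
      rw [if_neg hp.1.1.2, hp.1.2, hc]
      exact hij
    rcases Nat.lt_or_ge j f with h | h
    · exact key j (by omega) (by simp [h])
    · exact key (j - 1) (by omega) (by rw [if_neg (by omega)]; omega)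

theorem Col.mono {P : Finset V} {k m m' : ℕ} {c : V → ℕ} (h : m ≤ m') (hc : Col P k m c) :
    Col P k m' c := ⟨hc.1, fun a ha => hc.2 a (h.trans ha)⟩

theorem numer (n e : ℕ) (he : e = 3 * 2 ^ n - 2) :
    12 ^ (2 ^ (n + 2) - 1) + (n + 2 + 1) * 12 ^ e ≤ 12 ^ (3 * 2 ^ (n + 1) - 2) := by
  have h1 := Nat.one_le_two_pow (n := n)
  have h2 : n + 1 ≤ 2 ^ n := Nat.lt_two_pow_self
  have p2 : 2 ^ (n + 2) = 4 * 2 ^ n := by ring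
  have p1 : 2 ^ (n + 1) = 2 * 2 ^ n := by ring
  have ea : 2 ^ (n + 2) - 1 ≤ 2 * e + 1 := by omega
  have eb : 3 * 2 ^ (n + 1) - 2 = 2 * e + 2 := by omega
  have e1 : n + 1 ≤ e := by omega
  rw [eb]
  have a1 : 12 ^ (2 ^ (n + 2) - 1) ≤ 12 ^ (2 * e + 1) := Nat.pow_le_pow_right (by norm_num) ea
  have a2 : n + 2 + 1 ≤ 12 ^ (e + 1) := by
    have := Nat.lt_pow_self (n := e + 1) (a := 12) (by norm_num)
    omega
  have a3 : (n + 2 + 1) * 12 ^ e ≤ 12 ^ (2 * e + 1) := by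
    calc (n + 2 + 1) * 12 ^ e ≤ 12 ^ (e + 1) * 12 ^ e := Nat.mul_le_mul_right _ a2
      _ = 12 ^ (2 * e + 1) := by rw [← pow_add]; congr 1; ring
  have a4 : 12 ^ (2 * e + 2) = 12 * 12 ^ (2 * e + 1) := by ring
  omega

theorem gen_col (n : ℕ) : ∀ P : Finset V, ∃ c, Col P (n + 2) (12 ^ (3 * 2 ^ n - 2)) c := by
  induction n with
  | zero =>
    intro P
    obtain ⟨c, hc⟩ := two_col P
    refine ⟨fun p => if c p = true then 1 else 0, fun p => ?_, fun a ha j hj => ?_⟩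
    · dsimp only
      split_ifs <;> omega
    · obtain ⟨p, hp, h⟩ := hc a (by simpa using ha) (decide (j = 1))
      refine ⟨p, hp, ?_⟩
      by_cases hj1 : j = 1
      · simp [h, hj1]
      · simp only [h, hj1]
        simp
        omega
  | succ n ih =>
    intro P
    obtain ⟨c, hc⟩ := gen_step (n + 2) _ _ (Nat.one_le_pow _ _ (by norm_num)) (anti_col (n + 2)) ih P
    exact ⟨c, hc.mono (numer n _ rfl)⟩

end OctB

/-- For every `k ≥ 2`, any finite point set in `ℝ³` has a `k`-coloring such that
every translate of the octant containing at least `12^(2^(k-1)+2^(k-2)-2)` of the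
points contains all `k` colors. -/
theorem octant_k_coloring (k : ℕ) (hk : 2 ≤ k)
    (S : Set (Fin 3 → ℝ)) (hS : S.Finite) :
    ∃ c : S → Fin k, ∀ a : Fin 3 → ℝ,
      12 ^ (2 ^ (k - 1) + 2 ^ (k - 2) - 2) ≤ (S ∩ Octant a).ncard →
      ∀ j : Fin k, ∃ x : S, (x : Fin 3 → ℝ) ∈ Octant a ∧ c x = j := by
  classical
  obtain ⟨n, rfl⟩ : ∃ n, k = n + 2 := ⟨k - 2, by omega⟩
  obtain ⟨c, hc, h⟩ := OctB.gen_col n hS.toFinset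
  refine ⟨fun p => ⟨c p, hc p⟩, fun a ha j => ?_⟩
  have hmem : ∀ p : Fin 3 → ℝ, p ∈ Octant a ↔ p ≤ a := by
    intro p
    rw [Pi.le_def, Fin.forall_fin_succ, Fin.forall_fin_succ, Fin.forall_fin_succ]
    simp [Octant]
  have hset : S ∩ Octant a = (OctB.oct hS.toFinset a : Set (Fin 3 → ℝ)) := by
    ext p
    simp [OctB.mem_oct, hmem]
  rw [hset, Set.ncard_coe_finset] at ha
  have he : 2 ^ (n + 2 - 1) + 2 ^ (n + 2 - 2) - 2 = 3 * 2 ^ n - 2 := by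
    have e1 : n + 2 - 1 = n + 1 := by omega
    have e2 : n + 2 - 2 = n := by omega
    rw [e1, e2, pow_succ]
    omega
  rw [he] at ha
  obtain ⟨p, hp, hcp⟩ := h a ha j j.2
  rw [OctB.mem_oct, Set.Finite.mem_toFinset] at hp
  exact ⟨⟨p, hp.1⟩, (hmem p).2 hp.2, Fin.ext hcp⟩
end

section
/- Projection equivalence. Let k ≥ 2, m ≥ 1, and let p₁, …, pₙ be points of ℝ³, indexed in increasing order of their z-coordinates, such that all n x-coordinates are pairwise distinct, all n y-coordinates are pairwise distinct, and all n z-coordinates are pairwise distinct. Then the following are equivalent: (1) there exists a coloring c : Fin n → Fin k such that for every a ∈ ℝ³, if the octant O(a) = {x : x₁ ≤ a₁ ∧ x₂ ≤ a₂ ∧ x₃ ≤ a₃} contains at least m of the points pᵢ, then all k colors occur among the points pᵢ contained in O(a); (2) there exists a coloring c : Fin n → Fin k such that for every t ∈ {1, …, n} and every b ∈ ℝ², if the index set Q = {i ≤ t : (pᵢ)₁ ≤ b₁ ∧ (pᵢ)₂ ≤ b₂} has at least m elements, then c takes all k values on Q. -/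
/-- Projection equivalence: for points of `ℝ³` listed in increasing order of
`z`-coordinate, with pairwise distinct `x`-, `y`- and `z`-coordinates, a `k`-good
coloring for octants in space exists iff a `k`-good coloring of the ordered
projected planar point set (with respect to wedges, at every time `t`) exists. -/
theorem projection_equivalence (k m n : ℕ) (hk : 2 ≤ k) (hm : 1 ≤ m)
    (p : Fin n → (Fin 3 → ℝ))
    (hz : ∀ i j : Fin n, i < j → p i 2 < p j 2)
    (hx : Function.Injective (fun i => p i 0))
    (hy : Function.Injective (fun i => p i 1))
    (hzinj : Function.Injective (fun i => p i 2)) :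
    (∃ c : Fin n → Fin k, ∀ a : Fin 3 → ℝ,
        m ≤ {i : Fin n | p i ∈ Octant a}.ncard →
        ∀ j : Fin k, ∃ i : Fin n, p i ∈ Octant a ∧ c i = j) ↔
    (∃ c : Fin n → Fin k, ∀ t : Fin n, ∀ b : Fin 2 → ℝ,
        m ≤ {i : Fin n | i ≤ t ∧ p i 0 ≤ b 0 ∧ p i 1 ≤ b 1}.ncard →
        ∀ j : Fin k, ∃ i : Fin n,
          (i ≤ t ∧ p i 0 ≤ b 0 ∧ p i 1 ≤ b 1) ∧ c i = j) := by
  have hle : ∀ i t : Fin n, p i 2 ≤ p t 2 ↔ i ≤ t := by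
    intro i t
    constructor
    · intro h
      by_contra hc
      exact absurd (hz t i (not_le.mp hc)) (not_lt.mpr h)
    · intro h
      rcases h.lt_or_eq with h | h
      · exact (hz i t h).le
      · rw [h]
  refine exists_congr fun c => ⟨fun H t b => ?_, fun H a hcard => ?_⟩
  · have key : ∀ i, p i ∈ Octant ![b 0, b 1, p t 2] ↔
        (i ≤ t ∧ p i 0 ≤ b 0 ∧ p i 1 ≤ b 1) := by
      intro i
      have := hle i t
      simp only [Octant, Set.mem_setOf_eq, Matrix.cons_val]
      tauto
    have H' := H ![b 0, b 1, p t 2]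
    simp only [key] at H'
    exact H'
  · have hne : {i : Fin n | p i ∈ Octant a}.Nonempty := by
      apply Set.nonempty_of_ncard_ne_zero
      omega
    obtain ⟨t, ht, hmax⟩ := Set.exists_max_image _ id (Set.toFinite _) hne
    have key : ∀ i, p i ∈ Octant a ↔
        (i ≤ t ∧ p i 0 ≤ ![a 0, a 1] 0 ∧ p i 1 ≤ ![a 0, a 1] 1) := by
      intro i
      constructor
      · intro hi
        exact ⟨hmax i hi, hi.1, hi.2.1⟩
      · rintro ⟨h1, h2, h3⟩
        exact ⟨h2, h3, ((hle i t).2 h1).trans ht.2.2⟩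
    simp only [key] at hcard ⊢
    exact H t _ hcard
end

section
/- Inductive step of the main theorem. Let k ≥ 3 and m ≥ 12. Suppose that every finite set S ⊆ ℝ³ admits a coloring c : S → Fin (k-1) such that for every a ∈ ℝ³, if |S ∩ O(a)| ≥ m then c takes all k-1 values on S ∩ O(a). Then every finite set S ⊆ ℝ³ admits a coloring c : S → Fin k such that for every a ∈ ℝ³, if |S ∩ O(a)| ≥ 144·(m² − m) + 1 then c takes all k values on S ∩ O(a). -/
theorem octant_eq (a : Fin 3 → ℝ) : Octant a = Set.Iic a := by
  ext x
  simp [Octant, Pi.le_def, Fin.forall_fin_succ]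

theorem exists_pred (S : Finset (Fin 3 → ℝ)) (i : Fin 3) (t : ℝ) :
    ∃ t' < t, ∀ x ∈ S, x i < t → x i ≤ t' := by
  classical
  induction S using Finset.induction_on with
  | empty => exact ⟨t - 1, by linarith, by simp⟩
  | insert p S hp ih =>
    obtain ⟨t', ht, h⟩ := ih
    by_cases hpt : p i < t
    · refine ⟨max t' (p i), max_lt ht hpt, ?_⟩
      intro x hx hxt
      rcases Finset.mem_insert.1 hx with rfl | hx
      · exact le_max_right _ _
      · exact (h x hx hxt).trans (le_max_left _ _)
    · refine ⟨t', ht, ?_⟩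
      intro x hx hxt
      rcases Finset.mem_insert.1 hx with rfl | hx
      · exact absurd hxt hpt
      · exact h x hx hxt

/-- sweep invariant -/
theorem sweep (S : Finset (Fin 3 → ℝ)) (a : Fin 3 → ℝ) (C : Finset (Fin 3 → ℝ)) :
    ∃ (A : Finset (ℝ × ℝ)) (D : Finset (ℝ × ℝ × ℝ)),
      A.card + D.card ≤ 2 * C.card + 1 ∧
      (∀ d ∈ D, (∃ c ∈ C, d.2.2 < c 2) ∧
        ∀ c ∈ C, ¬ (c 0 ≤ d.1 ∧ c 1 ≤ d.2.1 ∧ c 2 ≤ d.2.2)) ∧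
      (∀ q ∈ A, ∀ c ∈ C, ¬ (c 0 ≤ q.1 ∧ c 1 ≤ q.2)) ∧
      (∀ x ∈ S, x ≤ a → (∀ c ∈ C, ¬ c ≤ x) →
        (∃ q ∈ A, x 0 ≤ q.1 ∧ x 1 ≤ q.2) ∨
        (∃ d ∈ D, x 0 ≤ d.1 ∧ x 1 ≤ d.2.1 ∧ x 2 ≤ d.2.2)) := by
  classical
  induction C using Finset.induction_on_max_value (fun c : Fin 3 → ℝ => c 2) with
  | empty =>
    refine ⟨{(a 0, a 1)}, ∅, by simp, by simp, by simp, ?_⟩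
    intro x _ hxa _
    exact Or.inl ⟨_, Finset.mem_singleton_self _, hxa 0, hxa 1⟩
  | insert p C hp hmax ih =>
    obtain ⟨A, D, hcard, hD, hA, hcov⟩ := ih
    have hD' : ∀ d ∈ D, (∃ c ∈ insert p C, d.2.2 < c 2) ∧
        ∀ c ∈ insert p C, ¬ (c 0 ≤ d.1 ∧ c 1 ≤ d.2.1 ∧ c 2 ≤ d.2.2) := by
      intro d hd
      obtain ⟨⟨c, hc, hdc⟩, h2⟩ := hD d hd
      refine ⟨⟨c, Finset.mem_insert_of_mem hc, hdc⟩, ?_⟩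
      intro e he
      rcases Finset.mem_insert.1 he with rfl | he
      · rintro ⟨_, _, h⟩
        have := hmax c hc
        linarith
      · exact h2 e he
    set Y := A.filter (fun q => p 0 ≤ q.1 ∧ p 1 ≤ q.2) with hY
    set K := A.filter (fun q => ¬ (p 0 ≤ q.1 ∧ p 1 ≤ q.2)) with hK
    have hYK : Y.card + K.card = A.card := Finset.card_filter_add_card_filter_not _
    have hpc : (insert p C).card = C.card + 1 := Finset.card_insert_of_notMem hp
    have hKA : ∀ q ∈ K, ∀ c ∈ insert p C, ¬ (c 0 ≤ q.1 ∧ c 1 ≤ q.2) := by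
      intro q hq c hc
      rw [hK, Finset.mem_filter] at hq
      rcases Finset.mem_insert.1 hc with rfl | hc
      · exact hq.2
      · exact hA q hq.1 c hc
    rcases Y.eq_empty_or_nonempty with hYe | hYn
    · have hAK : ∀ q ∈ A, q ∈ K := by
        intro q hq
        rw [hK, Finset.mem_filter]
        refine ⟨hq, fun h => ?_⟩
        have : q ∈ Y := by rw [hY, Finset.mem_filter]; exact ⟨hq, h⟩
        rw [hYe] at this
        simp at this
      refine ⟨A, D, by omega, hD', fun q hq => hKA q (hAK q hq), ?_⟩
      intro x hx hxa hxc
      exact hcov x hx hxa (fun c hc => hxc c (Finset.mem_insert_of_mem hc))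
    · obtain ⟨q1, hq1, hm1⟩ := Y.exists_max_image (fun q => q.1) hYn
      obtain ⟨q2, hq2, hm2⟩ := Y.exists_max_image (fun q => q.2) hYn
      obtain ⟨s0, hs0, hs0'⟩ := exists_pred S 0 (p 0)
      obtain ⟨s1, hs1, hs1'⟩ := exists_pred S 1 (p 1)
      obtain ⟨s2, hs2, hs2'⟩ := exists_pred S 2 (p 2)
      have hq1' := Finset.mem_filter.1 hq1
      have hq2' := Finset.mem_filter.1 hq2
      refine ⟨insert (s0, q2.2) (insert (q1.1, s1) K),
        D ∪ Y.image (fun q => (q.1, q.2, s2)), ?_, ?_, ?_, ?_⟩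
      · have h1 := Finset.card_insert_le (s0, q2.2) (insert (q1.1, s1) K)
        have h2 := Finset.card_insert_le (q1.1, s1) K
        have h3 := Finset.card_union_le D (Y.image (fun q => (q.1, q.2, s2)))
        have h4 : (Y.image (fun q => (q.1, q.2, s2))).card ≤ Y.card := Finset.card_image_le
        omega
      · intro d hd
        rcases Finset.mem_union.1 hd with hd | hd
        · exact hD' d hd
        · obtain ⟨q, hq, rfl⟩ := Finset.mem_image.1 hd
          have hq' := Finset.mem_filter.1 hq
          refine ⟨⟨p, Finset.mem_insert_self _ _, hs2⟩, ?_⟩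
          rintro c hc ⟨h0, h1, h2⟩
          rcases Finset.mem_insert.1 hc with rfl | hc
          · simp only at h2
            linarith
          · exact hA q hq'.1 c hc ⟨h0, h1⟩
      · intro q hq
        rcases Finset.mem_insert.1 hq with rfl | hq
        · rintro c hc ⟨h0, h1⟩
          simp only at h0 h1
          rcases Finset.mem_insert.1 hc with rfl | hc
          · linarith
          · exact hA q2 hq2'.1 c hc ⟨by linarith [hq2'.2.1], h1⟩
        rcases Finset.mem_insert.1 hq with rfl | hq
        · rintro c hc ⟨h0, h1⟩
          simp only at h0 h1
          rcases Finset.mem_insert.1 hc with rfl | hc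
          · linarith
          · exact hA q1 hq1'.1 c hc ⟨h0, by linarith [hq1'.2.2]⟩
        · exact hKA q hq
      · intro x hx hxa hxc
        rcases hcov x hx hxa (fun c hc => hxc c (Finset.mem_insert_of_mem hc)) with
          ⟨q, hq, h0, h1⟩ | ⟨d, hd, h⟩
        · by_cases hqd : p 0 ≤ q.1 ∧ p 1 ≤ q.2
          · have hqY : q ∈ Y := Finset.mem_filter.2 ⟨hq, hqd⟩
            by_cases hx2 : x 2 < p 2
            · right
              exact ⟨(q.1, q.2, s2), Finset.mem_union_right _ (Finset.mem_image_of_mem _ hqY),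
                h0, h1, hs2' x hx hx2⟩
            · left
              by_cases hx0 : x 0 < p 0
              · exact ⟨(s0, q2.2), Finset.mem_insert_self _ _, hs0' x hx hx0,
                  h1.trans (hm2 q hqY)⟩
              · by_cases hx1 : x 1 < p 1
                · exact ⟨(q1.1, s1), Finset.mem_insert_of_mem (Finset.mem_insert_self _ _),
                    h0.trans (hm1 q hqY), hs1' x hx hx1⟩
                · exfalso
                  apply hxc p (Finset.mem_insert_self _ _)
                  intro i
                  fin_cases i
                  · exact not_lt.1 hx0
                  · exact not_lt.1 hx1
                  · exact not_lt.1 hx2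
          · left
            exact ⟨q, Finset.mem_insert_of_mem (Finset.mem_insert_of_mem
              (Finset.mem_filter.2 ⟨hq, hqd⟩)), h0, h1⟩
        · right
          exact ⟨d, Finset.mem_union_left _ hd, h⟩

open Classical in
theorem cover (S : Finset (Fin 3 → ℝ)) (a : Fin 3 → ℝ) (C : Finset (Fin 3 → ℝ)) :
    ∃ F : Finset (Fin 3 → ℝ), F.card ≤ 2 * C.card + 1 ∧
      (∀ f ∈ F, ∀ c ∈ C, ¬ c ≤ f) ∧
      (∀ x ∈ S, x ≤ a → (∀ c ∈ C, ¬ c ≤ x) → ∃ f ∈ F, x ≤ f) := by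
  obtain ⟨A, D, hcard, hD, hA, hcov⟩ := sweep S a C
  refine ⟨A.image (fun q => ![q.1, q.2, a 2]) ∪ D.image (fun d => ![d.1, d.2.1, d.2.2]),
    ?_, ?_, ?_⟩
  · refine (Finset.card_union_le _ _).trans (le_trans ?_ hcard)
    exact Nat.add_le_add Finset.card_image_le Finset.card_image_le
  · intro f hf c hc hcf
    rcases Finset.mem_union.1 hf with hf | hf
    · obtain ⟨q, hq, rfl⟩ := Finset.mem_image.1 hf
      exact hA q hq c hc ⟨hcf 0, hcf 1⟩
    · obtain ⟨d, hd, rfl⟩ := Finset.mem_image.1 hf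
      exact (hD d hd).2 c hc ⟨hcf 0, hcf 1, hcf 2⟩
  · intro x hx hxa hxc
    rcases hcov x hx hxa hxc with ⟨q, hq, h0, h1⟩ | ⟨d, hd, h0, h1, h2⟩
    · refine ⟨_, Finset.mem_union_left _ (Finset.mem_image_of_mem _ hq), ?_⟩
      intro i
      fin_cases i
      · exact h0
      · exact h1
      · exact hxa 2
    · refine ⟨_, Finset.mem_union_right _ (Finset.mem_image_of_mem _ hd), ?_⟩
      intro i
      fin_cases i
      · exact h0
      · exact h1
      · exact h2

open Classical in
/-- the part of `S` below `a` -/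
noncomputable def below (S : Finset (Fin 3 → ℝ)) (a : Fin 3 → ℝ) : Finset (Fin 3 → ℝ) :=
  S.filter (fun x => x ≤ a)

theorem mem_below {S : Finset (Fin 3 → ℝ)} {a x : Fin 3 → ℝ} :
    x ∈ below S a ↔ x ∈ S ∧ x ≤ a := by simp [below]

open Classical in
theorem antichain_bound (m : ℕ) (B C : Finset (Fin 3 → ℝ)) (a : Fin 3 → ℝ)
    (hanti : ∀ b ∈ B, ∀ c ∈ C, ¬ c ≤ b)
    (h : ∀ f, m ≤ (below B f).card → ∃ c ∈ C, c ≤ f) :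
    (below B a).card ≤ (2 * (below C a).card + 1) * (m - 1) := by
  obtain ⟨F, hF, hav, hcov⟩ := cover B a (below C a)
  have hsub : below B a ⊆ F.biUnion (fun f => below B (f ⊓ a)) := by
    intro x hx
    obtain ⟨hxB, hxa⟩ := mem_below.1 hx
    obtain ⟨f, hf, hxf⟩ := hcov x hxB hxa (fun c hc => hanti x hxB c (mem_below.1 hc).1)
    exact Finset.mem_biUnion.2 ⟨f, hf, mem_below.2 ⟨hxB, le_inf hxf hxa⟩⟩
  refine (Finset.card_le_card hsub).trans ?_
  refine (Finset.card_biUnion_le_card_mul F _ (m - 1) ?_).trans (Nat.mul_le_mul_right _ hF)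
  intro f hf
  by_contra hlt
  obtain ⟨c, hc, hcf⟩ := h (f ⊓ a) (by omega)
  exact hav f hf c (mem_below.2 ⟨hc, hcf.trans inf_le_right⟩) (hcf.trans inf_le_left)

open Classical in
theorem exists_Y (m : ℕ) (hm : 1 ≤ m)
    (two : ∀ A : Finset (Fin 3 → ℝ), ∃ B ⊆ A, ∀ a, m ≤ (below A a).card →
      (∃ x ∈ B, x ≤ a) ∧ (∃ x ∈ A \ B, x ≤ a)) (n : ℕ) :
    ∀ S : Finset (Fin 3 → ℝ), ∃ Y ⊆ S, ∀ a,
      (n * (m - 1) + 1 ≤ (below S a).card → ∃ y ∈ Y, y ≤ a) ∧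
      ((below (S \ Y) a).card < n →
        (below Y a).card ≤ (3 * (below (S \ Y) a).card + 1) * (m - 1)) := by
  induction n with
  | zero =>
    intro S
    refine ⟨S, subset_rfl, fun a => ⟨?_, by simp⟩⟩
    intro h
    obtain ⟨y, hy⟩ := Finset.card_pos.1 (show 0 < (below S a).card by omega)
    exact ⟨y, (mem_below.1 hy).1, (mem_below.1 hy).2⟩
  | succ n ih =>
    intro S
    set A := S.filter (fun x => ∀ y ∈ S, y ≤ x → y = x) with hAdef
    obtain ⟨B, hBA, hB⟩ := two A
    set S' := S.filter (fun x => x ∉ A ∧ ∀ b ∈ B, ¬ b ≤ x) with hS'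
    obtain ⟨Y', hY'S, hY'⟩ := ih S'
    have hAS : A ⊆ S := Finset.filter_subset _ _
    have hS'S : S' ⊆ S := Finset.filter_subset _ _
    have hanti : ∀ b ∈ A, ∀ c ∈ A, c ≤ b → c = b := by
      intro b hb c hc h
      exact (Finset.mem_filter.1 hb).2 c (hAS hc) h
    have hmin : ∀ x ∈ S, ∃ y ∈ A, y ≤ x := by
      intro x hx
      obtain ⟨y, hyx, hy⟩ := S.exists_le_minimal hx
      refine ⟨y, Finset.mem_filter.2 ⟨hy.1, fun z hz hzy => le_antisymm hzy (hy.2 hz hzy)⟩, hyx⟩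
    refine ⟨B ∪ Y', Finset.union_subset (hBA.trans hAS) (hY'S.trans hS'S), fun a => ⟨?_, ?_⟩⟩
    · intro h
      by_cases hBa : ∃ b ∈ B, b ≤ a
      · obtain ⟨b, hb, hba⟩ := hBa
        exact ⟨b, Finset.mem_union_left _ hb, hba⟩
      · have hA1 : (below A a).card ≤ m - 1 := by
          by_contra hlt
          exact hBa (hB a (by omega)).1
        have hsub : below S a ⊆ below A a ∪ below S' a := by
          intro x hx
          obtain ⟨hxS, hxa⟩ := mem_below.1 hx
          by_cases hxA : x ∈ A
          · exact Finset.mem_union_left _ (mem_below.2 ⟨hxA, hxa⟩)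
          · refine Finset.mem_union_right _ (mem_below.2 ⟨Finset.mem_filter.2
              ⟨hxS, hxA, fun b hb hbx => hBa ⟨b, hb, hbx.trans hxa⟩⟩, hxa⟩)
        have h1 := (Finset.card_le_card hsub).trans (Finset.card_union_le _ _)
        rw [Nat.succ_mul] at h
        obtain ⟨y, hy, hya⟩ := (hY' a).1 (by omega)
        exact ⟨y, Finset.mem_union_right _ hy, hya⟩
    · intro hz
      have hBb : (below B a).card ≤ (2 * (below (A \ B) a).card + 1) * (m - 1) := by
        apply antichain_bound
        · intro b hb c hc hcb
          have hc' := Finset.mem_sdiff.1 hc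
          exact hc'.2 (hanti b (hBA hb) c hc'.1 hcb ▸ hb)
        · intro f hf
          refine (hB f (hf.trans (Finset.card_le_card ?_))).2
          intro x hx
          exact mem_below.2 ⟨hBA (mem_below.1 hx).1, (mem_below.1 hx).2⟩
      have hU : (below (B ∪ Y') a).card ≤ (below B a).card + (below Y' a).card := by
        refine le_trans (Finset.card_le_card ?_) (Finset.card_union_le _ _)
        intro x hx
        obtain ⟨h1, h2⟩ := mem_below.1 hx
        rcases Finset.mem_union.1 h1 with h | h
        · exact Finset.mem_union_left _ (mem_below.2 ⟨h, h2⟩)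
        · exact Finset.mem_union_right _ (mem_below.2 ⟨h, h2⟩)
      have hZ : (below (A \ B) a).card + (below (S' \ Y') a).card ≤
          (below (S \ (B ∪ Y')) a).card := by
        rw [← Finset.card_union_of_disjoint]
        · apply Finset.card_le_card
          intro x hx
          rcases Finset.mem_union.1 hx with hx | hx
          · obtain ⟨h1, h2⟩ := mem_below.1 hx
            obtain ⟨h3, h4⟩ := Finset.mem_sdiff.1 h1
            refine mem_below.2 ⟨Finset.mem_sdiff.2 ⟨hAS h3, fun h => ?_⟩, h2⟩
            rcases Finset.mem_union.1 h with h | h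
            · exact h4 h
            · exact (Finset.mem_filter.1 (hY'S h)).2.1 h3
          · obtain ⟨h1, h2⟩ := mem_below.1 hx
            obtain ⟨h3, h4⟩ := Finset.mem_sdiff.1 h1
            refine mem_below.2 ⟨Finset.mem_sdiff.2 ⟨hS'S h3, fun h => ?_⟩, h2⟩
            rcases Finset.mem_union.1 h with h | h
            · exact (Finset.mem_filter.1 h3).2.1 (hBA h)
            · exact h4 h
        · rw [Finset.disjoint_left]
          intro x hx hx'
          have h1 := (Finset.mem_sdiff.1 (mem_below.1 hx).1).1
          have h2 := (Finset.mem_sdiff.1 (mem_below.1 hx').1).1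
          exact (Finset.mem_filter.1 h2).2.1 h1
      refine hU.trans ?_
      rcases (below Y' a).eq_empty_or_nonempty with he | ⟨y, hy⟩
      · rw [he, Finset.card_empty, add_zero]
        exact hBb.trans (Nat.mul_le_mul_right _ (by omega))
      · obtain ⟨hyY, hya⟩ := mem_below.1 hy
        have hyS' := Finset.mem_filter.1 (hY'S hyY)
        obtain ⟨w, hwA, hwy⟩ := hmin y hyS'.1
        have hw : w ∈ below (A \ B) a :=
          mem_below.2 ⟨Finset.mem_sdiff.2 ⟨hwA, fun h => hyS'.2.2 w h hwy⟩, hwy.trans hya⟩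
        have hpos : 0 < (below (A \ B) a).card := Finset.card_pos.2 ⟨w, hw⟩
        have h2 := (hY' a).2 (by omega)
        refine (Nat.add_le_add hBb h2).trans ?_
        rw [← Nat.add_mul]
        exact Nat.mul_le_mul_right _ (by omega)

theorem ncard_below (S : Finset (Fin 3 → ℝ)) (a : Fin 3 → ℝ) :
    ((S : Set (Fin 3 → ℝ)) ∩ Octant a).ncard = (below S a).card := by
  rw [← Set.ncard_coe_finset]
  congr 1
  ext x
  simp [mem_below, octant_eq]

theorem inductive_step (k m : ℕ) (hk : 3 ≤ k) (hm : 12 ≤ m)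
    (ih : ∀ S : Set (Fin 3 → ℝ), S.Finite →
      ∃ c : S → Fin (k - 1), ∀ a : Fin 3 → ℝ,
        m ≤ (S ∩ Octant a).ncard →
        ∀ j : Fin (k - 1), ∃ x : S, (x : Fin 3 → ℝ) ∈ Octant a ∧ c x = j) :
    ∀ S : Set (Fin 3 → ℝ), S.Finite →
      ∃ c : S → Fin k, ∀ a : Fin 3 → ℝ,
        144 * (m ^ 2 - m) + 1 ≤ (S ∩ Octant a).ncard →
        ∀ j : Fin k, ∃ x : S, (x : Fin 3 → ℝ) ∈ Octant a ∧ c x = j := by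
  classical
  have ih' : ∀ A : Finset (Fin 3 → ℝ), ∃ c : (Fin 3 → ℝ) → Fin (k - 1), ∀ a,
      m ≤ (below A a).card → ∀ j, ∃ x ∈ A, x ≤ a ∧ c x = j := by
    intro A
    obtain ⟨c, hc⟩ := ih A A.finite_toSet
    refine ⟨fun x => if h : x ∈ (A : Set (Fin 3 → ℝ)) then c ⟨x, h⟩ else ⟨0, by omega⟩, ?_⟩
    intro a ha j
    obtain ⟨⟨x, hx⟩, hxa, hxj⟩ := hc a (by rw [ncard_below]; exact ha) j
    refine ⟨x, hx, by simpa [octant_eq] using hxa, ?_⟩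
    simp only [hx, dif_pos, hxj]
  have two : ∀ A : Finset (Fin 3 → ℝ), ∃ B ⊆ A, ∀ a, m ≤ (below A a).card →
      (∃ x ∈ B, x ≤ a) ∧ (∃ x ∈ A \ B, x ≤ a) := by
    intro A
    obtain ⟨c, hc⟩ := ih' A
    refine ⟨A.filter (fun x => c x = ⟨0, by omega⟩), Finset.filter_subset _ _, ?_⟩
    intro a ha
    constructor
    · obtain ⟨x, hx, hxa, hxc⟩ := hc a ha ⟨0, by omega⟩
      exact ⟨x, Finset.mem_filter.2 ⟨hx, hxc⟩, hxa⟩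
    · obtain ⟨x, hx, hxa, hxc⟩ := hc a ha ⟨1, by omega⟩
      refine ⟨x, Finset.mem_sdiff.2 ⟨hx, fun h => ?_⟩, hxa⟩
      have := (Finset.mem_filter.1 h).2
      rw [hxc] at this
      simp at this
  intro S hS
  obtain ⟨T, rfl⟩ := hS.exists_finset_coe
  obtain ⟨Y, hYT, hY⟩ := exists_Y m (by omega) two m T
  obtain ⟨c, hc⟩ := ih' (T \ Y)
  refine ⟨fun x => if (x : Fin 3 → ℝ) ∈ Y then ⟨k - 1, by omega⟩
    else ⟨(c x).1, by have := (c x).2; omega⟩, ?_⟩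
  intro a ha j
  rw [ncard_below] at ha
  obtain ⟨n, rfl⟩ : ∃ n, m = n + 1 := ⟨m - 1, by omega⟩
  have hsq : (n + 1) ^ 2 - (n + 1) = (n + 1) * n := by
    rw [Nat.sub_eq_iff_eq_add (by nlinarith)]; ring
  rw [hsq] at ha
  obtain ⟨h1, h2⟩ := hY a
  simp only [Nat.add_sub_cancel] at h1 h2
  by_cases hj : j.1 = k - 1
  · obtain ⟨y, hy, hya⟩ := h1 (by nlinarith [Nat.zero_le ((n + 1) * n)])
    refine ⟨⟨y, hYT hy⟩, by simpa [octant_eq] using hya, ?_⟩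
    simp only [hy, if_true]
    exact Fin.ext hj.symm
  · have hsum : (below T a).card ≤ (below Y a).card + (below (T \ Y) a).card := by
      refine le_trans (Finset.card_le_card ?_) (Finset.card_union_le _ _)
      intro x hx
      obtain ⟨h1, h2⟩ := mem_below.1 hx
      by_cases h : x ∈ Y
      · exact Finset.mem_union_left _ (mem_below.2 ⟨h, h2⟩)
      · exact Finset.mem_union_right _ (mem_below.2 ⟨Finset.mem_sdiff.2 ⟨h1, h⟩, h2⟩)
    have hbig : n + 1 ≤ (below (T \ Y) a).card := by
      by_contra hlt
      push Not at hlt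
      have h3 := h2 hlt
      have h4 : (3 * (below (T \ Y) a).card + 1) * n ≤ (3 * n + 1) * n :=
        Nat.mul_le_mul_right _ (by omega)
      nlinarith
    obtain ⟨x, hx, hxa, hxj⟩ := hc a hbig ⟨j.1, by have := j.2; omega⟩
    obtain ⟨hxT, hxY⟩ := Finset.mem_sdiff.1 hx
    refine ⟨⟨x, hxT⟩, by simpa [octant_eq] using hxa, ?_⟩
    simp only [hxY, if_false, hxj]
end

section
/- For every integer k ≥ 2 and every triangle T ⊆ ℝ² (the convex hull of three affinely independent points), any 12^(2^(k-1)+2^(k-2)-2)-fold covering of any subset of ℝ² with a finite number of homothetic copies of T with positive ratio can be decomposed into k coverings. Precisely: let I be a finite index set and for each i ∈ I let T_i = {λ_i·x + v_i : x ∈ T} with λ_i > 0 and v_i ∈ ℝ²; if every point of X ⊆ ℝ² belongs to T_i for at least 12^(2^(k-1)+2^(k-2)-2) indices i, then there exists f : I → Fin k such that for every color j and every x ∈ X there is an index i with f i = j and x ∈ T_i. -/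
/-- The homothetic copy of a planar set `T` with ratio `lam` and translation `v`. -/
def Homothet (lam : ℝ) (v : Fin 2 → ℝ) (T : Set (Fin 2 → ℝ)) : Set (Fin 2 → ℝ) :=
  (fun x => lam • x + v) '' T

def OBad {I : Type} (x y : I → ℕ) (P S D : Finset I) (col : I → Bool) (A B : ℕ) : Prop :=
  (∀ i ∈ P, x i < A → y i < B → i ∈ S ∨ i ∈ D) ∧
  ∃ c : Bool, ∀ d ∈ D, x d < A → y d < B → col d = c

structure OPre {I : Type} (x y z : I → ℕ) (P S D : Finset I) (col : I → Bool) : Prop where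
  SP : ∀ i ∈ S, i ∈ P
  DP : ∀ i ∈ D, i ∈ P
  disj : ∀ i ∈ S, i ∉ D
  anti : ∀ s ∈ S, ∀ t ∈ S, x s < x t → y t ≤ y s
  nb : ∀ d ∈ D, ∀ s ∈ S, x d < x s → y s ≤ y d
  G : ∀ A B, OBad x y P S D col A B → (∀ s ∈ S, x s < A → B ≤ y s) →
    ∀ d ∈ D, ∀ e ∈ D, x d < A → y d < B → x e < A → y e < B → d = e
  L : ∀ A B, OBad x y P S D col A B → ∀ s ∈ S, x s < A → y s < B →
    (∀ t ∈ S, x t < A → y t < B → z s ≤ z t) →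
    ∀ d ∈ D, ∀ e ∈ D, x d < A → y d < B → x e < A → y e < B →
      x s < x d → y s < y d → x s < x e → y s < y e → d = e

def ORG {I : Type} (x y : I → ℕ) (P S D : Finset I) (col : I → Bool) (s : I) (c : Bool) : Prop :=
  ∀ A B, OBad x y P S D col A B → x s < A → y s < B →
    (∀ t ∈ S, x t < A → y t < B → t = s) → ∀ d ∈ D, x d < A → y d < B → col d ≠ c

def ORL {I : Type} (x y z : I → ℕ) (P S D : Finset I) (col : I → Bool) (s : I) (c : Bool) : Prop :=
  ∀ A B, OBad x y P S D col A B → x s < A → y s < B →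
    (∀ t ∈ S, x t < A → y t < B → z s ≤ z t) →
    ∀ u ∈ S, x u < A → y u < B → u ≠ s →
    (∀ t ∈ S, x t < A → y t < B → t ≠ s → z u ≤ z t) →
    (∀ d ∈ D, x d < A → y d < B → col d = c) →
    ∀ d ∈ D, ∀ e ∈ D, x d < A → y d < B → x e < A → y e < B →
      x u < x d → y u < y d → x u < x e → y u < y e → d = e

def ONoCol {I : Type} (x y z : I → ℕ) (P S D : Finset I) (col : I → Bool) : Prop :=
  ∀ s ∈ S, ∀ c, ¬ (ORG x y P S D col s c ∧ ORL x y z P S D col s c)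

theorem OBad.swap {I : Type} {x y : I → ℕ} {P S D : Finset I} {col : I → Bool} {A B : ℕ}
    (h : OBad x y P S D col A B) : OBad y x P S D col B A :=
  ⟨fun i hi a b => h.1 i hi b a, h.2.imp fun _ hc d hd a b => hc d hd b a⟩

theorem OBad.mono {I : Type} {x y : I → ℕ} {P S D : Finset I} {col : I → Bool} {A B A' B' : ℕ}
    (h : OBad x y P S D col A B) (hA : A' ≤ A) (hB : B' ≤ B) : OBad x y P S D col A' B' :=
  ⟨fun i hi a b => h.1 i hi (by omega) (by omega),
    h.2.imp fun _ hc d hd a b => hc d hd (by omega) (by omega)⟩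

theorem OPre.swap {I : Type} {x y z : I → ℕ} {P S D : Finset I} {col : I → Bool}
    (h : OPre x y z P S D col) : OPre y x z P S D col where
  SP := h.SP
  DP := h.DP
  disj := h.disj
  anti s hs t ht a := by
    by_contra hh
    have := h.anti s hs t ht (by omega)
    omega
  nb s hs t ht a := by
    by_contra hh
    have := h.nb s hs t ht (by omega)
    omega
  G A B hb hs d hd e he a1 a2 a3 a4 := by
    refine h.G B A hb.swap (fun s h1 h2 => ?_) d hd e he a2 a1 a4 a3
    by_contra hh
    have := hs s h1 (by omega)
    omega
  L A B hb s hs b1 b2 b3 d hd e he a1 a2 a3 a4 c1 c2 c3 c4 :=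
    h.L B A hb.swap s hs b2 b1 (fun t h1 h2 h3 => b3 t h1 h3 h2) d hd e he a2 a1 a4 a3 c2 c1 c4 c3

theorem ORG.swap {I : Type} {x y : I → ℕ} {P S D : Finset I} {col : I → Bool} {s : I} {c : Bool}
    (h : ORG x y P S D col s c) : ORG y x P S D col s c :=
  fun A B hb a1 a2 a3 d hd b1 b2 =>
    h B A hb.swap a2 a1 (fun t ht h1 h2 => a3 t ht h2 h1) d hd b2 b1

theorem ORL.swap {I : Type} {x y z : I → ℕ} {P S D : Finset I} {col : I → Bool} {s : I} {c : Bool}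
    (h : ORL x y z P S D col s c) : ORL y x z P S D col s c :=
  fun A B hb a1 a2 a3 u hu b1 b2 b3 b4 b5 d hd e he c1 c2 c3 c4 d1 d2 d3 d4 =>
    h B A hb.swap a2 a1 (fun t ht h1 h2 => a3 t ht h2 h1) u hu b2 b1 b3
      (fun t ht h1 h2 => b4 t ht h2 h1) (fun t ht h1 h2 => b5 t ht h2 h1) d hd e he
      c2 c1 c4 c3 d2 d1 d4 d3

theorem ONoCol.swap {I : Type} {x y z : I → ℕ} {P S D : Finset I} {col : I → Bool}
    (h : ONoCol x y z P S D col) : ONoCol y x z P S D col :=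
  fun s hs c hh => h s hs c ⟨hh.1.swap, hh.2.swap⟩

theorem O_a {I : Type} {x y z : I → ℕ} {P S D : Finset I} {col : I → Bool}
    (hn : ONoCol x y z P S D col) {A0 B0 : ℕ}
    (hb : OBad x y P S D col A0 B0) {l w r : I} (hl : l ∈ S) (hw : w ∈ S) (hr : r ∈ S)
    (l2 : y l < B0) (r1 : x r < A0)
    (h1 : x l < x w) (h2 : y r < y w) (z1 : z l < z w) (z2 : z r < z w) : False := by
  obtain ⟨hb1, c, hc⟩ := hb
  refine hn w hw (!c) ⟨?_, ?_⟩
  · intro A B hB a1 a2 a3 d hd b1 b2 hcol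
    have e1 : B ≤ y l := by
      by_contra hh
      have := a3 l hl (by omega) (by omega)
      subst this; omega
    have e2 : A ≤ x r := by
      by_contra hh
      have := a3 r hr (by omega) (by omega)
      subst this; omega
    have := hc d hd (by omega) (by omega)
    simp [this] at hcol
  · intro A B hB a1 a2 a3 u hu b1 b2 b3 b4 b5 d hd e he c1 c2 c3 c4 d1 d2 d3 d4
    have e1 : B ≤ y l := by
      by_contra hh
      have := a3 l hl (by omega) (by omega)
      omega
    have e2 : A ≤ x r := by
      by_contra hh
      have := a3 r hr (by omega) (by omega)
      omega
    have := hc d hd (by omega) (by omega)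
    have h' := b5 d hd c1 c2
    simp [this] at h'

theorem O_b {I : Type} {x y z : I → ℕ} {P S D : Finset I} {col : I → Bool}
    (hy : Function.Injective y) (hp : OPre x y z P S D col)
    (hn : ONoCol x y z P S D col) {A0 B0 : ℕ} {c : Bool}
    (hc : ∀ d ∈ D, x d < A0 → y d < B0 → col d = c)
    {s u w : I} (hs : s ∈ S) (hu : u ∈ S) (hw : w ∈ S)
    (s2 : y s < B0) (w1 : x w < A0)
    (h1 : x s < x u) (h2 : x u < x w) (h3 : y w < y u) (z1 : z s < z u) (z2 : z u < z w) :
    ∃ A B f, f ∈ D ∧ x f < A ∧ y f < B ∧ A0 ≤ x f ∧ y f < y u ∧ y u < B ∧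
      ∀ d ∈ D, x d < A → y d < B → col d = !c := by
  have hRG : ORG x y P S D col u (!c) := by
    intro A B hB a1 a2 a3 d hd b1 b2 hcol
    have e1 : B ≤ y s := by
      by_contra hh
      have := a3 s hs (by omega) (by omega)
      subst this; omega
    have e2 : A ≤ x w := by
      by_contra hh
      have := a3 w hw (by omega) (by omega)
      subst this; omega
    have := hc d hd (by omega) (by omega)
    simp [this] at hcol
  have hRL : ¬ ORL x y z P S D col u (!c) := fun h => hn u hu (!c) ⟨hRG, h⟩
  unfold ORL at hRL
  push Not at hRL
  obtain ⟨A, B, hB, a1, a2, a3, u', hu', b1, b2, b3, b4, b5, d, hd, e, he, c1, c2, c3, c4, d1, d2,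
    d3, d4, hne⟩ := hRL
  have e1 : B ≤ y s := by
    by_contra hh
    have := a3 s hs (by omega) (by omega)
    omega
  have key : ∀ f ∈ D, x f < A → y f < B → A0 ≤ x f := by
    intro f hf g1 g2
    by_contra hh
    have := hc f hf (by omega) (by omega)
    have h' := b5 f hf g1 g2
    simp [this] at h'
  have kd := key d hd c1 c2
  have ke := key e he c3 c4
  have hyne : ∀ f ∈ D, y f ≠ y u := by
    intro f hf h
    have := hy h
    subst this
    exact hp.disj _ hu hf
  by_cases hdu : y d < y u
  · exact ⟨A, B, d, hd, c1, c2, kd, hdu, a2, b5⟩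
  by_cases heu : y e < y u
  · exact ⟨A, B, e, he, c3, c4, ke, heu, a2, b5⟩
  exfalso
  have n1 := hyne d hd
  have n2 := hyne e he
  exact hne (hp.L A B hB u hu a1 a2 a3 d hd e he c1 c2 c3 c4 (by omega) (by omega)
    (by omega) (by omega))

theorem O_b2 {I : Type} {x y z : I → ℕ} {P S D : Finset I} {col : I → Bool}
    (hy : Function.Injective y) (hp : OPre x y z P S D col)
    (hn : ONoCol x y z P S D col) {A0 B0 : ℕ}
    {s u w : I} (hs : s ∈ S) (hu : u ∈ S) (hw : w ∈ S)
    (s2 : y s < B0) (w1 : x w < A0)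
    (h1 : x s < x u) (h2 : x u < x w) (h3 : y w < y u) (z1 : z s < z u) (z2 : z u < z w) :
    ∃ d ∈ D, x d < A0 ∧ y d < B0 := by
  by_contra hh
  push Not at hh
  have hc : ∀ c, ∀ d ∈ D, x d < A0 → y d < B0 → col d = c := by
    intro c d hd a b
    have := hh d hd a
    omega
  obtain ⟨A1, B1, f1, hf1, a1, a2, a3, a4, a5, a6⟩ :=
    O_b hy hp hn (hc true) hs hu hw s2 w1 h1 h2 h3 z1 z2
  obtain ⟨A2, B2, f2, hf2, b1, b2, b3, b4, b5, b6⟩ :=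
    O_b hy hp hn (hc false) hs hu hw s2 w1 h1 h2 h3 z1 z2
  have k1 := a6 f1 hf1 a1 a2
  have k2 := b6 f2 hf2 b1 b2
  rcases le_total A1 A2 with h | h
  · have := b6 f1 hf1 (by omega) (by omega)
    simp [this] at k1
  · have := a6 f2 hf2 (by omega) (by omega)
    simp [this] at k2

theorem O_b1 {I : Type} {x y z : I → ℕ} {P S D : Finset I} {col : I → Bool}
    (hy : Function.Injective y) (hp : OPre x y z P S D col)
    (hn : ONoCol x y z P S D col) {A0 B0 : ℕ}
    (hb : OBad x y P S D col A0 B0)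
    {s u w : I} (hs : s ∈ S) (hu : u ∈ S) (hw : w ∈ S)
    (s2 : y s < B0) (w1 : x w < A0)
    (h1 : x s < x u) (h2 : x u < x w) (h3 : y w < y u) (z1 : z s < z u) (z2 : z u < z w)
    {d : I} (hd : d ∈ D) (d1 : x d < A0) (d2 : y d < B0) : y u < y d := by
  obtain ⟨_, c, hc⟩ := hb
  obtain ⟨A1, B1, f1, hf1, a1, a2, a3, a4, a5, a6⟩ :=
    O_b hy hp hn hc hs hu hw s2 w1 h1 h2 h3 z1 z2
  by_contra hh
  have k1 := a6 d hd (by omega) (by omega)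
  simp [hc d hd d1 d2] at k1

theorem exists_min_z {I : Type} (z : I → ℕ) (S : Finset I) (p : I → Prop)
    (h : ∃ s ∈ S, p s) : ∃ s ∈ S, p s ∧ ∀ t ∈ S, p t → z s ≤ z t := by
  classical
  obtain ⟨s, hs, hps⟩ := h
  obtain ⟨t, ht, hm⟩ := Finset.exists_min_image (S.filter p) z ⟨s, by simp [hs, hps]⟩
  simp only [Finset.mem_filter] at ht hm
  exact ⟨t, ht.1, ht.2, fun r hr hpr => hm r ⟨hr, hpr⟩⟩

open Classical in
theorem O_c {I : Type} {x y z : I → ℕ} {P S D : Finset I} {col : I → Bool}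
    (hx : Function.Injective x) (hy : Function.Injective y) (hz : Function.Injective z)
    (hp : OPre x y z P S D col)
    (hn : ONoCol x y z P S D col) {A0 B0 : ℕ}
    (hb : OBad x y P S D col A0 B0)
    {s : I} (hs : s ∈ S) (s1 : x s < A0) (s2 : y s < B0)
    (hmin : ∀ t ∈ S, x t < A0 → y t < B0 → z s ≤ z t) :
    (P.filter fun i => x i < A0 ∧ y i < y s).card ≤ 4 := by
  have hb' : OBad x y P S D col A0 (y s) := hb.mono le_rfl (by omega)
  have hant : ∀ a ∈ S, ∀ b ∈ S, a ≠ b → (x a < x b ∧ y b < y a) ∨ (x b < x a ∧ y a < y b) := by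
    intro a ha b hb hab
    have h1 := hp.anti a ha b hb
    have h2 := hp.anti b hb a ha
    have h3 : x a ≠ x b := fun h => hab (hx h)
    have h4 : y a ≠ y b := fun h => hab (hy h)
    omega
  have hzz : ∀ a b, a ≠ b → z a ≠ z b := fun a b hab h => hab (hz h)
  by_cases hRS : ∃ u ∈ S, x u < A0 ∧ y u < y s
  · obtain ⟨u, hu, ⟨u1, u2⟩, umin⟩ := exists_min_z z S (fun u => x u < A0 ∧ y u < y s) hRS
    have hsu : s ≠ u := by rintro rfl; omega
    have hxsu : x s < x u := by have := hant s hs u hu hsu; omega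
    have hzsu : z s < z u := by
      have := hmin u hu u1 (by omega)
      have := hzz s u hsu
      omega
    have hR : ∀ w ∈ S, x w < A0 → y w < y s → w ≠ u → x u < x w ∧ y w < y u := by
      intro w hw w1 w2 hwu
      by_contra hh
      have hq := hant w hw u hu hwu
      have hsw : s ≠ w := by rintro rfl; omega
      have hq' := hant s hs w hw hsw
      have zz1 := hzz w u hwu
      have zz2 := umin w hw ⟨w1, w2⟩
      exact O_a hn hb hs hw hu s2 u1 (by omega) (by omega) (by omega) (by omega)
    let D1 := D.filter fun d => x d < A0 ∧ y d < y s ∧ x u < x d ∧ y u < y d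
    let D2 := D.filter fun d => x d < x u ∧ y d < y s
    let D3 := D.filter fun d => x d < A0 ∧ y d < y u
    have hD1 : D1.card ≤ 1 := by
      rw [Finset.card_le_one]
      intro d hd e he
      simp only [D1, Finset.mem_filter] at hd he
      exact hp.L A0 (y s) hb' u hu u1 u2 (fun t ht h1 h2 => umin t ht ⟨h1, h2⟩) d hd.1 e he.1
        (by omega) (by omega) (by omega) (by omega) (by omega) (by omega) (by omega) (by omega)
    have hD2 : D2.card ≤ 1 := by
      rw [Finset.card_le_one]
      intro d hd e he
      simp only [D2, Finset.mem_filter] at hd he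
      refine hp.G (x u) (y s) (hb.mono (by omega) (by omega)) ?_ d hd.1 e he.1
        (by omega) (by omega) (by omega) (by omega)
      intro w hw w1
      by_contra hh
      have hwu : w ≠ u := by rintro rfl; omega
      have := hR w hw (by omega) (by omega) hwu
      omega
    have hsplit : ∀ d ∈ D, x d < A0 → y d < y s → d ∈ D1 ∨ d ∈ D2 ∨ d ∈ D3 := by
      intro d hd d1 d2
      simp only [D1, D2, D3, Finset.mem_filter]
      have hdu : d ≠ u := by rintro rfl; exact hp.disj _ hu hd
      have h3 : x d ≠ x u := fun h => hdu (hx h)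
      have h4 : y d ≠ y u := fun h => hdu (hy h)
      simp only [hd, true_and]
      omega
    by_cases hR2 : ∃ w ∈ S, x w < A0 ∧ y w < y u
    · obtain ⟨w, hw, w1, w2⟩ := hR2
      have hwu : u ≠ w := by rintro rfl; omega
      have hxw : x u < x w := by have := hant u hu w hw hwu; omega
      have hzuw : z u < z w := by
        have := umin w hw ⟨w1, by omega⟩
        have := hzz u w hwu
        omega
      have key : ∀ w ∈ S, x w < A0 → y w < y u → ∀ w' ∈ S, x w' < A0 → y w' < y u →
          x w < x w' → False := by
        intro w hw w1 w2 w' hw' w1' w2' hlt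
        have hww : w ≠ w' := by rintro rfl; omega
        have hyw : y w' < y w := by have := hant w hw w' hw' hww; omega
        have hwu : u ≠ w := by rintro rfl; omega
        have hxw : x u < x w := by have := hant u hu w hw hwu; omega
        have hzuw : z u < z w := by
          have := umin w hw ⟨w1, by omega⟩
          have := hzz u w hwu
          omega
        have hwz := hzz w w' hww
        rcases lt_or_gt_of_ne hwz with hlz | hlz
        · obtain ⟨d, hd, d1, d2⟩ := O_b2 (A0 := A0) (B0 := y u + 1) hy hp hn hu hw hw' (by omega)
            (by omega) hxw hlt hyw hzuw hlz
          have := O_b1 hy hp hn hb hs hu hw s2 w1 hxsu hxw w2 hzsu hzuw hd d1 (by omega)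
          omega
        · exact O_a hn hb hu hw hw' (by omega) (by omega) hxw hyw hzuw hlz
      have hsub : (P.filter fun i => x i < A0 ∧ y i < y s) ⊆ ({u} ∪ {w}) ∪ (D1 ∪ D2) := by
        intro i hi
        simp only [Finset.mem_filter] at hi
        simp only [Finset.mem_union, Finset.mem_singleton]
        rcases hb'.1 i hi.1 hi.2.1 hi.2.2 with h | h
        · left
          by_contra hh
          push Not at hh
          have h1 := hR i h hi.2.1 hi.2.2 hh.1
          have h3 := hant i h w hw hh.2
          rcases h3 with h3 | h3
          · exact key i h (by omega) (by omega) w hw (by omega) (by omega) (by omega)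
          · exact key w hw (by omega) (by omega) i h (by omega) (by omega) (by omega)
        · right
          rcases hsplit i h hi.2.1 hi.2.2 with h' | h' | h'
          · exact Or.inl h'
          · exact Or.inr h'
          · exfalso
            simp only [D3, Finset.mem_filter] at h'
            have := O_b1 hy hp hn hb hs hu hw s2 w1 hxsu hxw w2 hzsu hzuw h (by omega) (by omega)
            omega
      have c1 := Finset.card_le_card hsub
      have c2 := Finset.card_union_le (({u} : Finset I) ∪ {w}) (D1 ∪ D2)
      have c3 := Finset.card_union_le ({u} : Finset I) {w}
      have c4 := Finset.card_union_le D1 D2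
      simp only [Finset.card_singleton] at c3
      omega
    · push Not at hR2
      have hD3 : D3.card ≤ 1 := by
        rw [Finset.card_le_one]
        intro d hd e he
        simp only [D3, Finset.mem_filter] at hd he
        exact hp.G A0 (y u) (hb.mono (by omega) (by omega)) hR2 d hd.1 e he.1
          (by omega) (by omega) (by omega) (by omega)
      have hsub : (P.filter fun i => x i < A0 ∧ y i < y s) ⊆ ({u} ∪ D3) ∪ (D1 ∪ D2) := by
        intro i hi
        simp only [Finset.mem_filter] at hi
        simp only [Finset.mem_union, Finset.mem_singleton]
        rcases hb'.1 i hi.1 hi.2.1 hi.2.2 with h | h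
        · left; left
          by_contra hh
          have h1 := hR i h hi.2.1 hi.2.2 hh
          have := hR2 i h (by omega)
          omega
        · have := hsplit i h hi.2.1 hi.2.2
          tauto
      have c1 := Finset.card_le_card hsub
      have c2 := Finset.card_union_le (({u} : Finset I) ∪ D3) (D1 ∪ D2)
      have c3 := Finset.card_union_le ({u} : Finset I) D3
      have c4 := Finset.card_union_le D1 D2
      simp only [Finset.card_singleton] at c3
      omega
  · push Not at hRS
    refine le_trans (Finset.card_le_one.2 ?_) (by norm_num)
    intro d hd e he
    simp only [Finset.mem_filter] at hd he
    have f : ∀ i ∈ P, x i < A0 → y i < y s → i ∈ D := by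
      intro i hi h1 h2
      refine (hb'.1 i hi h1 h2).resolve_left fun h => ?_
      have := hRS i h h1
      omega
    exact hp.G A0 (y s) hb' hRS d (f d hd.1 hd.2.1 hd.2.2) e (f e he.1 he.2.1 he.2.2)
      hd.2.1 hd.2.2 he.2.1 he.2.2

open Classical in
theorem O_claim {I : Type} {x y z : I → ℕ} {P S D : Finset I} {col : I → Bool}
    (hx : Function.Injective x) (hy : Function.Injective y) (hz : Function.Injective z)
    (hp : OPre x y z P S D col)
    (hn : ONoCol x y z P S D col) {A0 B0 : ℕ}
    (hb : OBad x y P S D col A0 B0) :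
    (P.filter fun i => x i < A0 ∧ y i < B0).card ≤ 10 := by
  by_cases hS : ∃ s ∈ S, x s < A0 ∧ y s < B0
  · obtain ⟨s, hs, ⟨s1, s2⟩, smin⟩ := exists_min_z z S (fun u => x u < A0 ∧ y u < B0) hS
    have r1 := O_c hx hy hz hp hn hb hs s1 s2 (fun t ht h1 h2 => smin t ht ⟨h1, h2⟩)
    have r2 := O_c hy hx hz hp.swap hn.swap hb.swap hs s2 s1 (fun t ht h1 h2 => smin t ht ⟨h2, h1⟩)
    have r3 : (D.filter fun d => x d < A0 ∧ y d < B0 ∧ x s < x d ∧ y s < y d).card ≤ 1 := by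
      rw [Finset.card_le_one]
      intro d hd e he
      simp only [Finset.mem_filter] at hd he
      exact hp.L A0 B0 hb s hs s1 s2 (fun t ht h1 h2 => smin t ht ⟨h1, h2⟩) d hd.1 e he.1
        (by omega) (by omega) (by omega) (by omega) (by omega) (by omega) (by omega) (by omega)
    have hsub : (P.filter fun i => x i < A0 ∧ y i < B0) ⊆
        ({s} ∪ (D.filter fun d => x d < A0 ∧ y d < B0 ∧ x s < x d ∧ y s < y d)) ∪
        ((P.filter fun i => x i < A0 ∧ y i < y s) ∪ (P.filter fun i => y i < B0 ∧ x i < x s)) := by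
      intro i hi
      simp only [Finset.mem_filter, Finset.mem_union, Finset.mem_singleton] at hi ⊢
      by_cases his : i = s
      · simp [his]
      have h3 : x i ≠ x s := fun h => his (hx h)
      have h4 : y i ≠ y s := fun h => his (hy h)
      simp only [hi, his, true_and, false_or]
      rcases hb.1 i hi.1 hi.2.1 hi.2.2 with h | h
      · have := hp.anti s hs i h
        omega
      · simp only [h, true_and]
        omega
    have c1 := Finset.card_le_card hsub
    have c2 := Finset.card_union_le ({s} ∪ (D.filter fun d => x d < A0 ∧ y d < B0 ∧ x s < x d ∧ y s < y d))
        ((P.filter fun i => x i < A0 ∧ y i < y s) ∪ (P.filter fun i => y i < B0 ∧ x i < x s))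
    have c3 := Finset.card_union_le {s} (D.filter fun d => x d < A0 ∧ y d < B0 ∧ x s < x d ∧ y s < y d)
    have c4 := Finset.card_union_le (P.filter fun i => x i < A0 ∧ y i < y s) (P.filter fun i => y i < B0 ∧ x i < x s)
    simp only [Finset.card_singleton] at c3
    omega
  · push Not at hS
    refine le_trans (Finset.card_le_one.2 ?_) (by norm_num)
    intro d hd e he
    simp only [Finset.mem_filter] at hd he
    have f : ∀ i ∈ P, x i < A0 → y i < B0 → i ∈ D := by
      intro i hi h1 h2
      refine (hb.1 i hi h1 h2).resolve_left fun h => ?_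
      have := hS i h h1
      omega
    exact hp.G A0 B0 hb hS d (f d hd.1 hd.2.1 hd.2.2) e (f e he.1 he.2.1 he.2.2)
      hd.2.1 hd.2.2 he.2.1 he.2.2

structure OInv {I : Type} (x y z : I → ℕ) (P S D : Finset I) (col : I → Bool)
    (ch : (I → Bool) → I → Bool) : Prop where
  pre : OPre x y z P S D col
  hS : ∀ α, ∀ s ∈ S, ch α s = α s
  hD : ∀ α, ∀ d ∈ D, ch α d = col d
  good : ∀ q ∈ P, q ∉ S → q ∉ D → ∀ α A B, x q < A → y q < B →
    ∃ a ∈ P, ∃ b ∈ P, x a < A ∧ y a < B ∧ x b < A ∧ y b < B ∧ ch α a ≠ ch α b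

open Classical in
theorem O_colorstep {I : Type} {x y z : I → ℕ} {P S D : Finset I} {col : I → Bool}
    {ch : (I → Bool) → I → Bool} (hz : Function.Injective z)
    (h : OInv x y z P S D col ch) {s : I} (hs : s ∈ S) {c : Bool}
    (hRG : ORG x y P S D col s c) (hRL : ORL x y z P S D col s c) :
    OInv x y z P (S.erase s) (insert s D) (Function.update col s c)
      (fun α => ch (Function.update α s c)) := by
  have hp := h.pre
  have hsD : s ∉ D := hp.disj s hs
  have hcol : ∀ d ∈ D, Function.update col s c d = col d := by
    intro d hd
    rw [Function.update_of_ne]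
    rintro rfl; exact hsD hd
  have hbad : ∀ A B, OBad x y P (S.erase s) (insert s D) (Function.update col s c) A B →
      OBad x y P S D col A B ∧ (x s < A → y s < B → ∀ d ∈ D, x d < A → y d < B → col d = c) := by
    rintro A B ⟨h1, c', h2⟩
    refine ⟨⟨fun i hi a b => ?_, c', fun d hd a b => ?_⟩, fun a b d hd a' b' => ?_⟩
    · have := h1 i hi a b
      simp only [Finset.mem_erase, Finset.mem_insert] at this
      rcases this with h | h | h
      · exact Or.inl h.2
      · exact Or.inl (h ▸ hs)
      · exact Or.inr h
    · rw [← hcol d hd]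
      exact h2 d (by simp [hd]) a b
    · have e1 := h2 d (by simp [hd]) a' b'
      have e2 := h2 s (by simp) a b
      rw [hcol d hd] at e1
      simp at e2
      rw [e1, e2]
  refine ⟨⟨?_, ?_, ?_, ?_, ?_, ?_, ?_⟩, ?_, ?_, ?_⟩
  · intro i hi; exact hp.SP i (Finset.mem_of_mem_erase hi)
  · intro i hi
    rcases Finset.mem_insert.1 hi with rfl | hi
    · exact hp.SP _ hs
    · exact hp.DP i hi
  · intro i hi
    simp only [Finset.mem_erase] at hi
    simp [hi.1, hp.disj i hi.2]
  · intro a ha b hb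
    exact hp.anti a (Finset.mem_of_mem_erase ha) b (Finset.mem_of_mem_erase hb)
  · intro d hd b hb
    rcases Finset.mem_insert.1 hd with rfl | hd
    · exact hp.anti _ hs b (Finset.mem_of_mem_erase hb)
    · exact hp.nb d hd b (Finset.mem_of_mem_erase hb)
  · intro A B hb hS d hd e he a1 a2 a3 a4
    obtain ⟨hb1, hb2⟩ := hbad A B hb
    by_cases hin : x s < A ∧ y s < B
    · have hDe : ∀ d ∈ D, x d < A → y d < B → False := by
        intro d hd d1 d2
        refine hRG A B hb1 hin.1 hin.2 ?_ d hd d1 d2 (hb2 hin.1 hin.2 d hd d1 d2)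
        intro t ht t1 t2
        by_contra hh
        have := hS t (by simp [hh, ht]) t1
        omega
      rcases Finset.mem_insert.1 hd with rfl | hd
      · rcases Finset.mem_insert.1 he with rfl | he
        · rfl
        · exact (hDe e he a3 a4).elim
      · exact (hDe d hd a1 a2).elim
    · have k : ∀ d ∈ insert s D, x d < A → y d < B → d ∈ D := by
        intro d hd d1 d2
        rcases Finset.mem_insert.1 hd with rfl | hd
        · exact (hin ⟨d1, d2⟩).elim
        · exact hd
      refine hp.G A B hb1 ?_ d (k d hd a1 a2) e (k e he a3 a4) a1 a2 a3 a4
      intro t ht t1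
      by_contra hh
      have hts : t ≠ s := by rintro rfl; omega
      have := hS t (by simp [hts, ht]) t1
      omega
  · intro A B hb u hu u1 u2 umin d hd e he a1 a2 a3 a4 b1 b2 b3 b4
    obtain ⟨hb1, hb2⟩ := hbad A B hb
    obtain ⟨hus, hu'⟩ := Finset.mem_erase.1 hu
    clear hu
    have hu := hu'
    clear hu'
    have k : ∀ d ∈ insert s D, x u < x d → y u < y d → d ∈ D := by
      intro d hd d1 d2
      rcases Finset.mem_insert.1 hd with rfl | hd
      · have := hp.anti u hu d hs; omega
      · exact hd
    have hd := k d hd b1 b2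
    have he := k e he b3 b4
    by_cases hin : x s < A ∧ y s < B ∧ z s < z u
    · refine hRL A B hb1 hin.1 hin.2.1 ?_ u hu u1 u2 hus ?_ (hb2 hin.1 hin.2.1) d hd e he
        a1 a2 a3 a4 b1 b2 b3 b4
      · intro t ht t1 t2
        by_cases hts : t = s
        · rw [hts]
        · have := umin t (by simp [hts, ht]) t1 t2
          omega
      · intro t ht t1 t2 hts
        exact umin t (by simp [hts, ht]) t1 t2
    · refine hp.L A B hb1 u hu u1 u2 ?_ d hd e he a1 a2 a3 a4 b1 b2 b3 b4
      intro t ht t1 t2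
      by_cases hts : t = s
      · subst hts; omega
      · exact umin t (by simp [hts, ht]) t1 t2
  · intro α t ht
    obtain ⟨hts, ht⟩ := Finset.mem_erase.1 ht
    rw [h.hS _ t ht, Function.update_of_ne hts]
  · intro α d hd
    rcases Finset.mem_insert.1 hd with rfl | hd
    · rw [h.hS _ _ hs]; simp
    · rw [h.hD _ d hd, hcol d hd]
  · intro q hq q1 q2 α
    simp only [Finset.mem_erase, Finset.mem_insert, not_and, not_or] at q1 q2
    exact h.good q hq (q1 q2.1) q2.2 _

open Classical in
theorem O_colorall {I : Type} {x y z : I → ℕ} (hz : Function.Injective z) {P : Finset I} :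
    ∀ (n : ℕ) {S D : Finset I} {col : I → Bool} {ch : (I → Bool) → I → Bool},
    S.card = n → OInv x y z P S D col ch →
    ∃ S' D' col' ch', OInv x y z P S' D' col' ch' ∧ ONoCol x y z P S' D' col' ∧
      ∀ α, ∃ α', ch' α = ch α' := by
  intro n
  induction n with
  | zero =>
    intro S D col ch hc h
    refine ⟨S, D, col, ch, h, ?_, fun α => ⟨α, rfl⟩⟩
    intro s hs
    rw [Finset.card_eq_zero] at hc
    simp [hc] at hs
  | succ n ih =>
    intro S D col ch hc h
    by_cases hn : ONoCol x y z P S D col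
    · exact ⟨S, D, col, ch, h, hn, fun α => ⟨α, rfl⟩⟩
    · unfold ONoCol at hn
      push Not at hn
      obtain ⟨s, hs, c, h1, h2⟩ := hn
      obtain ⟨S', D', col', ch', g1, g2, g3⟩ := ih (by rw [Finset.card_erase_of_mem hs]; omega)
        (O_colorstep hz h hs h1 h2)
      refine ⟨S', D', col', ch', g1, g2, fun α => ?_⟩
      obtain ⟨α', h'⟩ := g3 α
      exact ⟨_, h'⟩

open Classical in
theorem O_insert {I : Type} {x y z : I → ℕ} (hx : Function.Injective x)
    (hy : Function.Injective y) {P S D : Finset I} {col : I → Bool}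
    {ch : (I → Bool) → I → Bool} (h : OInv x y z P S D col ch) {p : I} (hpP : p ∉ P)
    (hpz : ∀ i ∈ P, z i < z p) :
    ∃ S' D' col' ch', OInv x y z (insert p P) S' D' col' ch' ∧
      ∀ α, ∃ α', ∀ i ∈ P, ch' α i = ch α' i := by
  have hp := h.pre
  have hne : ∀ i ∈ P, i ≠ p := by rintro i hi rfl; exact hpP hi
  by_cases hq : ∃ q ∈ P, x q < x p ∧ y q < y p
  · obtain ⟨q, hq, q1, q2⟩ := hq
    have hb : ∀ A B, OBad x y (insert p P) S D col A B → OBad x y P S D col A B :=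
      fun A B hb => ⟨fun i hi => hb.1 i (by simp [hi]), hb.2⟩
    refine ⟨S, D, col, fun α i => if i = p then !ch α q else ch α i, ⟨⟨?_, ?_, hp.disj, hp.anti,
      hp.nb, ?_, ?_⟩, ?_, ?_, ?_⟩, fun α => ⟨α, fun i hi => by simp [hne i hi]⟩⟩
    · intro i hi; simp [hp.SP i hi]
    · intro i hi; simp [hp.DP i hi]
    · intro A B hB; exact hp.G A B (hb A B hB)
    · intro A B hB; exact hp.L A B (hb A B hB)
    · intro α s hs; simp [hne s (hp.SP s hs), h.hS α s hs]
    · intro α s hs; simp [hne s (hp.DP s hs), h.hD α s hs]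
    · intro r hr r1 r2 α A B a1 a2
      rcases Finset.mem_insert.1 hr with rfl | hr
      · refine ⟨r, by simp, q, by simp [hq], a1, a2, by omega, by omega, ?_⟩
        simp [hne q hq]
      · obtain ⟨a, ha, b, hb, e1, e2, e3, e4, e5⟩ := h.good r hr r1 r2 α A B a1 a2
        refine ⟨a, by simp [ha], b, by simp [hb], e1, e2, e3, e4, ?_⟩
        simpa [hne a ha, hne b hb] using e5
  · push Not at hq
    have hpS : p ∉ S := fun hh => hpP (hp.SP p hh)
    have hpD : p ∉ D := fun hh => hpP (hp.DP p hh)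
    have hb : ∀ A B, OBad x y (insert p P) (insert p (S.filter fun s => ¬ (x p < x s ∧ y p < y s)))
        D col A B → OBad x y P S D col A B ∧
        ∀ s ∈ S, x s < A → y s < B → ¬ (x p < x s ∧ y p < y s) := by
      rintro A B ⟨h1, h2⟩
      refine ⟨⟨fun i hi a b => ?_, h2⟩, fun s hs a b => ?_⟩
      · have := h1 i (by simp [hi]) a b
        simp only [Finset.mem_insert, hne i hi, Finset.mem_filter, false_or] at this
        tauto
      · have := h1 s (by simp [hp.SP s hs]) a b
        simp only [Finset.mem_insert, hne s (hp.SP s hs), Finset.mem_filter, false_or,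
          hp.disj s hs, or_false] at this
        exact this.2
    refine ⟨insert p (S.filter fun s => ¬ (x p < x s ∧ y p < y s)), D, col,
      fun α i => if i = p then α p else
        ch (fun s => if s ∈ S ∧ x p < x s ∧ y p < y s then !α p else α s) i,
      ⟨⟨?_, ?_, ?_, ?_, ?_, ?_, ?_⟩, ?_, ?_, ?_⟩, fun α => ⟨_, fun i hi => by
        simp only [hne i hi, if_false]; rfl⟩⟩
    · intro i hi
      simp only [Finset.mem_insert, Finset.mem_filter] at hi ⊢
      exact hi.imp_right fun hh => hp.SP i hh.1
    · intro i hi; simp [hp.DP i hi]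
    · intro i hi
      simp only [Finset.mem_insert, Finset.mem_filter] at hi
      rcases hi with rfl | hi
      · exact hpD
      · exact hp.disj i hi.1
    · intro s hs t ht hlt
      simp only [Finset.mem_insert, Finset.mem_filter] at hs ht
      rcases hs with rfl | hs <;> rcases ht with rfl | ht
      · omega
      · omega
      · exact hq s (hp.SP s hs.1) hlt
      · exact hp.anti s hs.1 t ht.1 hlt
    · intro d hd t ht hlt
      simp only [Finset.mem_insert, Finset.mem_filter] at ht
      rcases ht with rfl | ht
      · exact hq d (hp.DP d hd) hlt
      · exact hp.nb d hd t ht.1 hlt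
    · intro A B hB hS
      obtain ⟨hb1, hb2⟩ := hb A B hB
      refine hp.G A B hb1 fun s hs s1 => ?_
      by_contra hh
      have := hS s (by simp [hs]; have := hb2 s hs s1 (by omega); right; omega) s1
      omega
    · intro A B hB s hs s1 s2 smin
      obtain ⟨hb1, hb2⟩ := hb A B hB
      have k : ∀ t ∈ S, x t < A → y t < B → z s ≤ z t := by
        intro t ht t1 t2
        exact smin t (by simp [ht]; have := hb2 t ht t1 (by omega); right; omega) t1 t2
      simp only [Finset.mem_insert, Finset.mem_filter] at hs
      rcases hs with rfl | hs
      · intro d hd e he a1 a2 a3 a4 _ _ _ _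
        refine hp.G A B hb1 ?_ d hd e he a1 a2 a3 a4
        intro t ht t1
        by_contra hh
        have := k t ht t1 (by omega)
        have := hpz t (hp.SP t ht)
        omega
      · exact hp.L A B hb1 s hs.1 s1 s2 k
    · intro α s hs
      simp only [Finset.mem_insert, Finset.mem_filter] at hs
      rcases hs with rfl | hs
      · simp
      · simp only [hne s (hp.SP s hs.1), if_false]
        rw [h.hS _ s hs.1, if_neg]
        exact fun hh => hs.2 hh.2
    · intro α d hd
      simp only [hne d (hp.DP d hd), if_false]
      exact h.hD _ d hd
    · intro r hr r1 r2 α A B a1 a2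
      simp only [Finset.mem_insert, Finset.mem_filter, not_or] at hr r1
      have hr := hr.resolve_left r1.1
      by_cases hrS : r ∈ S
      · have hab : x p < x r ∧ y p < y r := by
          by_contra hh
          exact r1.2 ⟨hrS, hh⟩
        refine ⟨r, by simp [hr], p, by simp, a1, a2, by omega, by omega, ?_⟩
        simp only [r1.1, if_false, if_true]
        rw [h.hS _ r hrS, if_pos ⟨hrS, hab⟩]
        simp
      · obtain ⟨a, ha, b, hb, e1, e2, e3, e4, e5⟩ := h.good r hr hrS r2
          (fun s => if s ∈ S ∧ x p < x s ∧ y p < y s then !α p else α s) A B a1 a2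
        refine ⟨a, by simp [ha], b, by simp [hb], e1, e2, e3, e4, ?_⟩
        simpa only [hne a ha, hne b hb, if_false] using e5

open Classical in
theorem O_two {I : Type} (x y z : I → ℕ) (hx : Function.Injective x)
    (hy : Function.Injective y) (hz : Function.Injective z) (P : Finset I) :
    ∃ f : I → Bool, ∀ A B C, 11 ≤ (P.filter fun i => x i < A ∧ y i < B ∧ z i < C).card →
      ∃ a ∈ P, ∃ b ∈ P, (x a < A ∧ y a < B ∧ z a < C) ∧ (x b < A ∧ y b < B ∧ z b < C) ∧
        f a ≠ f b := by
  suffices H : ∃ S D col ch, OInv x y z P S D col ch ∧ ∀ α, ∀ A B C,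
      11 ≤ (P.filter fun i => x i < A ∧ y i < B ∧ z i < C).card →
      ∃ a ∈ P, ∃ b ∈ P, (x a < A ∧ y a < B ∧ z a < C) ∧ (x b < A ∧ y b < B ∧ z b < C) ∧
        ch α a ≠ ch α b by
    obtain ⟨S, D, col, ch, _, h⟩ := H
    exact ⟨_, h fun _ => true⟩
  induction P using Finset.induction_on_max_value z with
  | empty =>
    refine ⟨∅, ∅, fun _ => true, fun α => α, ?_, ?_⟩
    · constructor
      · constructor <;> simp
      all_goals simp
    · simp
  | insert p P hpP hmax ih =>
    obtain ⟨S, D, col, ch, hI, h5⟩ := ih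
    have hpz : ∀ i ∈ P, z i < z p := by
      intro i hi
      refine lt_of_le_of_ne (hmax i hi) fun h => hpP ?_
      rw [← hz h]; exact hi
    obtain ⟨S1, D1, col1, ch1, hI1, hc1⟩ := O_insert hx hy hI hpP hpz
    obtain ⟨S2, D2, col2, ch2, hI2, hn2, hc2⟩ := O_colorall hz _ rfl hI1
    refine ⟨S2, D2, col2, ch2, hI2, ?_⟩
    intro α A B C hcard
    by_cases hC : z p < C
    · have heq : ((insert p P).filter fun i => x i < A ∧ y i < B ∧ z i < C) =
          (insert p P).filter fun i => x i < A ∧ y i < B := by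
        apply Finset.filter_congr
        intro i hi
        have : z i < C := by
          rcases Finset.mem_insert.1 hi with rfl | hi
          · exact hC
          · have := hpz i hi; omega
        simp [this]
      have hzC : ∀ i ∈ insert p P, z i < C := by
        intro i hi
        rcases Finset.mem_insert.1 hi with rfl | hi
        · exact hC
        · have := hpz i hi; omega
      rw [heq] at hcard
      have hnb : ¬ OBad x y (insert p P) S2 D2 col2 A B := by
        intro hb
        have := O_claim hx hy hz hI2.pre hn2 hb
        omega
      by_cases hg : ∀ i ∈ insert p P, x i < A → y i < B → i ∈ S2 ∨ i ∈ D2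
      · have : ¬ ∃ c : Bool, ∀ d ∈ D2, x d < A → y d < B → col2 d = c := fun hh => hnb ⟨hg, hh⟩
        have h1 : ¬ ∀ d ∈ D2, x d < A → y d < B → col2 d = true := fun hh => this ⟨true, hh⟩
        have h2 : ¬ ∀ d ∈ D2, x d < A → y d < B → col2 d = false := fun hh => this ⟨false, hh⟩
        push Not at h1 h2
        obtain ⟨d, hd, d1, d2, d3⟩ := h1
        obtain ⟨e, he, e1, e2, e3⟩ := h2
        have hd' := hI2.pre.DP d hd
        have he' := hI2.pre.DP e he
        refine ⟨d, hd', e, he', ⟨d1, d2, hzC _ hd'⟩, ⟨e1, e2, hzC _ he'⟩, ?_⟩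
        rw [hI2.hD α d hd, hI2.hD α e he]
        simp at d3 e3
        simp [d3, e3]
      · push Not at hg
        obtain ⟨i, hi, i1, i2, i3, i4⟩ := hg
        obtain ⟨a, ha, b, hb, e1, e2, e3, e4, e5⟩ := hI2.good i hi i3 i4 α A B i1 i2
        exact ⟨a, ha, b, hb, ⟨e1, e2, hzC _ ha⟩, ⟨e3, e4, hzC _ hb⟩, e5⟩
    · obtain ⟨α1, hα1⟩ := hc2 α
      obtain ⟨α0, hα0⟩ := hc1 α1
      rw [Finset.filter_insert, if_neg (by omega)] at hcard
      obtain ⟨a, ha, b, hb, h1, h2, h3⟩ := h5 α0 A B C hcard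
      refine ⟨a, by simp [ha], b, by simp [hb], h1, h2, ?_⟩
      rw [hα1, hα0 a ha, hα0 b hb]
      exact h3

open Classical in
theorem O_cover_aux {I : Type} (x y z : I → ℕ) (A0 B0 C0 : ℕ) (N : Finset I) :
    ∃ (Ac : Finset (ℕ × ℕ)) (F : Finset (ℕ × ℕ × ℕ)), Ac.card + F.card ≤ 2 * N.card + 1 ∧
      (∀ a ∈ Ac, a.1 ≤ A0 ∧ a.2 ≤ B0 ∧ ∀ b ∈ N, x b < a.1 → a.2 ≤ y b) ∧
      (∀ f ∈ F, f.1 ≤ A0 ∧ f.2.1 ≤ B0 ∧ f.2.2 ≤ C0 ∧ (∃ b ∈ N, f.2.2 ≤ z b) ∧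
        ∀ b ∈ N, x b < f.1 → y b < f.2.1 → f.2.2 ≤ z b) ∧
      (∀ q, x q < A0 → y q < B0 → z q < C0 → (∀ b ∈ N, ¬ (x b ≤ x q ∧ y b ≤ y q ∧ z b ≤ z q)) →
        (∃ a ∈ Ac, x q < a.1 ∧ y q < a.2) ∨ ∃ f ∈ F, x q < f.1 ∧ y q < f.2.1 ∧ z q < f.2.2) := by
  induction N using Finset.induction_on_max_value z with
  | empty =>
    exact ⟨{(A0, B0)}, ∅, by simp, by simp, by simp, fun q h1 h2 _ _ => Or.inl ⟨(A0, B0), by simp, h1, h2⟩⟩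
  | insert p N hpN hmax ih =>
    obtain ⟨Ac, F, hcard, hA, hF, hcov⟩ := ih
    have hcN : (insert p N).card = N.card + 1 := Finset.card_insert_of_notMem hpN
    by_cases hdead : (Ac.filter fun a => x p < a.1 ∧ y p < a.2).Nonempty
    · obtain ⟨aX, haX, hX⟩ := Finset.exists_max_image _ (fun a : ℕ × ℕ => a.1) hdead
      obtain ⟨aY, haY, hY⟩ := Finset.exists_max_image _ (fun a : ℕ × ℕ => a.2) hdead
      simp only [Finset.mem_filter] at haX haY hX hY
      refine ⟨(Ac.filter fun a => ¬ (x p < a.1 ∧ y p < a.2)) ∪ {(x p, aY.2), (aX.1, y p)},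
        F ∪ (Ac.filter fun a => x p < a.1 ∧ y p < a.2).image
          (fun a => (a.1, a.2, min (z p) C0)), ?_, ?_, ?_, ?_⟩
      · have c1 := Finset.card_union_le (Ac.filter fun a => ¬ (x p < a.1 ∧ y p < a.2))
          {(x p, aY.2), (aX.1, y p)}
        have c2 := Finset.card_union_le F ((Ac.filter fun a => x p < a.1 ∧ y p < a.2).image
          (fun a => (a.1, a.2, min (z p) C0)))
        have c3 := Finset.card_image_le (s := Ac.filter fun a => x p < a.1 ∧ y p < a.2)
          (f := fun a => (a.1, a.2, min (z p) C0))
        have c4 := Finset.card_le_two (a := (x p, aY.2)) (b := (aX.1, y p))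
        have c5 := Finset.card_filter_add_card_filter_not (s := Ac)
          (fun a => x p < a.1 ∧ y p < a.2)
        omega
      · intro a ha
        simp only [Finset.mem_union, Finset.mem_filter, Finset.mem_insert,
          Finset.mem_singleton] at ha
        rcases ha with ⟨ha, ha'⟩ | rfl | rfl
        · obtain ⟨h1, h2, h3⟩ := hA a ha
          refine ⟨h1, h2, fun b hb hb' => ?_⟩
          rcases Finset.mem_insert.1 hb with rfl | hb
          · omega
          · exact h3 b hb hb'
        · obtain ⟨h1, h2, h3⟩ := hA aY haY.1
          refine ⟨by dsimp only; omega, h2, fun b hb hb' => ?_⟩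
          rcases Finset.mem_insert.1 hb with rfl | hb
          · dsimp only at hb'; omega
          · exact h3 b hb (by dsimp only at hb'; omega)
        · obtain ⟨h1, h2, h3⟩ := hA aX haX.1
          refine ⟨h1, by dsimp only; omega, fun b hb hb' => ?_⟩
          rcases Finset.mem_insert.1 hb with rfl | hb
          · rfl
          · have := h3 b hb hb'
            dsimp only; omega
      · intro f hf
        rcases Finset.mem_union.1 hf with hf | hf
        · obtain ⟨h1, h2, h3, ⟨b', hb', h4⟩, h5⟩ := hF f hf
          have := hmax b' hb'
          refine ⟨h1, h2, h3, ⟨b', by simp [hb'], h4⟩, fun b hb h6 h7 => ?_⟩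
          rcases Finset.mem_insert.1 hb with rfl | hb
          · omega
          · exact h5 b hb h6 h7
        · obtain ⟨a, ha, rfl⟩ := Finset.mem_image.1 hf
          obtain ⟨ha, ha'⟩ := Finset.mem_filter.1 ha
          obtain ⟨h1, h2, h3⟩ := hA a ha
          refine ⟨h1, h2, by simp, ⟨p, by simp, by simp⟩, fun b hb h6 h7 => ?_⟩
          rcases Finset.mem_insert.1 hb with rfl | hb
          · simp
          · have := h3 b hb h6
            dsimp only at h7; omega
      · intro q q1 q2 q3 hq
        have hqp := hq p (by simp)
        rcases hcov q q1 q2 q3 (fun b hb => hq b (by simp [hb])) with ⟨a, ha, h1, h2⟩ | ⟨f, hf, h⟩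
        · by_cases hd : x p < a.1 ∧ y p < a.2
          · by_cases hzq : z q < z p
            · right
              refine ⟨(a.1, a.2, min (z p) C0), ?_, h1, h2, by simp [hzq, q3]⟩
              exact Finset.mem_union_right _ (Finset.mem_image.2 ⟨a, by simp [ha, hd], rfl⟩)
            · left
              by_cases hxq : x q < x p
              · refine ⟨(x p, aY.2), by simp, hxq, ?_⟩
                have := hY a ⟨ha, hd⟩
                dsimp only; omega
              · refine ⟨(aX.1, y p), by simp, ?_, ?_⟩
                · have := hX a ⟨ha, hd⟩
                  dsimp only; omega
                · dsimp only; omega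
          · left
            exact ⟨a, Finset.mem_union_left _ (by simp only [Finset.mem_filter]; exact ⟨ha, hd⟩),
              h1, h2⟩
        · right
          exact ⟨f, Finset.mem_union_left _ hf, h⟩
    · rw [Finset.not_nonempty_iff_eq_empty, Finset.filter_eq_empty_iff] at hdead
      refine ⟨Ac, F, by omega, ?_, ?_, ?_⟩
      · intro a ha
        obtain ⟨h1, h2, h3⟩ := hA a ha
        refine ⟨h1, h2, fun b hb hb' => ?_⟩
        rcases Finset.mem_insert.1 hb with rfl | hb
        · have := hdead ha; omega
        · exact h3 b hb hb'
      · intro f hf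
        obtain ⟨h1, h2, h3, ⟨b', hb', h4⟩, h5⟩ := hF f hf
        have := hmax b' hb'
        refine ⟨h1, h2, h3, ⟨b', by simp [hb'], h4⟩, fun b hb h6 h7 => ?_⟩
        rcases Finset.mem_insert.1 hb with rfl | hb
        · omega
        · exact h5 b hb h6 h7
      · intro q q1 q2 q3 hq
        exact hcov q q1 q2 q3 (fun b hb => hq b (by simp [hb]))

open Classical in
theorem O_cover {I : Type} (x y z : I → ℕ) (A0 B0 C0 : ℕ) (N : Finset I) :
    ∃ (F : Finset (ℕ × ℕ × ℕ)), F.card ≤ 2 * N.card + 1 ∧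
      (∀ f ∈ F, f.1 ≤ A0 ∧ f.2.1 ≤ B0 ∧ f.2.2 ≤ C0 ∧
        ∀ b ∈ N, x b < f.1 → y b < f.2.1 → f.2.2 ≤ z b) ∧
      (∀ q, x q < A0 → y q < B0 → z q < C0 → (∀ b ∈ N, ¬ (x b ≤ x q ∧ y b ≤ y q ∧ z b ≤ z q)) →
        ∃ f ∈ F, x q < f.1 ∧ y q < f.2.1 ∧ z q < f.2.2) := by
  obtain ⟨Ac, F, hcard, hA, hF, hcov⟩ := O_cover_aux x y z A0 B0 C0 N
  refine ⟨F ∪ Ac.image (fun a => (a.1, a.2, C0)), ?_, ?_, ?_⟩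
  · have c1 := Finset.card_union_le F (Ac.image (fun a => (a.1, a.2, C0)))
    have c2 := Finset.card_image_le (s := Ac) (f := fun a => (a.1, a.2, C0))
    omega
  · intro f hf
    rcases Finset.mem_union.1 hf with hf | hf
    · obtain ⟨h1, h2, h3, _, h5⟩ := hF f hf
      exact ⟨h1, h2, h3, h5⟩
    · obtain ⟨a, ha, rfl⟩ := Finset.mem_image.1 hf
      obtain ⟨h1, h2, h3⟩ := hA a ha
      refine ⟨h1, h2, le_rfl, fun b hb h4 h5 => ?_⟩
      have := h3 b hb h4
      dsimp only at h5
      omega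
  · intro q q1 q2 q3 hq
    rcases hcov q q1 q2 q3 hq with ⟨a, ha, h1, h2⟩ | ⟨f, hf, h⟩
    · exact ⟨(a.1, a.2, C0), Finset.mem_union_right _ (Finset.mem_image.2 ⟨a, ha, rfl⟩), h1, h2, q3⟩
    · exact ⟨f, Finset.mem_union_left _ hf, h⟩

open Classical in
theorem O_antichain {I : Type} (x y z : I → ℕ) (β : Finset I) (f : I → Bool)
    (hanti : ∀ p ∈ β, ∀ q ∈ β, p ≠ q → ¬ (x p ≤ x q ∧ y p ≤ y q ∧ z p ≤ z q))
    (hf : ∀ A B C, 11 ≤ (β.filter fun i => x i < A ∧ y i < B ∧ z i < C).card →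
      ∃ a ∈ β, ∃ b ∈ β, (x a < A ∧ y a < B ∧ z a < C) ∧ (x b < A ∧ y b < B ∧ z b < C) ∧
        f a ≠ f b) (A B C : ℕ) :
    (β.filter fun i => x i < A ∧ y i < B ∧ z i < C).card ≤
      21 * (β.filter fun i => (x i < A ∧ y i < B ∧ z i < C) ∧ f i = false).card + 10 := by
  set N := β.filter fun i => (x i < A ∧ y i < B ∧ z i < C) ∧ f i = false with hN
  obtain ⟨F, hF1, hF2, hF3⟩ := O_cover x y z A B C N
  have hsub : (β.filter fun i => x i < A ∧ y i < B ∧ z i < C) ⊆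
      N ∪ F.biUnion fun g => β.filter fun i => x i < g.1 ∧ y i < g.2.1 ∧ z i < g.2.2 := by
    intro q hq
    obtain ⟨hq, hq'⟩ := Finset.mem_filter.1 hq
    by_cases hqN : q ∈ N
    · exact Finset.mem_union_left _ hqN
    · refine Finset.mem_union_right _ ?_
      obtain ⟨g, hg, hg'⟩ := hF3 q hq'.1 hq'.2.1 hq'.2.2 (fun b hb => by
        refine hanti b (Finset.mem_filter.1 hb).1 q hq ?_
        rintro rfl; exact hqN hb)
      exact Finset.mem_biUnion.2 ⟨g, hg, by simp [hq, hg']⟩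
  have c1 := Finset.card_le_card hsub
  have c2 := Finset.card_union_le N
    (F.biUnion fun g => β.filter fun i => x i < g.1 ∧ y i < g.2.1 ∧ z i < g.2.2)
  have c3 := Finset.card_biUnion_le_card_mul F
    (fun g => β.filter fun i => x i < g.1 ∧ y i < g.2.1 ∧ z i < g.2.2) 10 (by
      intro g hg
      by_contra hh
      obtain ⟨h1, h2, h3, h4⟩ := hF2 g hg
      obtain ⟨a, ha, b, hb, ha', hb', hab⟩ := hf g.1 g.2.1 g.2.2 (by omega)
      have key : ∀ a ∈ β, (x a < g.1 ∧ y a < g.2.1 ∧ z a < g.2.2) → f a = true := by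
        intro a ha ha'
        by_contra hfa
        have : a ∈ N := by
          simp only [hN, Finset.mem_filter]
          exact ⟨ha, by omega, by simpa using hfa⟩
        have := h4 a this ha'.1 ha'.2.1
        omega
      exact hab (by rw [key a ha ha', key b hb hb']))
  omega

def olt {I : Type} (x y z : I → ℕ) (a b : I) : Prop := x a < x b ∧ y a < y b ∧ z a < z b

open Classical in
noncomputable def ocnt {I : Type} (x y z : I → ℕ) (P : Finset I) (q : I) : ℕ :=
  (P.filter fun i => olt x y z i q).card

theorem ocnt_lt {I : Type} (x y z : I → ℕ) (P : Finset I) {a b : I} (ha : a ∈ P)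
    (h : olt x y z a b) : ocnt x y z P a < ocnt x y z P b := by
  classical
  apply Finset.card_lt_card
  rw [Finset.ssubset_iff_of_subset]
  · refine ⟨a, Finset.mem_filter.2 ⟨ha, h⟩, fun hh => ?_⟩
    have := (Finset.mem_filter.1 hh).2
    unfold olt at this
    omega
  · intro i hi
    obtain ⟨hi, hi'⟩ := Finset.mem_filter.1 hi
    refine Finset.mem_filter.2 ⟨hi, ?_⟩
    unfold olt at *
    omega

def oredb {I : Type} (x y z : I → ℕ) (P : Finset I) (f : I → Bool) (q : I) : Prop :=
  ∃ r ∈ P, olt x y z r q ∧ f r = true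

open Classical in
noncomputable def obeta {I : Type} (x y z : I → ℕ) (P : Finset I) (f : I → Bool) (n : ℕ) :
    Finset I :=
  P.filter fun q => ocnt x y z P q = n ∧ ¬ oredb x y z P f q

open Classical in
theorem O_levels {I : Type} (x y z : I → ℕ) (hx : Function.Injective x)
    (hy : Function.Injective y) (hz : Function.Injective z) (P : Finset I) (m : ℕ) (N : ℕ) :
    ∃ f : I → Bool,
      (∀ q ∈ P, ocnt x y z P q < N → oredb x y z P f q → f q = false) ∧
      (∀ q ∈ P, ocnt x y z P q < N → ¬ oredb x y z P f q → m ≤ ocnt x y z P q → f q = true) ∧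
      (∀ n < N, n < m → ∀ A B C,
        11 ≤ ((obeta x y z P f n).filter fun i => x i < A ∧ y i < B ∧ z i < C).card →
        ∃ a ∈ obeta x y z P f n, ∃ b ∈ obeta x y z P f n,
          (x a < A ∧ y a < B ∧ z a < C) ∧ (x b < A ∧ y b < B ∧ z b < C) ∧ f a ≠ f b) := by
  induction N with
  | zero => exact ⟨fun _ => true, by simp, by simp, by simp⟩
  | succ N ih =>
    obtain ⟨f, h1, h2, h3⟩ := ih
    obtain ⟨g, hg⟩ := O_two x y z hx hy hz (obeta x y z P f N)
    let f' : I → Bool := fun q => if ocnt x y z P q = N then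
      (if oredb x y z P f q then false else if m ≤ N then true else g q) else f q
    have hf' : ∀ q, ocnt x y z P q < N → f' q = f q := by
      intro q hq
      have : ocnt x y z P q ≠ N := by omega
      simp [f', this]
    have hr : ∀ q, ocnt x y z P q ≤ N → (oredb x y z P f' q ↔ oredb x y z P f q) := by
      intro q hq
      unfold oredb
      refine exists_congr fun r => and_congr_right fun hr => and_congr_right fun hrq => ?_
      have := ocnt_lt x y z P hr hrq
      rw [hf' r (by omega)]
    have hbeta : ∀ n ≤ N, obeta x y z P f' n = obeta x y z P f n := by
      intro n hn
      unfold obeta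
      apply Finset.filter_congr
      intro q _
      refine and_congr_right fun hq => ?_
      rw [hr q (by omega)]
    refine ⟨f', ?_, ?_, ?_⟩
    · intro q hq hqN hred
      rw [hr q (by omega)] at hred
      by_cases hc : ocnt x y z P q = N
      · simp [f', hc, hred]
      · rw [hf' q (by omega)]
        exact h1 q hq (by omega) hred
    · intro q hq hqN hred hm
      rw [hr q (by omega)] at hred
      by_cases hc : ocnt x y z P q = N
      · simp only [f', hc, hred, if_true, if_false]
        rw [if_pos (by omega)]
      · rw [hf' q (by omega)]
        exact h2 q hq (by omega) hred hm
    · intro n hn hnm A B C hcard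
      rw [hbeta n (by omega)] at hcard ⊢
      by_cases hc : n = N
      · subst hc
        obtain ⟨a, ha, b, hb, e1, e2, e3⟩ := hg A B C hcard
        refine ⟨a, ha, b, hb, e1, e2, ?_⟩
        have key : ∀ a ∈ obeta x y z P f n, f' a = g a := by
          intro a ha
          simp only [obeta, Finset.mem_filter] at ha
          simp only [f', ha.2.1, ha.2.2, if_true, if_false]
          rw [if_neg (by omega)]
        rwa [key a ha, key b hb]
      · obtain ⟨a, ha, b, hb, e1, e2, e3⟩ := h3 n (by omega) hnm A B C hcard
        refine ⟨a, ha, b, hb, e1, e2, ?_⟩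
        have key : ∀ a ∈ obeta x y z P f n, f' a = f a := by
          intro a ha
          simp only [obeta, Finset.mem_filter] at ha
          exact hf' a (by omega)
        rwa [key a ha, key b hb]

open Classical in
theorem O_asym {I : Type} (x y z : I → ℕ) (hx : Function.Injective x)
    (hy : Function.Injective y) (hz : Function.Injective z) (P : Finset I) (m : ℕ) (hm : 1 ≤ m) :
    ∃ f : I → Bool, ∀ A B C,
      144 * m ^ 2 ≤ (P.filter fun i => x i < A ∧ y i < B ∧ z i < C).card →
      (∃ r ∈ P, (x r < A ∧ y r < B ∧ z r < C) ∧ f r = true) ∧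
      m ≤ (P.filter fun i => (x i < A ∧ y i < B ∧ z i < C) ∧ f i = false).card := by
  obtain ⟨f, h1, h2, h3⟩ := O_levels x y z hx hy hz P m (P.card + 1)
  have hcnt : ∀ q, ocnt x y z P q < P.card + 1 := fun q =>
    Nat.lt_succ_of_le (Finset.card_le_card (Finset.filter_subset _ _))
  refine ⟨f, fun A B C hcard => ?_⟩
  by_cases c1 : ∃ q ∈ P, (x q < A ∧ y q < B ∧ z q < C) ∧ ¬ oredb x y z P f q ∧ m ≤ ocnt x y z P q
  · obtain ⟨q, hq, hqO, hred, hqm⟩ := c1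
    refine ⟨⟨q, hq, hqO, h2 q hq (hcnt q) hred hqm⟩, le_trans hqm ?_⟩
    apply Finset.card_le_card
    intro i hi
    simp only [Finset.mem_filter] at hi ⊢
    refine ⟨hi.1, ?_, ?_⟩
    · have := hi.2
      unfold olt at this
      omega
    · by_contra hh
      exact hred ⟨i, hi.1, hi.2, by simpa using hh⟩
  push Not at c1
  by_cases c2 : ∃ j < m, 21 * m ≤
      ((obeta x y z P f j).filter fun i => x i < A ∧ y i < B ∧ z i < C).card
  · obtain ⟨j, hj, hjc⟩ := c2
    have hj' : (obeta x y z P f j) ⊆ P := Finset.filter_subset _ _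
    have hanti := O_antichain x y z (obeta x y z P f j) f (by
      intro p hp q hq hpq hh
      simp only [obeta, Finset.mem_filter] at hp hq
      have n1 : x p ≠ x q := fun h => hpq (hx h)
      have n2 : y p ≠ y q := fun h => hpq (hy h)
      have n3 : z p ≠ z q := fun h => hpq (hz h)
      have := ocnt_lt x y z P (a := p) (b := q) hp.1 ⟨by omega, by omega, by omega⟩
      omega) (fun A B C => by
        by_cases hjP : j < P.card + 1
        · exact h3 j hjP hj A B C
        · intro hc
          exfalso
          have hne : (obeta x y z P f j).card ≠ 0 := by
            have := Finset.card_filter_le (obeta x y z P f j)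
              (fun i => x i < A ∧ y i < B ∧ z i < C)
            omega
          obtain ⟨i, hi⟩ := Finset.card_ne_zero.1 hne
          simp only [obeta, Finset.mem_filter] at hi
          have := hcnt i
          omega) A B C
    constructor
    · by_cases hjP : j < P.card + 1
      · obtain ⟨a, ha, b, hb, e1, e2, e3⟩ := h3 j hjP hj A B C (by omega)
        by_cases hfa : f a = true
        · exact ⟨a, hj' ha, e1, hfa⟩
        · refine ⟨b, hj' hb, e2, ?_⟩
          cases hb' : f b <;> simp_all
      · exfalso
        have hne : (obeta x y z P f j).card ≠ 0 := by
          have := Finset.card_filter_le (obeta x y z P f j)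
            (fun i => x i < A ∧ y i < B ∧ z i < C)
          omega
        obtain ⟨i, hi⟩ := Finset.card_ne_zero.1 hne
        simp only [obeta, Finset.mem_filter] at hi
        have := hcnt i
        omega
    · have := Finset.card_le_card (Finset.filter_subset_filter
        (fun i => (x i < A ∧ y i < B ∧ z i < C) ∧ f i = false) hj')
      omega
  push Not at c2
  set Q := P.filter fun i => (x i < A ∧ y i < B ∧ z i < C) ∧ oredb x y z P f i with hQ
  have hsub : (P.filter fun i => x i < A ∧ y i < B ∧ z i < C) ⊆
      Q ∪ (Finset.range m).biUnion fun j =>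
        ((obeta x y z P f j).filter fun i => x i < A ∧ y i < B ∧ z i < C) := by
    intro i hi
    obtain ⟨hi, hi'⟩ := Finset.mem_filter.1 hi
    by_cases hr : oredb x y z P f i
    · exact Finset.mem_union_left _ (Finset.mem_filter.2 ⟨hi, hi', hr⟩)
    · refine Finset.mem_union_right _ (Finset.mem_biUnion.2 ⟨ocnt x y z P i, ?_, ?_⟩)
      · exact Finset.mem_range.2 (c1 i hi hi' hr)
      · simp [obeta, hi, hi', hr]
  have e1 := Finset.card_le_card hsub
  have e2 := Finset.card_union_le Q ((Finset.range m).biUnion fun j =>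
        ((obeta x y z P f j).filter fun i => x i < A ∧ y i < B ∧ z i < C))
  have e3 := Finset.card_biUnion_le_card_mul (Finset.range m) (fun j =>
        ((obeta x y z P f j).filter fun i => x i < A ∧ y i < B ∧ z i < C)) (21 * m)
        (fun j hj => (c2 j (Finset.mem_range.1 hj)).le)
  rw [Finset.card_range] at e3
  have hQm : m ≤ Q.card := by nlinarith
  constructor
  · obtain ⟨q, hq⟩ := Finset.card_pos.1 (show 0 < Q.card by omega)
    obtain ⟨hq, hqO, r, hr, hrq, hfr⟩ := Finset.mem_filter.1 hq
    refine ⟨r, hr, ?_, hfr⟩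
    unfold olt at hrq
    omega
  · refine hQm.trans (Finset.card_le_card ?_)
    intro q hq
    obtain ⟨hq, hqO, hred⟩ := Finset.mem_filter.1 hq
    exact Finset.mem_filter.2 ⟨hq, hqO, h1 q hq (hcnt q) hred⟩

open Classical in
theorem O_many {I : Type} (x y z : I → ℕ) (hx : Function.Injective x)
    (hy : Function.Injective y) (hz : Function.Injective z) (k : ℕ) : ∀ (P : Finset I),
    ∃ f : I → Fin (k + 2), ∀ A B C,
      12 ^ (2 ^ (k + 1) + 2 ^ k - 2) ≤ (P.filter fun i => x i < A ∧ y i < B ∧ z i < C).card →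
      ∀ j, ∃ i ∈ P, (x i < A ∧ y i < B ∧ z i < C) ∧ f i = j := by
  induction k with
  | zero =>
    intro P
    obtain ⟨f, hf⟩ := O_two x y z hx hy hz P
    refine ⟨fun i => if f i then 1 else 0, fun A B C hc j => ?_⟩
    obtain ⟨a, ha, b, hb, e1, e2, e3⟩ := hf A B C (by norm_num at hc; omega)
    by_cases hj : (if f a then (1 : Fin 2) else 0) = j
    · exact ⟨a, ha, e1, hj⟩
    · refine ⟨b, hb, e2, ?_⟩
      show (if f b then (1 : Fin 2) else 0) = j
      revert hj e3
      generalize f a = u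
      generalize f b = w
      revert u w j
      decide
  | succ k ih =>
    intro P
    obtain ⟨g, hg⟩ := O_asym x y z hx hy hz P (12 ^ (2 ^ (k + 1) + 2 ^ k - 2))
      (Nat.one_le_pow _ _ (by norm_num))
    obtain ⟨f, hf⟩ := ih (P.filter fun i => g i = false)
    have hexp : 12 ^ (2 ^ (k + 1 + 1) + 2 ^ (k + 1) - 2) =
        144 * (12 ^ (2 ^ (k + 1) + 2 ^ k - 2)) ^ 2 := by
      have : 2 ^ (k + 1 + 1) + 2 ^ (k + 1) - 2 = 2 + (2 ^ (k + 1) + 2 ^ k - 2) * 2 := by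
        have : 1 ≤ 2 ^ k := Nat.one_le_pow _ _ (by norm_num)
        rw [pow_succ 2 (k + 1), pow_succ 2 k]
        omega
      rw [this, pow_add, pow_mul]
      norm_num
    refine ⟨fun i => if g i then Fin.last _ else (f i).castSucc, fun A B C hc j => ?_⟩
    rw [hexp] at hc
    obtain ⟨⟨r, hr, hr1, hr2⟩, hb⟩ := hg A B C hc
    refine Fin.lastCases ?_ (fun j => ?_) j
    · exact ⟨r, hr, hr1, by simp [hr2]⟩
    · have heq : (P.filter fun i => (x i < A ∧ y i < B ∧ z i < C) ∧ g i = false) =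
          ((P.filter fun i => g i = false).filter fun i => x i < A ∧ y i < B ∧ z i < C) := by
        ext i
        simp only [Finset.mem_filter]
        tauto
      rw [heq] at hb
      obtain ⟨i, hi, hi1, hi2⟩ := hf A B C hb j
      obtain ⟨hi, hgi⟩ := Finset.mem_filter.1 hi
      exact ⟨i, hi, hi1, by simp [hgi, hi2]⟩

theorem O_rank {I : Type} [Fintype I] (a : I → ℝ) :
    ∃ r : I → ℕ, Function.Injective r ∧ ∀ t : ℝ, ∃ A : ℕ, ∀ i, a i ≤ t ↔ r i < A := by
  classical
  let e := Fintype.equivFin I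
  let σ := Tuple.sort (a ∘ e.symm)
  have hmono : Monotone ((a ∘ e.symm) ∘ σ) := Tuple.monotone_sort _
  refine ⟨fun i => (σ.symm (e i) : ℕ), ?_, fun t => ?_⟩
  · intro i j h
    simpa using Fin.ext h
  · have hr : ∀ i j, (σ.symm (e i) : ℕ) ≤ (σ.symm (e j) : ℕ) → a i ≤ a j := by
      intro i j h
      have := hmono (show σ.symm (e i) ≤ σ.symm (e j) from h)
      simpa using this
    refine ⟨(Finset.univ.filter fun i => a i ≤ t).sup fun i => (σ.symm (e i) : ℕ) + 1, fun i => ?_⟩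
    constructor
    · intro h
      exact Nat.lt_of_succ_le (Finset.le_sup (f := fun i => (σ.symm (e i) : ℕ) + 1)
        (Finset.mem_filter.2 ⟨Finset.mem_univ _, h⟩))
    · intro h
      obtain ⟨j, hj, hj'⟩ := Finset.lt_sup_iff.1 h
      have := hr i j (by dsimp only at h hj'; omega)
      exact this.trans (Finset.mem_filter.1 hj).2

theorem O_geom (p q r : Fin 2 → ℝ) (hT : AffineIndependent ℝ ![p, q, r])
    (I : Type) (lam : I → ℝ) (hlam : ∀ i, 0 < lam i) (v : I → (Fin 2 → ℝ)) :
    ∃ (a : Fin 3 → I → ℝ) (l : Fin 3 → (Fin 2 → ℝ) → ℝ), ∀ i x,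
      x ∈ Homothet (lam i) (v i) (convexHull ℝ {p, q, r}) ↔ ∀ j, a j i ≤ l j x := by
  have htop : affineSpan ℝ (Set.range ![p, q, r]) = ⊤ := by
    rw [hT.affineSpan_eq_top_iff_card_eq_finrank_add_one]
    simp
  let b : AffineBasis (Fin 3) ℝ (Fin 2 → ℝ) := ⟨![p, q, r], hT, htop⟩
  have hrange : Set.range b = {p, q, r} := by
    show Set.range ![p, q, r] = _
    ext t
    simp [eq_comm]
    tauto
  have hco : ∀ j y, b.coord j y = (b.coord j).linear y + b.coord j 0 := by
    intro j y
    have := congrFun (AffineMap.decomp (b.coord j)) y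
    simpa using this
  refine ⟨fun j i => (b.coord j).linear (v i) - lam i * b.coord j 0,
    fun j x => (b.coord j).linear x, fun i x => ?_⟩
  have h1 : x ∈ Homothet (lam i) (v i) (convexHull ℝ {p, q, r}) ↔
      (lam i)⁻¹ • (x - v i) ∈ convexHull ℝ {p, q, r} := by
    have hl := (hlam i).ne'
    constructor
    · rintro ⟨w, hw, rfl⟩
      simpa [smul_smul, hl] using hw
    · intro h
      exact ⟨_, h, by simp [smul_smul, hl]⟩
  rw [h1, ← hrange, b.convexHull_eq_nonneg_coord]
  refine forall_congr' fun j => ?_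
  rw [hco j, map_smul, map_sub, smul_eq_mul]
  have hl := hlam i
  constructor
  · intro h
    have := mul_nonneg hl.le h
    rw [mul_add, mul_inv_cancel_left₀ hl.ne'] at this
    linarith
  · intro h
    have : 0 ≤ (lam i)⁻¹ * (((b.coord j).linear x - (b.coord j).linear (v i)) +
      lam i * b.coord j 0) := mul_nonneg (inv_nonneg.2 hl.le) (by linarith)
    rwa [mul_add, inv_mul_cancel_left₀ hl.ne'] at this

/-- For every `k ≥ 2` and every triangle `T` (convex hull of three affinely
independent points of `ℝ²`), any `12^(2^(k-1)+2^(k-2)-2)`-fold covering of a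
subset of the plane by finitely many positive homothets of `T` decomposes into
`k` coverings. -/
theorem triangles_cover_decomposable_many
    (k : ℕ) (hk : 2 ≤ k)
    (p q r : Fin 2 → ℝ) (hT : AffineIndependent ℝ ![p, q, r])
    (I : Type) [Fintype I]
    (lam : I → ℝ) (hlam : ∀ i, 0 < lam i) (v : I → (Fin 2 → ℝ))
    (X : Set (Fin 2 → ℝ))
    (hcov : ∀ x ∈ X,
      12 ^ (2 ^ (k - 1) + 2 ^ (k - 2) - 2) ≤
        {i : I | x ∈ Homothet (lam i) (v i) (convexHull ℝ {p, q, r})}.ncard) :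
    ∃ f : I → Fin k, ∀ j : Fin k, ∀ x ∈ X, ∃ i : I,
      f i = j ∧ x ∈ Homothet (lam i) (v i) (convexHull ℝ {p, q, r}) := by
  classical
  obtain ⟨a, l, hal⟩ := O_geom p q r hT I lam hlam v
  obtain ⟨x, hx, hx'⟩ := O_rank (a 0)
  obtain ⟨y, hy, hy'⟩ := O_rank (a 1)
  obtain ⟨z, hz, hz'⟩ := O_rank (a 2)
  obtain ⟨k, rfl⟩ : ∃ k', k = k' + 2 := ⟨k - 2, by omega⟩
  obtain ⟨f, hf⟩ := O_many x y z hx hy hz k Finset.univ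
  refine ⟨f, fun j t ht => ?_⟩
  obtain ⟨A, hA⟩ := hx' (l 0 t)
  obtain ⟨B, hB⟩ := hy' (l 1 t)
  obtain ⟨C, hC⟩ := hz' (l 2 t)
  have key : ∀ i, t ∈ Homothet (lam i) (v i) (convexHull ℝ {p, q, r}) ↔
      (x i < A ∧ y i < B ∧ z i < C) := by
    intro i
    rw [hal, Fin.forall_fin_succ, Fin.forall_fin_succ, Fin.forall_fin_succ, ← hA, ← hB, ← hC]
    simp
  have hc := hcov t ht
  have hset : {i : I | t ∈ Homothet (lam i) (v i) (convexHull ℝ {p, q, r})} =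
      ((Finset.univ.filter fun i => x i < A ∧ y i < B ∧ z i < C : Finset I) : Set I) := by
    ext i
    simp [key]
  rw [hset, Set.ncard_coe_finset] at hc
  obtain ⟨i, -, h1, h2⟩ := hf A B C hc j
  exact ⟨i, h2, (key i).2 h1⟩
end

section
/- Four colors are sometimes needed: there exists a finite set S ⊆ ℝ³ such that for every coloring c : S → Fin 3 there is some a ∈ ℝ³ with |S ∩ O(a)| ≥ 2 on which c is constant, i.e., some translate of the octant contains at least two points of S, all of the same color. -/
def fourPts : Fin 4 → Fin 3 → ℝ :=
  ![![1, 1, 1], ![2, 0, 0], ![0, 2, 0], ![0, 0, 2]]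

theorem fourPts_inj : Function.Injective fourPts := by
  intro i j h
  have h0 := congrFun h 0
  have h1 := congrFun h 1
  have h2 := congrFun h 2
  fin_cases i <;> fin_cases j <;> simp [fourPts] at h0 h1 h2 ⊢

theorem fourPts_oct (i j k : Fin 4) (hij : i ≠ j)
    (h : fourPts k ∈ Octant (fourPts i ⊔ fourPts j)) : k = i ∨ k = j := by
  obtain ⟨h0, h1, h2⟩ := h
  fin_cases i <;> fin_cases j <;> fin_cases k <;>
    simp [fourPts] at h0 h1 h2 hij ⊢ <;>
    first | (norm_num at h0; done) | (norm_num at h1; done) | (norm_num at h2; done)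

/-- Four colors are sometimes needed: there is a finite point set in `ℝ³` such that
for every 3-coloring, some translate of the octant contains at least two of the
points and all points of the set inside it get the same color. -/
theorem three_colors_not_enough :
    ∃ S : Set (Fin 3 → ℝ), S.Finite ∧
      ∀ c : S → Fin 3, ∃ a : Fin 3 → ℝ,
        2 ≤ (S ∩ Octant a).ncard ∧
        ∀ x y : S, (x : Fin 3 → ℝ) ∈ Octant a → (y : Fin 3 → ℝ) ∈ Octant a →
          c x = c y := by
  refine ⟨Set.range fourPts, Set.finite_range _, fun c => ?_⟩
  obtain ⟨i, j, hij, hc⟩ := Fintype.exists_ne_map_eq_of_card_lt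
    (fun i : Fin 4 => c ⟨fourPts i, i, rfl⟩) (by simp)
  have hi : fourPts i ∈ Octant (fourPts i ⊔ fourPts j) := by simp [Octant]
  have hj : fourPts j ∈ Octant (fourPts i ⊔ fourPts j) := by simp [Octant]
  refine ⟨fourPts i ⊔ fourPts j, ?_, ?_⟩
  · rw [← Set.ncard_pair (fourPts_inj.ne hij)]
    apply Set.ncard_le_ncard
    · rintro x (rfl | rfl)
      · exact ⟨⟨i, rfl⟩, hi⟩
      · exact ⟨⟨j, rfl⟩, hj⟩
    · exact (Set.finite_range _).inter_of_left _
  · rintro ⟨_, k, rfl⟩ ⟨_, l, rfl⟩ hk hl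
    rcases fourPts_oct i j k hij hk with rfl | rfl <;>
      rcases fourPts_oct _ _ l hij hl with rfl | rfl <;>
      first | rfl | exact hc | exact hc.symm
end

section
/- Quadrants are cover-decomposable: there exists an integer m such that any m-fold covering of any subset of ℝ² with a finite number of translates of a given quadrant can be decomposed into two coverings. Precisely: there is m such that for every finite index set I, every b : I → ℝ², and every X ⊆ ℝ², if every point of X belongs to Q(b i) = {q ∈ ℝ² : q₁ ≤ (b i)₁ ∧ q₂ ≤ (b i)₂} for at least m indices i, then there exists f : I → Bool such that for each value of f and every x ∈ X some quadrant of that class contains x. -/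
/-- The quadrant with apex `b`. -/
def Quadrant (b : Fin 2 → ℝ) : Set (Fin 2 → ℝ) :=
  {q | q 0 ≤ b 0 ∧ q 1 ≤ b 1}

theorem quad_aux {I : Type} [DecidableEq I] (b : I → (Fin 2 → ℝ)) (S : Finset I) :
    ∃ f : I → Bool, ∀ x : Fin 2 → ℝ,
      (∃ i ∈ S, ∃ j ∈ S, i ≠ j ∧ x ∈ Quadrant (b i) ∧ x ∈ Quadrant (b j)) →
      ∃ i ∈ S, ∃ j ∈ S, f i ≠ f j ∧ x ∈ Quadrant (b i) ∧ x ∈ Quadrant (b j) := by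
  induction S using Finset.induction_on_min_value (fun i => b i 0) with
  | empty => exact ⟨fun _ => true, by simp⟩
  | insert p S hp hmin ih =>
    obtain ⟨f, hf⟩ := ih
    rcases S.eq_empty_or_nonempty with rfl | hne
    · refine ⟨f, ?_⟩
      rintro x ⟨i, hi, j, hj, hij, -⟩
      simp at hi hj
      exact absurd (hi.trans hj.symm) hij
    obtain ⟨t, ht, hmax⟩ := S.exists_max_image (fun i => b i 1) hne
    have key : ∀ x, x ∈ Quadrant (b p) → (∃ j ∈ S, x ∈ Quadrant (b j)) →
        x ∈ Quadrant (b t) := by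
      rintro x hx ⟨j, hj, hxj⟩
      exact ⟨hx.1.trans (hmin t ht), hxj.2.trans (hmax j hj)⟩
    have hu : ∀ i ∈ S, Function.update f p (!f t) i = f i := by
      intro i hi
      have hne' : i ≠ p := by rintro rfl; exact hp hi
      exact Function.update_of_ne hne' _ _
    refine ⟨Function.update f p (!f t), ?_⟩
    rintro x ⟨i, hi, j, hj, hij, hxi, hxj⟩
    have fin : x ∈ Quadrant (b p) → (∃ j ∈ S, x ∈ Quadrant (b j)) → _ := fun h1 h2 =>
      (⟨p, Finset.mem_insert_self _ _, t, Finset.mem_insert_of_mem ht,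
        by rw [hu t ht]; simp, h1, key x h1 h2⟩ :
        ∃ i ∈ insert p S, ∃ j ∈ insert p S, Function.update f p (!f t) i ≠
          Function.update f p (!f t) j ∧ x ∈ Quadrant (b i) ∧ x ∈ Quadrant (b j))
    rcases Finset.mem_insert.1 hi with rfl | hi2
    · rcases Finset.mem_insert.1 hj with rfl | hj
      · exact absurd rfl hij
      · exact fin hxi ⟨j, hj, hxj⟩
    · rcases Finset.mem_insert.1 hj with rfl | hj
      · exact fin hxj ⟨i, hi2, hxi⟩
      · obtain ⟨k, hk, l, hl, h, h'⟩ := hf x ⟨i, hi2, j, hj, hij, hxi, hxj⟩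
        exact ⟨k, Finset.mem_insert_of_mem hk, l, Finset.mem_insert_of_mem hl,
          by rwa [hu k hk, hu l hl], h'⟩

/-- Quadrants are cover-decomposable: there is an `m` such that any `m`-fold
covering of any subset of `ℝ²` by finitely many translates of the quadrant
decomposes into two coverings. -/
theorem quadrants_cover_decomposable :
    ∃ m : ℕ, ∀ (I : Type) [Fintype I], ∀ (b : I → (Fin 2 → ℝ)) (X : Set (Fin 2 → ℝ)),
      (∀ x ∈ X, m ≤ {i : I | x ∈ Quadrant (b i)}.ncard) →
      ∃ f : I → Bool, ∀ v : Bool, ∀ x ∈ X, ∃ i : I, f i = v ∧ x ∈ Quadrant (b i) := by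
  classical
  refine ⟨2, ?_⟩
  intro I _ b X hX
  obtain ⟨f, hf⟩ := quad_aux b Finset.univ
  refine ⟨f, ?_⟩
  intro v x hx
  obtain ⟨i, hi, j, hj, hij⟩ := (Set.one_lt_ncard (Set.toFinite _)).1 (hX x hx)
  obtain ⟨k, -, l, -, hkl, hk, hl⟩ :=
    hf x ⟨i, Finset.mem_univ _, j, Finset.mem_univ _, hij, hi, hj⟩
  by_cases h : f k = v
  · exact ⟨k, h, hk⟩
  · refine ⟨l, ?_, hl⟩
    revert h hkl
    cases f k <;> cases f l <;> cases v <;> simp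
end

section
/- Dualization. Let k ≥ 2 and m ≥ 1. Suppose that every finite set S ⊆ ℝ³ admits a coloring c : S → Fin k such that for every a ∈ ℝ³, if |S ∩ O(a)| ≥ m then c takes all k values on S ∩ O(a). Then any m-fold covering of any subset of ℝ³ with a finite number of translates of the octant can be decomposed into k coverings: for every finite index set I, a : I → ℝ³, and X ⊆ ℝ³, if every point of X belongs to O(a i) for at least m indices i, then there exists f : I → Fin k such that for every color j and every x ∈ X there is an index i with f i = j and x ∈ O(a i). -/
/-- Dualization: if every finite point set of `ℝ³` has a `k`-coloring in which
every octant with at least `m` of the points contains all `k` colors, then every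
`m`-fold covering of any subset of `ℝ³` by finitely many translates of the octant
decomposes into `k` coverings. -/
theorem dualization (k m : ℕ) (hk : 2 ≤ k) (hm : 1 ≤ m)
    (hcol : ∀ S : Set (Fin 3 → ℝ), S.Finite →
      ∃ c : S → Fin k, ∀ a : Fin 3 → ℝ,
        m ≤ (S ∩ Octant a).ncard →
        ∀ j : Fin k, ∃ x : S, (x : Fin 3 → ℝ) ∈ Octant a ∧ c x = j) :
    ∀ (I : Type) [Fintype I], ∀ (a : I → (Fin 3 → ℝ)) (X : Set (Fin 3 → ℝ)),
      (∀ x ∈ X, m ≤ {i : I | x ∈ Octant (a i)}.ncard) →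
      ∃ f : I → Fin k, ∀ j : Fin k, ∀ x ∈ X, ∃ i : I,
        f i = j ∧ x ∈ Octant (a i) := by
  classical
  intro I _ a X hX
  let e : I ≃ Fin (Fintype.card I) := Fintype.equivFin I
  let L : I → I → Prop := fun j i => a j 0 < a i 0 ∨ (a j 0 = a i 0 ∧ e j < e i)
  let r : I → ℕ := fun i => (Finset.univ.filter (fun j => L j i)).card
  have hmono : ∀ i j, L i j → r i < r j := by
    intro i j hij
    apply Finset.card_lt_card
    rw [Finset.ssubset_iff_of_subset]
    · refine ⟨i, by simpa using hij, ?_⟩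
      simp [L]
    · intro l hl
      simp only [Finset.mem_filter, Finset.mem_univ, true_and, L] at hl hij ⊢
      rcases hl with h | ⟨h, h'⟩ <;> rcases hij with g | ⟨g, g'⟩
      · exact Or.inl (h.trans g)
      · exact Or.inl (g ▸ h)
      · exact Or.inl (h ▸ g)
      · exact Or.inr ⟨h.trans g, h'.trans g'⟩
  have hinj : Function.Injective r := by
    intro i j hij
    by_contra hne
    have hne' : e i ≠ e j := fun h => hne (e.injective h)
    have : L i j ∨ L j i := by
      rcases lt_trichotomy (a i 0) (a j 0) with h | h | h
      · exact Or.inl (Or.inl h)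
      · rcases lt_or_gt_of_ne hne' with g | g
        · exact Or.inl (Or.inr ⟨h, g⟩)
        · exact Or.inr (Or.inr ⟨h.symm, g⟩)
      · exact Or.inr (Or.inl h)
    rcases this with h | h
    · exact absurd (hmono _ _ h) (by omega)
    · exact absurd (hmono _ _ h) (by omega)
  let b : I → (Fin 3 → ℝ) := fun i => ![-(r i : ℝ), -(a i 1), -(a i 2)]
  have hb : Function.Injective b := by
    intro i j hij
    have h0 := congrFun hij 0
    simp only [b, Matrix.cons_val_zero, neg_inj, Nat.cast_inj] at h0
    exact hinj h0
  let q : (Fin 3 → ℝ) → ℕ := fun x => (Finset.univ.filter (fun j => a j 0 < x 0)).card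
  have hq : ∀ x i, q x ≤ r i ↔ x 0 ≤ a i 0 := by
    intro x i
    constructor
    · intro h
      by_contra hlt
      push Not at hlt
      have : r i < q x := by
        apply Finset.card_lt_card
        rw [Finset.ssubset_iff_of_subset]
        · exact ⟨i, by simpa using hlt, by simp [L]⟩
        · intro l hl
          simp only [Finset.mem_filter, Finset.mem_univ, true_and, L] at hl ⊢
          rcases hl with h | ⟨h, _⟩
          · exact h.trans hlt
          · exact h ▸ hlt
      omega
    · intro h
      apply Finset.card_le_card
      intro l hl
      simp only [Finset.mem_filter, Finset.mem_univ, true_and, L] at hl ⊢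
      exact Or.inl (hl.trans_le h)
  let y : (Fin 3 → ℝ) → (Fin 3 → ℝ) := fun x => ![-(q x : ℝ), -(x 1), -(x 2)]
  have hy : ∀ x i, b i ∈ Octant (y x) ↔ x ∈ Octant (a i) := by
    intro x i
    simp [Octant, b, y, hq]
  obtain ⟨c, hc⟩ := hcol (Set.range b) (Set.finite_range b)
  refine ⟨fun i => c ⟨b i, i, rfl⟩, ?_⟩
  intro j x hx
  have hS : Set.range b ∩ Octant (y x) = b '' {i : I | x ∈ Octant (a i)} := by
    ext z
    constructor
    · rintro ⟨⟨i, rfl⟩, h⟩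
      exact ⟨i, (hy x i).1 h, rfl⟩
    · rintro ⟨i, h, rfl⟩
      exact ⟨⟨i, rfl⟩, (hy x i).2 h⟩
  obtain ⟨⟨_, i, rfl⟩, h1, h2⟩ := hc (y x)
    (by rw [hS, Set.ncard_image_of_injective _ hb]; exact hX x hx) j
  exact ⟨i, h2, (hy x i).1 h1⟩
end

section
/- Planar ordered form of the main theorem. Let k ≥ 2 and let p₁, …, pₙ ∈ ℝ² be a sequence of points whose first coordinates are pairwise distinct and whose second coordinates are pairwise distinct. Then there exists a coloring c : Fin n → Fin k such that for every t ∈ {1, …, n} and every b ∈ ℝ², if the index set Q = {i ≤ t : (pᵢ)₁ ≤ b₁ ∧ (pᵢ)₂ ≤ b₂} has at least 12^(2^(k-1)+2^(k-2)-2) elements, then c takes all k values on Q. -/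
namespace PO

def Dm (px py : ℕ → ℝ) (i j : ℕ) : Prop := px i ≤ px j ∧ py i ≤ py j

open Classical in
noncomputable def Wd (px py : ℕ → ℝ) (I : Finset ℕ) (t : ℕ) (a b : ℝ) : Finset ℕ :=
  I.filter (fun i => i < t ∧ px i ≤ a ∧ py i ≤ b)

lemma mem_Wd {px py : ℕ → ℝ} {I : Finset ℕ} {t : ℕ} {a b : ℝ} {i : ℕ} :
    i ∈ Wd px py I t a b ↔ i ∈ I ∧ i < t ∧ px i ≤ a ∧ py i ≤ b := by
  simp [Wd]

def Good (px py : ℕ → ℝ) (I : Finset ℕ) (A : Set (ℕ → Bool)) (t : ℕ) (a b : ℝ) : Prop :=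
  ∀ c ∈ A, ∃ i ∈ Wd px py I t a b, ∃ j ∈ Wd px py I t a b, c i ≠ c j

lemma Good.mono {px py : ℕ → ℝ} {I : Finset ℕ} {A A' : Set (ℕ → Bool)} {t t' : ℕ}
    {a b a' b' : ℝ} (h : Good px py I A t a b) (hA : A' ⊆ A) (ht : t ≤ t') (ha : a ≤ a')
    (hb : b ≤ b') : Good px py I A' t' a' b' := by
  intro c hc
  obtain ⟨i, hi, j, hj, hij⟩ := h c (hA hc)
  rw [mem_Wd] at hi hj
  refine ⟨i, mem_Wd.2 ⟨hi.1, by omega, hi.2.2.1.trans ha, hi.2.2.2.trans hb⟩,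
    j, mem_Wd.2 ⟨hj.1, by omega, hj.2.2.1.trans ha, hj.2.2.2.trans hb⟩, hij⟩

open Classical in
structure Inv (px py : ℕ → ℝ) (I : Finset ℕ) (t : ℕ) (A : Set (ℕ → Bool))
    (L S : Finset ℕ) : Prop where
  ind : ∀ a : ℕ → Bool, ∃ c ∈ A, ∀ i, (i ∈ L ∨ t ≤ i) → c i = a i
  Lsub : ∀ i ∈ L, i ∈ I ∧ i < t
  Ssub : ∀ i ∈ S, i ∈ I ∧ i < t
  i3 : ∀ i ∈ L, ∀ j ∈ L, Dm px py i j → i = j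
  i4 : ∀ i ∈ I, i < t → i ∈ L ∨ i ∈ S ∨ Good px py I A t (px i) (py i)
  i5 : ∀ i ∈ L, ∀ s ∈ S, ¬ Dm px py s i
  i6 : ∀ a b : ℝ, 3 ≤ (S ∩ Wd px py I t a b).card → Good px py I A t a b
  hist : ∀ s < t, ∀ a b : ℝ, 12 ≤ (Wd px py I s a b).card → Good px py I A s a b

def Sat (px py : ℕ → ℝ) (L S : Finset ℕ) : Prop :=
  ∀ T ⊆ L, 4 ≤ T.card → ∃ s ∈ S, ∃ i ∈ T, ∃ j ∈ T, px s ≤ px i ∧ py s ≤ py j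

lemma four_of_card (f : ℕ → ℝ) (T : Finset ℕ) (h : 4 ≤ T.card) :
    ∃ v1 ∈ T, ∃ v2 ∈ T, ∃ v3 ∈ T, ∃ v4 ∈ T, v1 ≠ v2 ∧ v1 ≠ v3 ∧ v1 ≠ v4 ∧ v2 ≠ v3 ∧ v2 ≠ v4 ∧
      v3 ≠ v4 ∧ f v1 ≤ f v2 ∧ f v2 ≤ f v3 ∧ f v3 ≤ f v4 := by
  obtain ⟨v1, h1, m1⟩ := Finset.exists_min_image T f (Finset.card_pos.1 (by omega))
  have c1 := Finset.card_erase_of_mem h1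
  obtain ⟨v2, h2, m2⟩ := Finset.exists_min_image (T.erase v1) f (Finset.card_pos.1 (by omega))
  have c2 := Finset.card_erase_of_mem h2
  obtain ⟨v3, h3, m3⟩ := Finset.exists_min_image ((T.erase v1).erase v2) f
    (Finset.card_pos.1 (by omega))
  have c3 := Finset.card_erase_of_mem h3
  obtain ⟨v4, h4⟩ := Finset.card_pos.1
    (show 0 < (((T.erase v1).erase v2).erase v3).card by omega)
  have m3' := m3 v4 (Finset.mem_of_mem_erase h4)
  have m2' := m2 v3 (Finset.mem_of_mem_erase h3)
  have m1' := m1 v2 (Finset.mem_of_mem_erase h2)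
  simp only [Finset.mem_erase] at h2 h3 h4
  exact ⟨v1, h1, v2, h2.2, v3, h3.2.2, v4, h4.2.2.2, by grind⟩

lemma saturate_step {px py : ℕ → ℝ} {I : Finset ℕ} {t : ℕ} {A : Set (ℕ → Bool)}
    {L S : Finset ℕ} (h : Inv px py I t A L S) (hs : ¬ Sat px py L S) :
    ∃ A' L' S', Inv px py I t A' L' S' ∧ L'.card < L.card := by
  classical
  unfold Sat at hs
  push Not at hs
  obtain ⟨T, hTL, hT, hno⟩ := hs
  obtain ⟨v1, h1, v2, h2, v3, h3, v4, h4, n12, n13, n14, n23, n24, n34, l12, l23, l34⟩ :=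
    four_of_card px T hT
  have y12 : py v2 < py v1 := by
    by_contra hh
    exact n12 (h.i3 v1 (hTL h1) v2 (hTL h2) ⟨l12, not_lt.1 hh⟩)
  have y23 : py v3 < py v2 := by
    by_contra hh
    exact n23 (h.i3 v2 (hTL h2) v3 (hTL h3) ⟨l23, not_lt.1 hh⟩)
  have y34 : py v4 < py v3 := by
    by_contra hh
    exact n34 (h.i3 v3 (hTL h3) v4 (hTL h4) ⟨l34, not_lt.1 hh⟩)
  have hAA : {c ∈ A | c v1 ≠ c v2 ∧ c v3 ≠ c v4} ⊆ A := fun c hc => hc.1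
  have W1 := h.Lsub v1 (hTL h1)
  have W2 := h.Lsub v2 (hTL h2)
  have W3 := h.Lsub v3 (hTL h3)
  have W4 := h.Lsub v4 (hTL h4)
  refine ⟨{c ∈ A | c v1 ≠ c v2 ∧ c v3 ≠ c v4}, (L.erase v2).erase v3, insert v2 (insert v3 S),
    ⟨?_, ?_, ?_, ?_, ?_, ?_, ?_, ?_⟩, ?_⟩
  · intro a
    obtain ⟨c, hc, hca⟩ := h.ind (fun i => if i = v2 then !(a v1) else if i = v3 then !(a v4)
      else a i)
    have e1 := hca v1 (Or.inl (hTL h1))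
    have e2 := hca v2 (Or.inl (hTL h2))
    have e3 := hca v3 (Or.inl (hTL h3))
    have e4 := hca v4 (Or.inl (hTL h4))
    simp [n12, n13, n24.symm, n34.symm, n23.symm] at e1 e2 e3 e4
    refine ⟨c, ⟨hc, by simp [e1, e2], by simp [e3, e4]⟩, ?_⟩
    intro i hi
    have ei := hca i (by grind)
    have : i ≠ v2 := by grind
    have : i ≠ v3 := by grind
    simp_all
  · intro i hi
    exact h.Lsub i (by grind)
  · intro i hi
    have := h.Ssub i
    grind
  · intro i hi j hj
    exact h.i3 i (by grind) j (by grind)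
  · intro i hi hit
    rcases h.i4 i hi hit with hh | hh | hh
    · grind
    · grind
    · exact Or.inr (Or.inr (hh.mono hAA le_rfl le_rfl le_rfl))
  · intro i hi s hs hd
    have hiL : i ∈ L := by grind
    simp only [Finset.mem_insert] at hs
    rcases hs with rfl | rfl | hs
    · have := h.i3 s (hTL h2) i hiL hd
      grind
    · have := h.i3 s (hTL h3) i hiL hd
      grind
    · exact h.i5 i hiL s hs hd
  · intro a b hab
    by_cases h3' : 3 ≤ (S ∩ Wd px py I t a b).card
    · exact (h.i6 a b h3').mono hAA le_rfl le_rfl le_rfl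
    have hex : ∃ l ∈ S, l ∈ Wd px py I t a b := by
      by_contra hcon
      push Not at hcon
      have : insert v2 (insert v3 S) ∩ Wd px py I t a b ⊆ {v2, v3} := by
        intro x hx
        have := hcon x
        grind
      have := (Finset.card_le_card this).trans Finset.card_le_two
      omega
    obtain ⟨l, hl, hlW⟩ := hex
    have hv : v2 ∈ Wd px py I t a b ∨ v3 ∈ Wd px py I t a b := by
      by_contra hcon
      push Not at hcon
      apply h3'
      refine hab.trans (Finset.card_le_card ?_)
      intro x hx
      grind
    have hlno := hno l hl v4 h4 v1 h1
    rw [mem_Wd] at hlW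
    simp only [mem_Wd] at hv
    intro c hc
    by_cases hx : px l ≤ px v4
    · have hy := hlno hx
      refine ⟨v1, mem_Wd.2 ⟨W1.1, W1.2, ?_, ?_⟩, v2, mem_Wd.2 ⟨W2.1, W2.2, ?_, ?_⟩, hc.2.1⟩
      all_goals rcases hv with hv | hv <;> linarith [hv.2.2.1, hv.2.2.2, hlW.2.2.1, hlW.2.2.2]
    · push Not at hx
      refine ⟨v3, mem_Wd.2 ⟨W3.1, W3.2, ?_, ?_⟩, v4, mem_Wd.2 ⟨W4.1, W4.2, ?_, ?_⟩, hc.2.2⟩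
      all_goals rcases hv with hv | hv <;> linarith [hv.2.2.1, hv.2.2.2, hlW.2.2.1, hlW.2.2.2]
  · intro s hs a b hab
    exact (h.hist s hs a b hab).mono hAA le_rfl le_rfl le_rfl
  · apply Finset.card_lt_card
    refine ⟨by intro x; grind, fun hh => ?_⟩
    have := hh (hTL h2)
    grind

lemma saturate {px py : ℕ → ℝ} {I : Finset ℕ} {t : ℕ} : ∀ (N : ℕ) {A : Set (ℕ → Bool)}
    {L S : Finset ℕ}, L.card ≤ N → Inv px py I t A L S →
    ∃ A' L' S', Inv px py I t A' L' S' ∧ Sat px py L' S' := by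
  intro N
  induction N with
  | zero =>
    intro A L S hN h
    by_cases hs : Sat px py L S
    · exact ⟨A, L, S, h, hs⟩
    · obtain ⟨A', L', S', h', hlt⟩ := saturate_step h hs
      omega
  | succ N ih =>
    intro A L S hN h
    by_cases hs : Sat px py L S
    · exact ⟨A, L, S, h, hs⟩
    · obtain ⟨A', L', S', h', hlt⟩ := saturate_step h hs
      exact ih (by omega) h'

lemma count {px py : ℕ → ℝ} {I : Finset ℕ} {t : ℕ} {A : Set (ℕ → Bool)}
    {L S : Finset ℕ} (h : Inv px py I t A L S) (hs : Sat px py L S) (a b : ℝ)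
    (hc : 12 ≤ (Wd px py I t a b).card) : Good px py I A t a b := by
  classical
  by_contra hG
  have hS2 : (S ∩ Wd px py I t a b).card ≤ 2 := by
    by_contra hcon
    exact hG (h.i6 a b (by omega))
  have hLS : ∀ i ∈ Wd px py I t a b, i ∈ L ∨ i ∈ S := by
    intro i hi
    rw [mem_Wd] at hi
    rcases h.i4 i hi.1 hi.2.1 with hh | hh | hh
    · exact Or.inl hh
    · exact Or.inr hh
    · exact absurd (hh.mono le_rfl le_rfl hi.2.2.1 hi.2.2.2) hG
  have key : ∀ T ⊆ L ∩ Wd px py I t a b,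
      (∀ s ∈ S ∩ Wd px py I t a b, ∀ i ∈ T, ∀ j ∈ T, px s ≤ px i → py s ≤ py j → False) →
      T.card ≤ 3 := by
    intro T hT hno
    by_contra hcon
    obtain ⟨s, hsS, i, hi, j, hj, hxi, hyj⟩ := hs T (fun x hx => by have := hT hx; grind)
      (by omega)
    have hiW := hT hi
    have hjW := hT hj
    have hsI := h.Ssub s hsS
    simp only [Finset.mem_inter, mem_Wd] at hiW hjW
    refine hno s (Finset.mem_inter.2 ⟨hsS, mem_Wd.2 ⟨hsI.1, hsI.2, ?_, ?_⟩⟩) i hi j hj hxi hyj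
    · linarith [hiW.2.2.2.1]
    · linarith [hjW.2.2.2.2]
  have hL9 : (L ∩ Wd px py I t a b).card ≤ 9 := by
    rcases (S ∩ Wd px py I t a b).eq_empty_or_nonempty with he | hne
    · have := key _ subset_rfl (by intro s hs'; simp [he] at hs')
      omega
    · obtain ⟨s, hsm, hmin⟩ := Finset.exists_min_image _ px hne
      obtain ⟨s', hsm', hall⟩ : ∃ s' ∈ S ∩ Wd px py I t a b,
          ∀ x ∈ S ∩ Wd px py I t a b, x = s ∨ x = s' := by
        have hcard := Finset.card_erase_of_mem hsm
        rcases ((S ∩ Wd px py I t a b).erase s).eq_empty_or_nonempty with he | ⟨s', hs'⟩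
        · refine ⟨s, hsm, fun x hx => ?_⟩
          by_contra hcon
          have : x ∈ (S ∩ Wd px py I t a b).erase s := Finset.mem_erase.2 ⟨by tauto, hx⟩
          simp [he] at this
        · refine ⟨s', Finset.mem_of_mem_erase hs', fun x hx => ?_⟩
          by_cases hxs : x = s
          · exact Or.inl hxs
          · exact Or.inr (Finset.card_le_one.1 (by omega) x (Finset.mem_erase.2 ⟨hxs, hx⟩) s' hs')
      have hss := hmin s' hsm'
      have i5s : ∀ i ∈ L, px s ≤ px i → py i < py s := by
        intro i hi hx
        by_contra hcon
        exact h.i5 i hi s (Finset.mem_inter.1 hsm).1 ⟨hx, not_lt.1 hcon⟩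
      have i5s' : ∀ i ∈ L, px s' ≤ px i → py i < py s' := by
        intro i hi hx
        by_contra hcon
        exact h.i5 i hi s' (Finset.mem_inter.1 hsm').1 ⟨hx, not_lt.1 hcon⟩
      set M := L ∩ Wd px py I t a b with hM
      have hML : ∀ i ∈ M, i ∈ L := fun i hi => (Finset.mem_inter.1 hi).1
      have t1 := key (M.filter (fun i => px i < px s)) (Finset.filter_subset _ _) (by
        intro x hx i hi j hj hxi hyj
        have := (Finset.mem_filter.1 hi).2
        have := hmin x hx
        linarith)
      have t2 := key (M.filter (fun i => py i < py s ∧ py i < py s')) (Finset.filter_subset _ _) (by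
        intro x hx i hi j hj hxi hyj
        have := (Finset.mem_filter.1 hj).2
        rcases hall x hx with rfl | rfl <;> linarith [this.1, this.2])
      have t3 := key (M.filter (fun i => ¬ px i < px s ∧ ¬ (py i < py s ∧ py i < py s')))
        (Finset.filter_subset _ _) (by
        have aux : ∀ i ∈ M.filter (fun i => ¬ px i < px s ∧ ¬ (py i < py s ∧ py i < py s')),
            py i < py s ∧ px i < px s' := by
          intro i hi
          obtain ⟨hiM, hi1, hi2⟩ := Finset.mem_filter.1 hi
          have := i5s i (hML i hiM) (not_lt.1 hi1)
          refine ⟨this, ?_⟩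
          by_contra hcon
          exact hi2 ⟨this, i5s' i (hML i hiM) (not_lt.1 hcon)⟩
        intro x hx i hi j hj hxi hyj
        have := aux i hi
        have := aux j hj
        rcases hall x hx with rfl | rfl <;> linarith [(aux i hi).2, (aux j hj).1])
      have hsub : M ⊆ (M.filter (fun i => px i < px s)) ∪
        ((M.filter (fun i => py i < py s ∧ py i < py s')) ∪
        (M.filter (fun i => ¬ px i < px s ∧ ¬ (py i < py s ∧ py i < py s')))) := by
        intro i hi
        simp only [Finset.mem_union, Finset.mem_filter, hi, true_and]
        tauto
      have c1 := Finset.card_le_card hsub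
      have c2 := Finset.card_union_le (M.filter (fun i => px i < px s))
        ((M.filter (fun i => py i < py s ∧ py i < py s')) ∪
        (M.filter (fun i => ¬ px i < px s ∧ ¬ (py i < py s ∧ py i < py s'))))
      have c3 := Finset.card_union_le (M.filter (fun i => py i < py s ∧ py i < py s'))
        (M.filter (fun i => ¬ px i < px s ∧ ¬ (py i < py s ∧ py i < py s')))
      omega
  have hsub : Wd px py I t a b ⊆ (L ∩ Wd px py I t a b) ∪ (S ∩ Wd px py I t a b) := by
    intro i hi
    have := hLS i hi
    simp only [Finset.mem_union, Finset.mem_inter, hi, and_true]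
    exact this
  have c1 := Finset.card_le_card hsub
  have c2 := Finset.card_union_le (L ∩ Wd px py I t a b) (S ∩ Wd px py I t a b)
  omega

lemma Wd_succ_of_notMem {px py : ℕ → ℝ} {I : Finset ℕ} {t : ℕ} (ht : t ∉ I) (a b : ℝ) :
    Wd px py I (t + 1) a b = Wd px py I t a b := by
  ext i
  rw [mem_Wd, mem_Wd]
  have : i ∈ I → i ≠ t := by rintro h rfl; exact ht h
  constructor
  · rintro ⟨h1, h2, h3⟩
    exact ⟨h1, by have := this h1; omega, h3⟩
  · rintro ⟨h1, h2, h3⟩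
    exact ⟨h1, by omega, h3⟩

lemma step {px py : ℕ → ℝ} {I : Finset ℕ} (hI : ∀ i ∈ I, ∀ j ∈ I, i < j → ¬ Dm px py i j)
    {t : ℕ} {A : Set (ℕ → Bool)}
    {L S : Finset ℕ} (h : Inv px py I t A L S) (hs : Sat px py L S) :
    ∃ A' L' S', Inv px py I (t + 1) A' L' S' := by
  classical
  have hh : ∀ s < t + 1, ∀ a b : ℝ, 12 ≤ (Wd px py I s a b).card → Good px py I A s a b := by
    intro s hst a b hc
    rcases Nat.lt_succ_iff_lt_or_eq.1 hst with hlt | rfl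
    · exact h.hist s hlt a b hc
    · exact count h hs a b hc
  by_cases htI : t ∈ I
  swap
  · refine ⟨A, L, S, ⟨?_, ?_, ?_, h.i3, ?_, h.i5, ?_, hh⟩⟩
    · intro a
      obtain ⟨c, hc, hca⟩ := h.ind a
      exact ⟨c, hc, fun i hi => hca i (by rcases hi with hi | hi; exact Or.inl hi; right; omega)⟩
    · intro i hi
      have := h.Lsub i hi
      exact ⟨this.1, by omega⟩
    · intro i hi
      have := h.Ssub i hi
      exact ⟨this.1, by omega⟩
    · intro i hi hit
      have hne : i ≠ t := by rintro rfl; exact htI hi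
      rcases h.i4 i hi (by omega) with h1 | h1 | h1
      · exact Or.inl h1
      · exact Or.inr (Or.inl h1)
      · exact Or.inr (Or.inr (h1.mono le_rfl (by omega) le_rfl le_rfl))
    · intro a b hab
      rw [Wd_succ_of_notMem htI] at hab
      exact (h.i6 a b hab).mono le_rfl (by omega) le_rfl le_rfl
  · have htL : t ∉ L := fun hl => by have := (h.Lsub t hl).2; omega
    have hAA : {c ∈ A | ∀ p ∈ L, Dm px py t p → c p ≠ c t} ⊆ A := fun c hc => hc.1
    refine ⟨{c ∈ A | ∀ p ∈ L, Dm px py t p → c p ≠ c t},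
      insert t (L.filter (fun p => ¬ Dm px py t p)), S, ⟨?_, ?_, ?_, ?_, ?_, ?_, ?_, ?_⟩⟩
    · intro a
      obtain ⟨c, hc, hca⟩ := h.ind (fun i => if i ∈ L ∧ Dm px py t i then !(a t) else a i)
      have et : c t = a t := by
        have := hca t (Or.inr le_rfl)
        simpa [htL] using this
      refine ⟨c, ⟨hc, ?_⟩, ?_⟩
      · intro p hp hd
        have := hca p (Or.inl hp)
        simp [hp, hd] at this
        simp [this, et]
      · intro i hi
        simp only [Finset.mem_insert, Finset.mem_filter] at hi
        rcases hi with (rfl | hi) | hi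
        · exact et
        · have := hca i (Or.inl hi.1)
          simpa [hi.2] using this
        · have := hca i (Or.inr (by omega))
          have hiL : i ∉ L := fun hl => by have := (h.Lsub i hl).2; omega
          simpa [hiL] using this
    · intro i hi
      simp only [Finset.mem_insert, Finset.mem_filter] at hi
      rcases hi with rfl | hi
      · exact ⟨htI, by omega⟩
      · have := h.Lsub i hi.1
        exact ⟨this.1, by omega⟩
    · intro i hi
      have := h.Ssub i hi
      exact ⟨this.1, by omega⟩
    · intro i hi j hj hd
      simp only [Finset.mem_insert, Finset.mem_filter] at hi hj
      rcases hi with rfl | hi <;> rcases hj with rfl | hj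
      · rfl
      · exact absurd hd hj.2
      · have := h.Lsub i hi.1
        exact absurd hd (hI i this.1 j htI this.2)
      · exact h.i3 i hi.1 j hj.1 hd
    · intro i hi hit
      by_cases hne : i = t
      · left; simp [hne]
      rcases h.i4 i hi (by omega) with h1 | h1 | h1
      · by_cases hd : Dm px py t i
        · right; right
          intro c hc
          exact ⟨i, mem_Wd.2 ⟨hi, hit, le_rfl, le_rfl⟩, t, mem_Wd.2 ⟨htI, by omega, hd.1, hd.2⟩,
            hc.2 i h1 hd⟩
        · left; simp [h1, hd]
      · exact Or.inr (Or.inl h1)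
      · exact Or.inr (Or.inr (h1.mono hAA (by omega) le_rfl le_rfl))
    · intro i hi s hs' hd
      simp only [Finset.mem_insert, Finset.mem_filter] at hi
      rcases hi with rfl | hi
      · have := h.Ssub s hs'
        exact hI s this.1 i htI this.2 hd
      · exact h.i5 i hi.1 s hs' hd
    · intro a b hab
      have : S ∩ Wd px py I (t + 1) a b ⊆ S ∩ Wd px py I t a b := by
        intro x hx
        simp only [Finset.mem_inter, mem_Wd] at hx ⊢
        have := h.Ssub x hx.1
        tauto
      exact (h.i6 a b (hab.trans (Finset.card_le_card this))).mono hAA (by omega) le_rfl le_rfl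
    · intro s hst a b hc
      exact (hh s hst a b hc).mono hAA le_rfl le_rfl le_rfl

lemma exists_inv {px py : ℕ → ℝ} {I : Finset ℕ}
    (hI : ∀ i ∈ I, ∀ j ∈ I, i < j → ¬ Dm px py i j) (t : ℕ) :
    ∃ A L S, Inv px py I t A L S := by
  induction t with
  | zero =>
    refine ⟨Set.univ, ∅, ∅, ⟨fun a => ⟨a, trivial, fun _ _ => rfl⟩, ?_, ?_, ?_, ?_, ?_, ?_, ?_⟩⟩ <;>
      simp
  | succ t ih =>
    obtain ⟨A, L, S, h⟩ := ih
    obtain ⟨A', L', S', h', hs⟩ := saturate _ le_rfl h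
    exact step hI h' hs

lemma two_color {px py : ℕ → ℝ} {I : Finset ℕ}
    (hI : ∀ i ∈ I, ∀ j ∈ I, i < j → ¬ Dm px py i j) :
    ∃ c : ℕ → Bool, ∀ t a b, 12 ≤ (Wd px py I t a b).card →
      ∃ i ∈ Wd px py I t a b, ∃ j ∈ Wd px py I t a b, c i ≠ c j := by
  obtain ⟨A, L, S, h⟩ := exists_inv hI (I.sup id + 2)
  obtain ⟨c, hc, -⟩ := h.ind (fun _ => true)
  refine ⟨c, fun t a b hcard => ?_⟩
  have hW : Wd px py I t a b = Wd px py I (min t (I.sup id + 1)) a b := by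
    ext i
    simp only [mem_Wd]
    have : i ∈ I → i ≤ I.sup id := fun hi => Finset.le_sup (f := id) hi
    constructor
    · rintro ⟨h1, h2, h3⟩
      exact ⟨h1, by have := this h1; omega, h3⟩
    · rintro ⟨h1, h2, h3⟩
      exact ⟨h1, by omega, h3⟩
  rw [hW] at hcard ⊢
  exact h.hist _ (by omega) a b hcard c hc

def AC (px py : ℕ → ℝ) (I : Finset ℕ) : Prop := ∀ i ∈ I, ∀ j ∈ I, i < j → ¬ Dm px py i j

def Col (px py : ℕ → ℝ) (I : Finset ℕ) (k m : ℕ) : Prop :=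
  ∃ c : ℕ → Fin k, ∀ t a b, m ≤ (Wd px py I t a b).card →
    ∀ col, ∃ i ∈ Wd px py I t a b, c i = col

def PA (px py : ℕ → ℝ) (k m : ℕ) : Prop := ∀ I, Col px py I k m

def AP (px py : ℕ → ℝ) (k m : ℕ) : Prop := ∀ I, AC px py I → Col px py I k m

lemma AP.mono {px py : ℕ → ℝ} {k m m' : ℕ} (h : AP px py k m) (hm : m ≤ m') :
    AP px py k m' := by
  intro I hI
  obtain ⟨c, hc⟩ := h I hI
  exact ⟨c, fun t a b hcard => hc t a b (hm.trans hcard)⟩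

lemma PA_one (px py : ℕ → ℝ) : PA px py 1 1 := by
  intro I
  refine ⟨fun _ => 0, fun t a b hcard col => ?_⟩
  obtain ⟨i, hi⟩ := Finset.card_pos.1 (show 0 < _ from hcard)
  exact ⟨i, hi, Subsingleton.elim _ _⟩

lemma AP_one (px py : ℕ → ℝ) : AP px py 1 1 := fun I _ => PA_one px py I

lemma AP_two (px py : ℕ → ℝ) : AP px py 2 12 := by
  intro I hI
  obtain ⟨c, hc⟩ := two_color hI
  refine ⟨fun i => if c i then 1 else 0, fun t a b hcard col => ?_⟩
  obtain ⟨i, hi, j, hj, hij⟩ := hc t a b hcard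
  fin_cases col
  · cases h1 : c i
    · exact ⟨i, hi, by simp [h1]⟩
    · refine ⟨j, hj, ?_⟩
      have : c j = false := by cases h2 : c j <;> simp_all
      simp [this]
  · cases h1 : c i
    · refine ⟨j, hj, ?_⟩
      have : c j = true := by cases h2 : c j <;> simp_all
      simp [this]
    · exact ⟨i, hi, by simp [h1]⟩

lemma class_large {px py : ℕ → ℝ} {I : Finset ℕ} (hI : AC px py I) {c : ℕ → Bool}
    (hc : ∀ t a b, 12 ≤ (Wd px py I t a b).card →
      ∃ i ∈ Wd px py I t a b, ∃ j ∈ Wd px py I t a b, c i ≠ c j)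
    {m : ℕ} (hm : 1 ≤ m) {t : ℕ} {a b : ℝ} (hcard : 12 * (m * m) ≤ (Wd px py I t a b).card)
    (β : Bool) : m ≤ (Wd px py (I.filter (fun i => c i = β)) t a b).card := by
  classical
  by_contra hlt
  push Not at hlt
  set B := Wd px py (I.filter (fun i => c i = β)) t a b with hB
  set W := Wd px py I t a b with hW
  have hBW : B = W.filter (fun i => c i = β) := by
    ext i
    simp only [hB, hW, mem_Wd, Finset.mem_filter]
    tauto
  set R := W.filter (fun i => ¬ c i = β) with hR
  have hsum := Finset.card_filter_add_card_filter_not (s := W) (fun i => c i = β)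
  rw [← hBW, ← hR] at hsum
  let key : ℕ → ℕ × ℕ := fun i =>
    ((B.filter (fun x => px x ≤ px i)).card, (B.filter (fun x => py x ≤ py i)).card)
  have hmaps : ∀ i ∈ R, key i ∈ Finset.range m ×ˢ Finset.range m := by
    intro i _
    simp only [key, Finset.mem_product, Finset.mem_range]
    exact ⟨(Finset.card_filter_le _ _).trans_lt hlt, (Finset.card_filter_le _ _).trans_lt hlt⟩
  have hmm : m ≤ m * m := Nat.le_mul_self m
  obtain ⟨y, -, hy⟩ := Finset.exists_lt_card_fiber_of_mul_lt_card_of_maps_to hmaps (n := 11)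
    (by rw [Finset.card_product, Finset.card_range]; omega)
  set T := R.filter (fun i => key i = y) with hT
  have hTne : T.Nonempty := Finset.card_pos.1 (by omega)
  obtain ⟨ix, hix, mx⟩ := Finset.exists_max_image T px hTne
  obtain ⟨iy, hiy, my⟩ := Finset.exists_max_image T py hTne
  obtain ⟨it, hit, mt⟩ := Finset.exists_max_image T id hTne
  have hTR : ∀ i ∈ T, i ∈ W ∧ c i ≠ β ∧ key i = y := by
    intro i hi
    simp only [hT, hR, Finset.mem_filter] at hi
    exact ⟨hi.1.1, hi.1.2, hi.2⟩
  have hsub : T ⊆ Wd px py I (it + 1) (px ix) (py iy) := by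
    intro i hi
    have h1 := (hTR i hi).1
    rw [hW, mem_Wd] at h1
    exact mem_Wd.2 ⟨h1.1, Nat.lt_succ_of_le (mt i hi), mx i hi, my i hi⟩
  obtain ⟨i, hi, j, hj, hij⟩ := hc (it + 1) (px ix) (py iy)
    (le_trans (by omega) (Finset.card_le_card hsub))
  obtain ⟨z, hz, hzc⟩ : ∃ z ∈ Wd px py I (it + 1) (px ix) (py iy), c z = β := by
    by_cases h1 : c i = β
    · exact ⟨i, hi, h1⟩
    · refine ⟨j, hj, ?_⟩
      revert h1 hij
      cases c i <;> cases c j <;> cases β <;> simp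
  rw [mem_Wd] at hz
  have hWit := (hTR it hit).1
  have hWix := (hTR ix hix).1
  have hWiy := (hTR iy hiy).1
  rw [hW, mem_Wd] at hWit hWix hWiy
  have hzB : z ∈ B := by
    rw [hBW, Finset.mem_filter]
    exact ⟨mem_Wd.2 ⟨hz.1, by omega, hz.2.2.1.trans hWix.2.2.1, hz.2.2.2.trans hWiy.2.2.2⟩, hzc⟩
  have kx : px z ≤ px it := by
    have hle := mx it hit
    have hsub : B.filter (fun x => px x ≤ px it) ⊆ B.filter (fun x => px x ≤ px ix) := by
      intro x hx
      simp only [Finset.mem_filter] at hx ⊢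
      exact ⟨hx.1, hx.2.trans hle⟩
    have e : key ix = key it := (hTR ix hix).2.2.trans (hTR it hit).2.2.symm
    have e1 := congrArg Prod.fst e
    have := Finset.eq_of_subset_of_card_le hsub (le_of_eq e1)
    have hz' : z ∈ B.filter (fun x => px x ≤ px ix) := Finset.mem_filter.2 ⟨hzB, hz.2.2.1⟩
    rw [← this] at hz'
    exact (Finset.mem_filter.1 hz').2
  have ky : py z ≤ py it := by
    have hle := my it hit
    have hsub : B.filter (fun x => py x ≤ py it) ⊆ B.filter (fun x => py x ≤ py iy) := by
      intro x hx
      simp only [Finset.mem_filter] at hx ⊢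
      exact ⟨hx.1, hx.2.trans hle⟩
    have e : key iy = key it := (hTR iy hiy).2.2.trans (hTR it hit).2.2.symm
    have e1 := congrArg Prod.snd e
    have := Finset.eq_of_subset_of_card_le hsub (le_of_eq e1)
    have hz' : z ∈ B.filter (fun x => py x ≤ py iy) := Finset.mem_filter.2 ⟨hzB, hz.2.2.2⟩
    rw [← this] at hz'
    exact (Finset.mem_filter.1 hz').2
  have hne : z ≠ it := by
    rintro rfl
    exact (hTR z hit).2.1 hzc
  exact hI z hz.1 it hWit.1 (by omega) ⟨kx, ky⟩

lemma merge {px py : ℕ → ℝ} {k1 k2 m : ℕ} (h1 : AP px py k1 m) (h2 : AP px py k2 m)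
    (hm : 1 ≤ m) : AP px py (k1 + k2) (12 * (m * m)) := by
  intro I hI
  obtain ⟨c, hc⟩ := two_color hI
  have hac : ∀ β : Bool, AC px py (I.filter (fun i => c i = β)) := fun β i hi j hj =>
    hI i (Finset.mem_filter.1 hi).1 j (Finset.mem_filter.1 hj).1
  obtain ⟨c1, hc1⟩ := h1 _ (hac true)
  obtain ⟨c2, hc2⟩ := h2 _ (hac false)
  have hWW : ∀ β t a b i, i ∈ Wd px py (I.filter (fun i => c i = β)) t a b →
      i ∈ Wd px py I t a b ∧ c i = β := by
    intro β t a b i hi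
    simp only [mem_Wd, Finset.mem_filter] at hi ⊢
    tauto
  refine ⟨fun i => if c i = true then Fin.castAdd k2 (c1 i) else Fin.natAdd k1 (c2 i),
    fun t a b hcard col => ?_⟩
  have l1 := class_large hI hc hm hcard true
  have l2 := class_large hI hc hm hcard false
  refine Fin.addCases (fun x => ?_) (fun x => ?_) col
  · obtain ⟨i, hi, hix⟩ := hc1 t a b l1 x
    have := hWW _ _ _ _ _ hi
    exact ⟨i, this.1, by simp [this.2, hix]⟩
  · obtain ⟨i, hi, hix⟩ := hc2 t a b l2 x
    have := hWW _ _ _ _ _ hi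
    exact ⟨i, this.1, by simp [this.2, hix]⟩

lemma fiber {px py : ℕ → ℝ} {k a M : ℕ} (hA : AP px py (k + 1) a) (hP : PA px py k M)
    (ha : 1 ≤ a) (hM : 1 ≤ M) : PA px py (k + 1) (a * M) := by
  classical
  intro I
  set A0 := I.filter (fun i => ∀ j ∈ I, j < i → ¬ Dm px py j i) with hA0
  have hA0I : ∀ i ∈ A0, i ∈ I := fun i hi => (Finset.mem_filter.1 hi).1
  have hac : AC px py A0 := by
    intro i hi j hj hij
    exact (Finset.mem_filter.1 hj).2 i (hA0I i hi) hij
  obtain ⟨cA, hcA⟩ := hA A0 hac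
  have hg : ∀ i, ∃ v, i ∈ I → v ∈ A0 ∧ v ≤ i ∧ Dm px py v i := by
    intro i
    induction i using Nat.strong_induction_on with
    | _ i ih =>
      by_cases hi0 : i ∈ A0
      · exact ⟨i, fun _ => ⟨hi0, le_rfl, le_rfl, le_rfl⟩⟩
      · by_cases hiI : i ∈ I
        · have : ∃ j ∈ I, j < i ∧ Dm px py j i := by
            by_contra hcon
            push Not at hcon
            exact hi0 (Finset.mem_filter.2 ⟨hiI, hcon⟩)
          obtain ⟨j, hj, hji, hd⟩ := this
          obtain ⟨v, hv⟩ := ih j hji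
          obtain ⟨h1, h2, h3⟩ := hv hj
          exact ⟨v, fun _ => ⟨h1, by omega, h3.1.trans hd.1, h3.2.trans hd.2⟩⟩
        · exact ⟨0, fun h => absurd h hiI⟩
  choose g hg using hg
  choose cP hcP using fun v => hP (I.filter (fun i => i ∉ A0 ∧ g i = v))
  refine ⟨fun i => if i ∈ A0 then cA i else (cA (g i)).succAbove (cP (g i) i),
    fun t x y hcard col => ?_⟩
  by_cases hbig : a ≤ (Wd px py A0 t x y).card
  · obtain ⟨i, hi, hic⟩ := hcA t x y hbig col
    rw [mem_Wd] at hi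
    exact ⟨i, mem_Wd.2 ⟨hA0I i hi.1, hi.2⟩, by simp [hi.1, hic]⟩
  · push Not at hbig
    have hmaps : ∀ i ∈ Wd px py I t x y, g i ∈ Wd px py A0 t x y := by
      intro i hi
      rw [mem_Wd] at hi ⊢
      obtain ⟨h1, h2, h3⟩ := hg i hi.1
      exact ⟨h1, by omega, h3.1.trans hi.2.2.1, h3.2.trans hi.2.2.2⟩
    obtain ⟨v, hv, hvc⟩ := Finset.exists_lt_card_fiber_of_mul_lt_card_of_maps_to hmaps (n := M)
      (lt_of_lt_of_le (Nat.mul_lt_mul_of_pos_right hbig hM) hcard)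
    rw [mem_Wd] at hv
    by_cases hcol : col = cA v
    · exact ⟨v, mem_Wd.2 ⟨hA0I v hv.1, hv.2⟩, by simp [hv.1, hcol]⟩
    · have hsub : ((Wd px py I t x y).filter (fun i => g i = v)).erase v ⊆
          Wd px py (I.filter (fun i => i ∉ A0 ∧ g i = v)) t x y := by
        intro i hi
        simp only [Finset.mem_erase, Finset.mem_filter, mem_Wd] at hi ⊢
        obtain ⟨hne, ⟨hiI, hit⟩, hgi⟩ := hi
        refine ⟨⟨hiI, ?_, hgi⟩, hit⟩
        intro hi0
        obtain ⟨h1, h2, h3⟩ := hg i hiI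
        rw [hgi] at h1 h2 h3
        exact hac v h1 i hi0 (lt_of_le_of_ne h2 (Ne.symm hne)) h3
      have hle := Finset.card_le_card hsub
      have her := Finset.pred_card_le_card_erase
        (s := (Wd px py I t x y).filter (fun i => g i = v)) (a := v)
      obtain ⟨z, hz⟩ := Fin.exists_succAbove_eq hcol
      obtain ⟨i, hi, hic⟩ := hcP v t x y (by omega) z
      simp only [mem_Wd, Finset.mem_filter] at hi
      refine ⟨i, mem_Wd.2 ⟨hi.1.1, hi.2⟩, ?_⟩
      simp only [hi.1.2.1, hi.1.2.2, if_false, hic, hz]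

lemma AP_big (px py : ℕ → ℝ) : ∀ r : ℕ, AP px py (r + 3) (12 ^ (3 * 2 ^ r))
  | 0 => by
    have := merge (AP_two px py) ((AP_one px py).mono (by norm_num)) (by norm_num)
    exact this.mono (by norm_num)
  | 1 => by
    have := merge (AP_two px py) (AP_two px py) (by norm_num)
    exact this.mono (by norm_num)
  | r + 2 => by
    have h1 : 1 ≤ 2 ^ r := Nat.one_le_two_pow
    have := merge (AP_big px py r)
      ((AP_two px py).mono (Nat.le_self_pow (by omega) 12)) (Nat.one_le_pow _ _ (by norm_num))
    refine AP.mono this ?_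
    rw [← pow_add, ← pow_succ']
    apply Nat.pow_le_pow_right (by norm_num)
    rw [pow_add]
    omega

lemma PA_main (px py : ℕ → ℝ) (r : ℕ) : PA px py (r + 2) (12 ^ (3 * 2 ^ r - 2)) := by
  induction r with
  | zero =>
    have := fiber (AP_two px py) (PA_one px py) (by norm_num) (by norm_num)
    simpa using this
  | succ r ih =>
    have h1 : 1 ≤ 2 ^ r := Nat.one_le_two_pow
    have := fiber (AP_big px py r) ih (Nat.one_le_pow _ _ (by norm_num))
      (Nat.one_le_pow _ _ (by norm_num))
    rw [← pow_add] at this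
    have e : 3 * 2 ^ r + (3 * 2 ^ r - 2) = 3 * 2 ^ (r + 1) - 2 := by
      rw [pow_succ]
      omega
    rw [e] at this
    exact this

end PO

/-- Planar ordered form of the main theorem: any sequence of planar points with
pairwise distinct first coordinates and pairwise distinct second coordinates has a
`k`-good coloring with threshold `12^(2^(k-1)+2^(k-2)-2)`: at every time `t`,
every wedge containing at least that many of the first `t` points contains all
`k` colors among them. -/
theorem planar_ordered_main (k n : ℕ) (hk : 2 ≤ k)
    (p : Fin n → (Fin 2 → ℝ))
    (hx : Function.Injective (fun i => p i 0))
    (hy : Function.Injective (fun i => p i 1)) :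
    ∃ c : Fin n → Fin k, ∀ t : Fin n, ∀ b : Fin 2 → ℝ,
      12 ^ (2 ^ (k - 1) + 2 ^ (k - 2) - 2) ≤
        {i : Fin n | i ≤ t ∧ p i 0 ≤ b 0 ∧ p i 1 ≤ b 1}.ncard →
      ∀ j : Fin k, ∃ i : Fin n,
        (i ≤ t ∧ p i 0 ≤ b 0 ∧ p i 1 ≤ b 1) ∧ c i = j := by
  obtain ⟨r, rfl⟩ : ∃ r, k = r + 2 := ⟨k - 2, by omega⟩
  have e : 2 ^ (r + 2 - 1) + 2 ^ (r + 2 - 2) - 2 = 3 * 2 ^ r - 2 := by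
    have h1 : r + 2 - 1 = r + 1 := by omega
    have h2 : r + 2 - 2 = r := by omega
    rw [h1, h2, pow_succ]
    omega
  rw [e]
  obtain ⟨c, hc⟩ := PO.PA_main (fun i => if h : i < n then p ⟨i, h⟩ 0 else 0)
    (fun i => if h : i < n then p ⟨i, h⟩ 1 else 0) r (Finset.range n)
  refine ⟨fun i => c i, fun t b hcard j => ?_⟩
  have key : (12 : ℕ) ^ (3 * 2 ^ r - 2) ≤
      (PO.Wd (fun i => if h : i < n then p ⟨i, h⟩ 0 else 0)
        (fun i => if h : i < n then p ⟨i, h⟩ 1 else 0) (Finset.range n) (t + 1)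
        (b 0) (b 1)).card := by
    refine hcard.trans ?_
    rw [← Set.ncard_coe_finset]
    refine Set.ncard_le_ncard_of_injOn (fun i : Fin n => (i : ℕ)) ?_
      (fun x _ y _ hxy => Fin.ext hxy) (Finset.finite_toSet _)
    intro i hi
    obtain ⟨h1, h2, h3⟩ := hi
    have h1' : (i : ℕ) ≤ t := h1
    rw [Finset.mem_coe, PO.mem_Wd]
    refine ⟨Finset.mem_range.2 i.2, by omega, ?_, ?_⟩
    · simpa using h2
    · simpa using h3
  obtain ⟨i, hi, hij⟩ := hc (t + 1) (b 0) (b 1) key j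
  rw [PO.mem_Wd] at hi
  obtain ⟨h0, h1, h2, h3⟩ := hi
  have hin : i < n := Finset.mem_range.1 h0
  refine ⟨⟨i, hin⟩, ⟨?_, ?_, ?_⟩, hij⟩
  · exact Fin.mk_le_of_le_val (by omega)
  · simpa [hin] using h2
  · simpa [hin] using h3
end
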